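/- Let φ = (1+√5)/2 be the golden ratio, A := 2^{1/3}·Γ(1/6)·Γ(1/3)·Γ(1/2)/(8√3·π²), and B := Γ(2/3)³/(16π²). Then the box limit defining F(1,5,5,5) exists and (225/(32√5·π²))·F(1,5,5,5) = (A/φ^{1/3})·Σ_{n=0}^∞ ((1/3)_n)³/((2/3)_n (4/3)_n n!) · φ^{−n} + (3B/φ^{2/3})·Σ_{n=0}^∞ ((2/3)_n)³/((4/3)_n (5/3)_n n!) · φ^{−n}, where both series are convergent since 0 < 1/φ < 1. -/

import Mathlib

open Real Filter Topology

/-- The partial "box" sum appearing in the definition of the lattice sum `F(a,b,c,d)`. -/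
noncomputable def boxSum (a b c d : ℝ) (v : ℕ) : ℝ :=
  ∑ n₁ ∈ Finset.Icc (-(v:ℤ)) (v:ℤ), ∑ n₂ ∈ Finset.Icc (-(v:ℤ)) (v:ℤ),
    ∑ n₃ ∈ Finset.Icc (-(v:ℤ)) (v:ℤ), ∑ n₄ ∈ Finset.Icc (-(v:ℤ)) (v:ℤ),
      (-1:ℝ)^(n₁+n₂+n₃+n₄) /
        (a*((6*n₁+1:ℤ):ℝ)^2 + b*((6*n₂+1:ℤ):ℝ)^2 + c*((6*n₃+1:ℤ):ℝ)^2 + d*((6*n₄+1:ℤ):ℝ)^2)^2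

/-- The Pochhammer symbol `(a)_n`. -/
noncomputable def poch (a : ℝ) (n : ℕ) : ℝ := ∏ i ∈ Finset.range n, (a + i)

section TripleProduct

/-- The infinite `q`-Pochhammer symbol `(a; q)_∞`. -/
noncomputable def qInf {𝕜 : Type*} [NormedField 𝕜] (a q : 𝕜) : 𝕜 := ∏' n : ℕ, (1 - a * q ^ n)

/-- The theta series `∑ (-1)^n q^{n(n-1)/2} x^n`. -/
noncomputable def thetaJ {𝕜 : Type*} [NormedField 𝕜] (q x : 𝕜) : 𝕜 :=
  ∑' n : ℤ, (-1) ^ n * q ^ (n * (n - 1) / 2) * x ^ n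

/-- Gaussian binomial coefficients, defined by the Pascal recursion. -/
def gaussBinom {𝕜 : Type*} [Field 𝕜] (q : 𝕜) : ℕ → ℕ → 𝕜
  | _, 0 => 1
  | 0, _ + 1 => 0
  | n + 1, k + 1 => gaussBinom q n k + q ^ (k + 1) * gaussBinom q n (k + 1)

variable {𝕜 : Type*} [NormedField 𝕜]

theorem gaussBinom_eq_zero (q : 𝕜) : ∀ n k : ℕ, n < k → gaussBinom q n k = 0
  | _, 0, h => by simp at h
  | 0, k + 1, _ => by simp [gaussBinom]
  | n + 1, k + 1, h => by
    simp [gaussBinom, gaussBinom_eq_zero q n k (by omega),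
      gaussBinom_eq_zero q n (k + 1) (by omega)]

theorem gaussBinom_mul_prod (q : 𝕜) : ∀ n k : ℕ,
    gaussBinom q (n + k) k * ((∏ i ∈ Finset.range k, (1 - q ^ (i + 1))) *
      ∏ i ∈ Finset.range n, (1 - q ^ (i + 1))) = ∏ i ∈ Finset.range (n + k), (1 - q ^ (i + 1))
  | n, 0 => by simp [gaussBinom]
  | 0, k + 1 => by
    have h := gaussBinom_mul_prod q 0 k
    simp only [zero_add, Finset.range_zero, Finset.prod_empty, mul_one] at h ⊢
    rw [gaussBinom, gaussBinom_eq_zero q k (k + 1) (by omega), Finset.prod_range_succ]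
    linear_combination (1 - q ^ (k + 1)) * h
  | n + 1, k + 1 => by
    have h1 := gaussBinom_mul_prod q (n + 1) k
    have h2 := gaussBinom_mul_prod q n (k + 1)
    rw [show n + 1 + (k + 1) = (n + k + 1) + 1 by ring, gaussBinom,
      Finset.prod_range_succ _ (n + k + 1)]
    rw [show n + 1 + k = n + k + 1 by ring] at h1
    rw [show n + (k + 1) = n + k + 1 by ring] at h2
    rw [Finset.prod_range_succ _ k, Finset.prod_range_succ _ n] at *
    have e : q ^ (n + k + 1 + 1) = q ^ (k + 1) * q ^ (n + 1) := by ring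
    rw [e]
    linear_combination (1 - q ^ (k + 1)) * h1 + q ^ (k + 1) * (1 - q ^ (n + 1)) * h2

theorem prod_one_add_mul_pow (q y : 𝕜) (n : ℕ) :
    ∏ i ∈ Finset.range n, (1 + y * q ^ i) =
      ∑ k ∈ Finset.range (n + 1), q ^ (k * (k - 1) / 2) * gaussBinom q n k * y ^ k := by
  induction n generalizing y with
  | zero => simp [gaussBinom]
  | succ n ih =>
    have h : ∏ i ∈ Finset.range (n + 1), (1 + y * q ^ i) =
        (1 + y) * ∏ i ∈ Finset.range n, (1 + (y * q) * q ^ i) := by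
      rw [Finset.prod_range_succ']
      simp only [pow_zero, mul_one, pow_succ', ← mul_assoc]
      rw [mul_comm]
    rw [h, ih, Finset.sum_range_succ' _ (n + 1)]
    have e1 : ∑ k ∈ Finset.range (n + 1), q ^ ((k + 1) * (k + 1 - 1) / 2) *
        gaussBinom q (n + 1) (k + 1) * y ^ (k + 1) =
        ∑ k ∈ Finset.range (n + 1), y * (q ^ (k * (k - 1) / 2) * gaussBinom q n k * (y * q) ^ k) +
        ∑ k ∈ Finset.range (n + 1), q ^ ((k + 1) * (k + 1 - 1) / 2) * gaussBinom q n (k + 1) *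
          (y * q) ^ (k + 1) := by
      rw [← Finset.sum_add_distrib]
      refine Finset.sum_congr rfl fun k _ => ?_
      have : (k + 1) * (k + 1 - 1) / 2 = k * (k - 1) / 2 + k := by
        have := Nat.triangle_succ k
        simpa using this
      rw [gaussBinom, this, pow_add, mul_pow, mul_pow]
      ring
    have e2 := Finset.sum_range_succ' (fun k => q ^ (k * (k - 1) / 2) * gaussBinom q n k *
          (y * q) ^ k) (n + 1)
    rw [Finset.sum_range_succ, gaussBinom_eq_zero q n (n + 1) (by omega)] at e2
    rw [e1, add_mul, one_mul, Finset.mul_sum]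
    simp only [mul_zero, zero_mul, add_zero] at e2
    rw [e2]
    simp [gaussBinom]
    ring

theorem triangle_shift (k n : ℤ) :
    (k - n) * (k - n - 1) / 2 = k * (k - 1) / 2 - n * k + n * (n + 1) / 2 := by
  have h1 : (k * (k - 1)) % 2 = 0 := Int.even_iff.mp (by simpa using Int.even_mul_pred_self k)
  have h2 : (n * (n + 1)) % 2 = 0 := Int.even_iff.mp (Int.even_mul_succ_self n)
  have h3 : (k - n) * (k - n - 1) = k * (k - 1) + n * (n + 1) - 2 * (n * k) := by ring
  omega

theorem natCast_triangle (k : ℕ) : ((k * (k - 1) / 2 : ℕ) : ℤ) = (k : ℤ) * (k - 1) / 2 := by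
  cases k with
  | zero => simp
  | succ k => push_cast; simp

theorem prod_neg_mul_zpow {q x : 𝕜} (hq : q ≠ 0) (n : ℕ) :
    ∏ i ∈ Finset.range n, (-x * q ^ (-((i : ℤ) + 1))) =
      (-x) ^ (n : ℤ) * q ^ (-((n : ℤ) * (n + 1) / 2)) := by
  induction n with
  | zero => simp
  | succ n ih =>
    rw [Finset.prod_range_succ, ih]
    have : ((n : ℤ) + 1) * (n + 1 + 1) / 2 = (n : ℤ) * (n + 1) / 2 + (n + 1) := by
      have : ((n : ℤ) + 1) * (n + 1 + 1) = (n : ℤ) * (n + 1) + (n + 1) * 2 := by ring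
      omega
    have e : q ^ (-((n : ℤ) * (n + 1) / 2 + (n + 1))) =
        q ^ (-((n : ℤ) * (n + 1) / 2)) * q ^ (-((n : ℤ) + 1)) := by
      rw [neg_add, zpow_add₀ hq]
    push_cast
    rw [this, e, ← Nat.cast_succ, zpow_natCast, zpow_natCast, pow_succ]
    ring

theorem finite_triple_product {q x : 𝕜} (hq : q ≠ 0) (hx : x ≠ 0) (n : ℕ) :
    (∏ i ∈ Finset.range n, (1 - x * q ^ i)) * ∏ i ∈ Finset.range n, (1 - q / x * q ^ i) =
      ∑ k ∈ Finset.range (2 * n + 1), (-1) ^ ((k : ℤ) - n) *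
        q ^ (((k : ℤ) - n) * ((k : ℤ) - n - 1) / 2) * x ^ ((k : ℤ) - n) * gaussBinom q (2 * n) k := by
  have h := prod_one_add_mul_pow q (-x * q ^ (-(n : ℤ))) (2 * n)
  rw [two_mul, Finset.prod_range_add] at h
  have h2 : ∏ i ∈ Finset.range n, (1 + -x * q ^ (-(n : ℤ)) * q ^ (n + i)) =
      ∏ i ∈ Finset.range n, (1 - x * q ^ i) := by
    refine Finset.prod_congr rfl fun i _ => ?_
    rw [pow_add, zpow_neg, zpow_natCast]
    field_simp
    ring
  have h1 : ∏ i ∈ Finset.range n, (1 + -x * q ^ (-(n : ℤ)) * q ^ i) =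
      ((-x) ^ (n : ℤ) * q ^ (-((n : ℤ) * (n + 1) / 2))) *
        ∏ i ∈ Finset.range n, (1 - q / x * q ^ i) := by
    rw [← prod_neg_mul_zpow hq, ← Finset.prod_mul_distrib, ← Finset.prod_range_reflect]
    refine Finset.prod_congr rfl fun i hi => ?_
    have hi' : i < n := Finset.mem_range.mp hi
    rw [mul_assoc, ← zpow_natCast, ← zpow_add₀ hq,
      show -(n : ℤ) + ((n - 1 - i : ℕ) : ℤ) = -((i : ℤ) + 1) by omega, zpow_neg, zpow_add₀ hq]
    field_simp
    simp
    ring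
  rw [h1, h2] at h
  have hc : (-x) ^ (n : ℤ) * q ^ (-((n : ℤ) * (n + 1) / 2)) ≠ 0 :=
    mul_ne_zero (zpow_ne_zero _ (neg_ne_zero.mpr hx)) (zpow_ne_zero _ hq)
  apply mul_left_cancel₀ hc
  rw [two_mul]
  refine Eq.trans (by ring) (h.trans ?_)
  rw [Finset.mul_sum]
  refine Finset.sum_congr rfl fun k _ => ?_
  rw [triangle_shift, ← zpow_natCast q, natCast_triangle, ← zpow_natCast _ k, mul_zpow, ← zpow_mul]
  have e : (-1 : 𝕜) ^ ((k : ℤ) - n) * x ^ ((k : ℤ) - n) = (-x) ^ (k : ℤ) * ((-x) ^ (n : ℤ))⁻¹ := by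
    rw [← mul_zpow, neg_one_mul, zpow_sub₀ (neg_ne_zero.mpr hx), div_eq_mul_inv]
  have e2 : q ^ ((k : ℤ) * (k - 1) / 2 - n * k + n * (n + 1) / 2) =
      q ^ ((k : ℤ) * (k - 1) / 2) * q ^ (-(n : ℤ) * k) * q ^ ((n : ℤ) * (n + 1) / 2) := by
    rw [← zpow_add₀ hq, ← zpow_add₀ hq]
    congr 1
    ring
  have e3 : (-x) ^ (n : ℤ) ≠ 0 := zpow_ne_zero _ (neg_ne_zero.mpr hx)
  have e4 : q ^ ((n : ℤ) * (n + 1) / 2) ≠ 0 := zpow_ne_zero _ hq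
  rw [e2, zpow_neg q ((n : ℤ) * (n + 1) / 2)]
  calc _ = q ^ ((k : ℤ) * (k - 1) / 2) * gaussBinom q (n + n) k * q ^ (-(n : ℤ) * k) *
        (-x) ^ (k : ℤ) := by ring
    _ = ((-x) ^ (n : ℤ) * (q ^ ((n : ℤ) * (n + 1) / 2))⁻¹) * (((-1 : 𝕜) ^ ((k : ℤ) - n) *
          x ^ ((k : ℤ) - n)) * (q ^ ((k : ℤ) * (k - 1) / 2) * q ^ (-(n : ℤ) * k) *
          q ^ ((n : ℤ) * (n + 1) / 2)) * gaussBinom q (n + n) k) := by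
        rw [e]; field_simp
    _ = _ := by ring

theorem summable_norm_thetaJ {q x : 𝕜} (hq0 : q ≠ 0) (hq : ‖q‖ < 1) (hx : x ≠ 0) :
    Summable fun n : ℤ => ‖(-1) ^ n * q ^ (n * (n - 1) / 2) * x ^ n‖ := by
  have key : ∀ y : 𝕜, y ≠ 0 → Summable fun n : ℕ => ‖q ^ ((n : ℤ) * (n - 1) / 2) * y ^ n‖ := by
    intro y hy
    refine summable_of_ratio_test_tendsto_lt_one (l := 0) one_pos
      (Eventually.of_forall fun n => norm_ne_zero_iff.mpr
        (mul_ne_zero (zpow_ne_zero _ hq0) (pow_ne_zero _ hy))) ?_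
    have : Tendsto (fun n : ℕ => ‖q‖ ^ n * ‖y‖) atTop (𝓝 (0 * ‖y‖)) :=
      (tendsto_pow_atTop_nhds_zero_of_lt_one (norm_nonneg q) hq).mul_const _
    rw [zero_mul] at this
    refine this.congr fun n => ?_
    have e : (((n + 1 : ℕ) : ℤ)) * ((n + 1 : ℕ) - 1) / 2 = (n : ℤ) * (n - 1) / 2 + n := by
      have : (((n + 1 : ℕ) : ℤ)) * ((n + 1 : ℕ) - 1) = (n : ℤ) * (n - 1) + n * 2 := by
        push_cast; ring
      omega
    have h1 : ‖q‖ ≠ 0 := norm_ne_zero_iff.mpr hq0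
    have h2 : ‖y‖ ≠ 0 := norm_ne_zero_iff.mpr hy
    have h3 : ‖q‖ ^ ((n : ℤ) * (n - 1) / 2) ≠ 0 := zpow_ne_zero _ h1
    simp only [norm_norm, norm_mul, norm_pow, norm_zpow]
    rw [e, zpow_add₀ h1, zpow_natCast, pow_succ]
    field_simp
  refine Summable.of_nat_of_neg ?_ ?_
  · refine (key x hx).congr fun n => ?_
    simp [norm_mul]
  · refine (key (q / x) (div_ne_zero hq0 hx)).congr fun n => ?_
    have e : -(n : ℤ) * (-(n : ℤ) - 1) / 2 = (n : ℤ) * (n - 1) / 2 + n := by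
      have : -(n : ℤ) * (-(n : ℤ) - 1) = (n : ℤ) * (n - 1) + n * 2 := by ring
      omega
    rw [e, zpow_add₀ hq0]
    simp [norm_mul, div_pow]
    ring

theorem prod_one_sub_pow_ne_zero {q : 𝕜} (hq : ‖q‖ < 1) (n : ℕ) :
    ∏ i ∈ Finset.range n, (1 - q ^ (i + 1)) ≠ 0 := by
  refine Finset.prod_ne_zero_iff.mpr fun i _ h => ?_
  have h1 : ‖q ^ (i + 1)‖ = 1 := by rw [← sub_eq_zero.mp h, norm_one]
  rw [norm_pow] at h1
  exact absurd h1 (pow_lt_one₀ (norm_nonneg q) hq (Nat.succ_ne_zero i)).ne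

variable [CompleteSpace 𝕜]

theorem multipliable_qInf {a q : 𝕜} (hq : ‖q‖ < 1) : Multipliable fun n : ℕ => 1 - a * q ^ n := by
  have : Summable fun n : ℕ => ‖-(a * q ^ n)‖ := by
    simpa [norm_mul, norm_pow] using
      (summable_geometric_of_lt_one (norm_nonneg q) hq).mul_left ‖a‖
  simpa [sub_eq_add_neg] using multipliable_one_add_of_summable this

theorem tendsto_qInf {a q : 𝕜} (hq : ‖q‖ < 1) :
    Tendsto (fun n => ∏ i ∈ Finset.range n, (1 - a * q ^ i)) atTop (𝓝 (qInf a q)) :=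
  (multipliable_qInf hq).hasProd.tendsto_prod_nat

theorem qInf_ne_zero {a q : 𝕜} (hq : ‖q‖ < 1) (h : ∀ n : ℕ, a * q ^ n ≠ 1) : qInf a q ≠ 0 := by
  have : Summable fun n : ℕ => ‖-(a * q ^ n)‖ := by
    simpa [norm_mul, norm_pow] using
      (summable_geometric_of_lt_one (norm_nonneg q) hq).mul_left ‖a‖
  have := tprod_one_add_ne_zero_of_summable (f := fun n : ℕ => -(a * q ^ n))
    (fun i => by simpa [← sub_eq_add_neg, sub_eq_zero] using (h i).symm) this
  simpa [qInf, sub_eq_add_neg] using this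

theorem qInf_ne_zero_of_norm_lt {a q : 𝕜} (hq : ‖q‖ < 1) (ha : ‖a‖ < 1) : qInf a q ≠ 0 := by
  refine qInf_ne_zero hq fun n h => ?_
  have h1 : ‖a * q ^ n‖ = 1 := by rw [h, norm_one]
  rw [norm_mul, norm_pow] at h1
  have : ‖q‖ ^ n ≤ 1 := pow_le_one₀ (norm_nonneg _) hq.le
  nlinarith [norm_nonneg a]

theorem tendsto_prod_one_sub_pow {q : 𝕜} (hq : ‖q‖ < 1) :
    Tendsto (fun n => ∏ i ∈ Finset.range n, (1 - q ^ (i + 1))) atTop (𝓝 (qInf q q)) := by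
  simpa [pow_succ'] using tendsto_qInf (a := q) hq

theorem exists_norm_gaussBinom_le {q : 𝕜} (hq : ‖q‖ < 1) :
    ∃ M : ℝ, ∀ n k, ‖gaussBinom q n k‖ ≤ M := by
  have hT := tendsto_prod_one_sub_pow hq
  have h0 := qInf_ne_zero_of_norm_lt hq hq
  obtain ⟨C, hC⟩ := (hT.norm).bddAbove_range
  obtain ⟨D, hD⟩ := ((hT.inv₀ h0).norm).bddAbove_range
  have hC' : ∀ n, ‖∏ i ∈ Finset.range n, (1 - q ^ (i + 1))‖ ≤ C := fun n => hC ⟨n, rfl⟩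
  have hD' : ∀ n, ‖(∏ i ∈ Finset.range n, (1 - q ^ (i + 1)))⁻¹‖ ≤ D := fun n => hD ⟨n, rfl⟩
  have hC0 : 0 ≤ C := (norm_nonneg _).trans (hC' 0)
  have hD0 : 0 ≤ D := (norm_nonneg _).trans (hD' 0)
  refine ⟨C * (D * D), fun n k => ?_⟩
  rcases lt_or_ge n k with h | h
  · rw [gaussBinom_eq_zero q n k h, norm_zero]; positivity
  · obtain ⟨m, rfl⟩ := Nat.exists_eq_add_of_le' h
    have e := gaussBinom_mul_prod q m k
    have e' : gaussBinom q (m + k) k = (∏ i ∈ Finset.range (m + k), (1 - q ^ (i + 1))) *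
        ((∏ i ∈ Finset.range k, (1 - q ^ (i + 1)))⁻¹ *
          (∏ i ∈ Finset.range m, (1 - q ^ (i + 1)))⁻¹) := by
      rw [← e]
      have := prod_one_sub_pow_ne_zero hq k
      have := prod_one_sub_pow_ne_zero hq m
      field_simp
    rw [e', norm_mul, norm_mul]
    gcongr
    · exact hC' _
    · exact hD' _
    · exact hD' _

/-- **Jacobi triple product.** -/
theorem thetaJ_eq_qInf {q x : 𝕜} (hq0 : q ≠ 0) (hq : ‖q‖ < 1) (hx : x ≠ 0) :
    thetaJ q x = qInf x q * qInf (q / x) q * qInf q q := by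
  obtain ⟨M, hM⟩ := exists_norm_gaussBinom_le hq
  have hT := tendsto_prod_one_sub_pow hq
  have h0 := qInf_ne_zero_of_norm_lt hq hq
  set g : ℕ → ℤ → 𝕜 := fun n m => if -(n : ℤ) ≤ m then gaussBinom q (2 * n) (m + n).toNat else 0
    with hg
  set F : ℤ → 𝕜 := fun n => (-1) ^ n * q ^ (n * (n - 1) / 2) * x ^ n with hF
  have hfin : ∀ n : ℕ, ∑' m, F m * g n m =
      (∏ i ∈ Finset.range n, (1 - x * q ^ i)) * ∏ i ∈ Finset.range n, (1 - q / x * q ^ i) := by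
    intro n
    obtain ⟨e, he⟩ : ∃ e : ℕ ↪ ℤ, ∀ k : ℕ, e k = (k : ℤ) - n :=
      ⟨⟨fun k : ℕ => (k : ℤ) - n, fun a b h => by simpa using h⟩, fun _ => rfl⟩
    rw [finite_triple_product hq0 hx, tsum_eq_sum (s := (Finset.range (2 * n + 1)).map e)]
    · rw [Finset.sum_map]
      refine Finset.sum_congr rfl fun k _ => ?_
      simp [hg, hF, he]
    · intro m hm
      have hm' : ∀ k < 2 * n + 1, (k : ℤ) - n ≠ m := by simpa [he] using hm
      by_cases h : -(n : ℤ) ≤ m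
      · have : 2 * n < (m + n).toNat := by
          by_contra hc
          exact hm' (m + n).toNat (by omega) (by omega)
        simp [hg, gaussBinom_eq_zero q _ _ this]
      · simp [hg, h]
  have hlim : Tendsto (fun n => ∑' m, F m * g n m) atTop (𝓝 (∑' m, F m * (qInf q q)⁻¹)) := by
    refine tendsto_tsum_of_dominated_convergence
      ((summable_norm_thetaJ hq0 hq hx).mul_right M) (fun m => ?_) ?_
    · refine Tendsto.const_mul _ ?_
      have hA : Tendsto (fun n : ℕ => 2 * n) atTop atTop :=
        tendsto_id.const_mul_atTop' (by norm_num)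
      have hB : Tendsto (fun n : ℕ => (m + n).toNat) atTop atTop :=
        tendsto_atTop.mpr fun b => (eventually_ge_atTop (b + m.natAbs)).mono fun n hn => by omega
      have hC : Tendsto (fun n : ℕ => (n - m).toNat) atTop atTop :=
        tendsto_atTop.mpr fun b => (eventually_ge_atTop (b + m.natAbs)).mono fun n hn => by omega
      have := (hT.comp hA).mul (((hT.comp hB).inv₀ h0).mul ((hT.comp hC).inv₀ h0))
      have e : qInf q q * ((qInf q q)⁻¹ * (qInf q q)⁻¹) = (qInf q q)⁻¹ := by field_simp
      rw [e] at this
      refine this.congr' ((eventually_ge_atTop m.natAbs).mono fun n hn => ?_)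
      have e1 := gaussBinom_mul_prod q (n - m).toNat (m + n).toNat
      have e2 : (n - m).toNat + (m + n).toNat = 2 * n := by omega
      have e3 : -(n : ℤ) ≤ m := by omega
      rw [e2] at e1
      simp only [Function.comp, hg, if_pos e3]
      rw [← e1]
      have := prod_one_sub_pow_ne_zero hq (n - m).toNat
      have := prod_one_sub_pow_ne_zero hq (m + n).toNat
      field_simp
    · refine Eventually.of_forall fun n m => ?_
      rw [norm_mul]
      refine mul_le_mul_of_nonneg_left ?_ (norm_nonneg _)
      by_cases h : -(n : ℤ) ≤ m
      · simpa [hg, h] using hM _ _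
      · simpa [hg, h] using (norm_nonneg _).trans (hM 0 0)
  have hlim2 := (tendsto_qInf (a := x) hq).mul (tendsto_qInf (a := q / x) hq)
  have := tendsto_nhds_unique (hlim.congr hfin) hlim2
  rw [tsum_mul_right] at this
  rw [thetaJ, ← this]
  field_simp
  rfl

end TripleProduct

section Laurent

/-- `f` is the sum of the everywhere absolutely convergent Laurent series with coefficients `c`. -/
def IsLaurent (f : ℂ → ℂ) (c : ℤ → ℂ) : Prop :=
  ∀ x ≠ 0, (Summable fun n => ‖c n * x ^ n‖) ∧ f x = ∑' n, c n * x ^ n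

namespace IsLaurent

variable {f g : ℂ → ℂ} {c d : ℤ → ℂ}

theorem hasSum (h : IsLaurent f c) {x : ℂ} (hx : x ≠ 0) : HasSum (fun n => c n * x ^ n) (f x) := by
  rw [(h x hx).2]
  exact (h x hx).1.of_norm.hasSum

theorem congr (h : IsLaurent f c) (hfg : ∀ x ≠ 0, g x = f x) : IsLaurent g c :=
  fun x hx => ⟨(h x hx).1, (hfg x hx).trans (h x hx).2⟩

theorem add (hf : IsLaurent f c) (hg : IsLaurent g d) :
    IsLaurent (fun x => f x + g x) (fun n => c n + d n) := fun x hx => by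
  constructor
  · refine Summable.of_nonneg_of_le (fun _ => norm_nonneg _) (fun n => ?_)
      ((hf x hx).1.add (hg x hx).1)
    rw [add_mul]
    exact norm_add_le _ _
  · beta_reduce
    rw [← ((hf.hasSum hx).add (hg.hasSum hx)).tsum_eq]
    simp only [add_mul]

theorem const_mul (hf : IsLaurent f c) (a : ℂ) :
    IsLaurent (fun x => a * f x) (fun n => a * c n) := fun x hx => by
  constructor
  · simpa [mul_assoc] using (hf x hx).1.mul_left ‖a‖
  · beta_reduce
    rw [← ((hf.hasSum hx).mul_left a).tsum_eq]
    simp only [mul_assoc]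

theorem zpow_mul (hf : IsLaurent f c) (k : ℤ) :
    IsLaurent (fun x => x ^ k * f x) (fun n => c (n - k)) := fun x hx => by
  have e : ∀ n, c (n - k) * x ^ n = x ^ k * (c (n - k) * x ^ (n - k)) := fun n => by
    rw [zpow_sub₀ hx]
    have := zpow_ne_zero k hx
    field_simp
  constructor
  · simp only [e]
    have := ((Equiv.subRight k).summable_iff.mpr (hf x hx).1).mul_left ‖x ^ k‖
    simpa [norm_mul] using this
  · have := (((Equiv.subRight k).hasSum_iff.mpr (hf.hasSum hx)).mul_left (x ^ k)).tsum_eq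
    simp only [e]
    exact this.symm

theorem comp_mul_left (hf : IsLaurent f c) {a : ℂ} (ha : a ≠ 0) :
    IsLaurent (fun x => f (a * x)) (fun n => c n * a ^ n) := fun x hx => by
  have := hf (a * x) (mul_ne_zero ha hx)
  simpa only [mul_zpow, mul_assoc] using this

theorem comp_inv (hf : IsLaurent f c) : IsLaurent (fun x => f x⁻¹) (fun n => c (-n)) :=
  fun x hx => by
  have h := hf x⁻¹ (inv_ne_zero hx)
  constructor
  · have := (Equiv.neg ℤ).summable_iff.mpr h.1
    simpa [Function.comp_def] using this
  · beta_reduce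
    rw [h.2, ← (Equiv.neg ℤ).tsum_eq]
    simp

theorem mul (hf : IsLaurent f c) (hg : IsLaurent g d) :
    IsLaurent (fun x => f x * g x) (fun N => ∑' n, c n * d (N - n)) := fun x hx => by
  have hs := (hf x hx).1.mul_norm (hg x hx).1
  let e : ℤ × ℤ ≃ ℤ × ℤ :=
    { toFun := fun p => (p.2, p.1 - p.2)
      invFun := fun p => (p.1 + p.2, p.1)
      left_inv := fun p => by ext <;> simp
      right_inv := fun p => by ext <;> simp }
  have ht : ∀ p : ℤ × ℤ, c (e p).1 * x ^ (e p).1 * (d (e p).2 * x ^ (e p).2) =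
      c p.2 * d (p.1 - p.2) * x ^ p.1 := fun p => by
    simp only [e, Equiv.coe_fn_mk]
    rw [zpow_sub₀ hx]
    have := zpow_ne_zero p.2 hx
    field_simp
  have hs2 : Summable fun p : ℤ × ℤ => ‖c p.2 * d (p.1 - p.2) * x ^ p.1‖ := by
    have := e.summable_iff.mpr hs
    refine this.congr fun p => ?_
    rw [← ht]
    rfl
  have hin : ∀ N : ℤ, Summable fun n => ‖c n * d (N - n) * x ^ N‖ := fun N => hs2.prod_factor N
  constructor
  · refine Summable.of_nonneg_of_le (fun _ => norm_nonneg _) (fun N => ?_) hs2.prod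
    rw [← tsum_mul_right]
    exact norm_tsum_le_tsum_norm (hin N)
  · beta_reduce
    rw [(hf x hx).2, (hg x hx).2, tsum_mul_tsum_of_summable_norm (hf x hx).1 (hg x hx).1,
      ← e.tsum_eq]
    simp only [ht]
    rw [hs2.of_norm.tsum_prod]
    simp only [tsum_mul_right]

theorem eq_zero (h : IsLaurent (fun _ => 0) c) (m : ℤ) : c m = 0 := by
  have hs : Summable fun n => ‖c n‖ := by simpa using (h 1 one_ne_zero).1
  let F : ℤ → C(ℝ, ℂ) := fun n =>
    ⟨fun t => c n * Complex.exp (2 * π * Complex.I * (n - m : ℤ) * t), by fun_prop⟩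
  have hF : ∀ n t, ‖F n t‖ = ‖c n‖ := fun n t => by
    simp only [F, ContinuousMap.coe_mk, norm_mul]
    rw [show 2 * π * Complex.I * (n - m : ℤ) * t = ((2 * π * (n - m : ℤ) * t : ℝ) : ℂ) * Complex.I by
      push_cast; ring, Complex.norm_exp_ofReal_mul_I, mul_one]
  have hsum := intervalIntegral.hasSum_intervalIntegral_of_summable_norm (a := 0) (b := 1) (f := F) (by
    refine Summable.of_nonneg_of_le (fun _ => norm_nonneg _) (fun n => ?_) hs
    refine (ContinuousMap.norm_le _ (norm_nonneg _)).mpr fun t => ?_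
    exact (hF n t).le)
  have hz : ∀ t : ℝ, ∑' n, F n t = 0 := fun t => by
    have hx := Complex.exp_ne_zero (2 * π * Complex.I * t)
    have := (h _ hx).2
    have e : ∀ n, F n t = c n * Complex.exp (2 * π * Complex.I * t) ^ n *
        Complex.exp (2 * π * Complex.I * t) ^ (-m) := fun n => by
      rw [mul_assoc, ← zpow_add₀ hx, ← Complex.exp_int_mul]
      simp only [F, ContinuousMap.coe_mk]
      congr 2
      push_cast
      ring
    simp only [e]
    rw [tsum_mul_right, ← this, zero_mul]
  have hI : ∀ n, ∫ t in (0 : ℝ)..1, F n t = if n = m then c m else 0 := fun n => by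
    split_ifs with hnm
    · subst hnm
      simp [F]
    · simp only [F, ContinuousMap.coe_mk]
      rw [intervalIntegral.integral_const_mul]
      have hk : (2 * π * Complex.I * (n - m : ℤ) : ℂ) ≠ 0 := by
        refine mul_ne_zero (by simp [Real.pi_ne_zero]) ?_
        exact_mod_cast sub_ne_zero.mpr hnm
      rw [integral_exp_mul_complex hk]
      have : Complex.exp (2 * π * Complex.I * (n - m : ℤ) * (1 : ℝ)) = 1 := by
        rw [Complex.ofReal_one, mul_one, mul_comm]
        exact Complex.exp_int_mul_two_pi_mul_I _
      rw [this]
      simp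
  simp only [hz, hI, intervalIntegral.integral_zero] at hsum
  exact ((hasSum_ite_eq m (c m)).unique hsum)

theorem coeff_eq (hf : IsLaurent f c) (hg : IsLaurent g d) (h : ∀ x ≠ 0, f x = g x) (n : ℤ) :
    c n = d n := by
  have := ((hf.add (hg.const_mul (-1))).congr (g := fun _ => 0)
    (fun x hx => by simp [h x hx])).eq_zero n
  linear_combination this

/-- Termwise differentiation in the logarithmic variable. -/
theorem hasDerivAt_exp (hf : IsLaurent f c) :
    HasDerivAt (fun w => f (Complex.exp w)) (∑' n : ℤ, n * c n) 0 := by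
  have h1 := (hf (Complex.exp 2) (Complex.exp_ne_zero _)).1
  have h2 := (hf (Complex.exp (-2)) (Complex.exp_ne_zero _)).1
  have hb : ∀ (n : ℤ) (w : ℂ), w ∈ Metric.ball (0 : ℂ) 1 → ‖c n * (n * Complex.exp (n * w))‖ ≤
      ‖c n * Complex.exp 2 ^ n‖ + ‖c n * Complex.exp (-2) ^ n‖ := fun n w hw => by
    have hw' : ‖w‖ < 1 := by simpa using hw
    rw [norm_mul (c n), norm_mul (c n), norm_mul (c n), norm_mul, ← mul_add, ← Complex.exp_int_mul, ← Complex.exp_int_mul]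
    refine mul_le_mul_of_nonneg_left ?_ (norm_nonneg _)
    rw [Complex.norm_exp, Complex.norm_exp, Complex.norm_exp, Complex.norm_intCast]
    have e1 : (n * w).re ≤ |(n : ℝ)| := by
      calc (n * w).re ≤ ‖(n : ℂ) * w‖ := Complex.re_le_norm _
        _ = |(n : ℝ)| * ‖w‖ := by rw [norm_mul, Complex.norm_intCast]
        _ ≤ |(n : ℝ)| * 1 := by gcongr
        _ = _ := mul_one _
    have e2 : |(n : ℝ)| ≤ Real.exp |(n : ℝ)| := by linarith [Real.add_one_le_exp |(n : ℝ)|]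
    calc |(n : ℝ)| * Real.exp (n * w).re ≤ Real.exp |(n : ℝ)| * Real.exp |(n : ℝ)| := by
          gcongr
      _ = Real.exp (2 * |(n : ℝ)|) := by rw [← Real.exp_add]; ring_nf
      _ ≤ _ := by
        rcases abs_cases (n : ℝ) with ⟨h, _⟩ | ⟨h, _⟩
        · rw [h]
          have : ((n : ℂ) * 2).re = 2 * (n : ℝ) := by simp [mul_comm]
          rw [this]
          linarith [Real.exp_pos ((n : ℂ) * (-2)).re]
        · rw [h]
          have : ((n : ℂ) * (-2)).re = 2 * -(n : ℝ) := by simp [mul_comm]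
          rw [this]
          linarith [Real.exp_pos ((n : ℂ) * 2).re]
  have hd := hasDerivAt_tsum_of_isPreconnected (g := fun (n : ℤ) w => c n * Complex.exp (n * w))
    (g' := fun n w => c n * (n * Complex.exp (n * w))) (h1.add h2) Metric.isOpen_ball
    (convex_ball (0 : ℂ) 1).isPreconnected (fun n w _ => by
      have : HasDerivAt (fun w : ℂ => (n : ℂ) * w) n w := by
        simpa using (hasDerivAt_id w).const_mul (n : ℂ)
      have := this.cexp.const_mul (c n)
      simpa only [mul_comm (n : ℂ) (Complex.exp _)] using this) hb (Metric.mem_ball_self one_pos) (by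
      have := (hf 1 one_ne_zero).1.of_norm
      simpa using this) (Metric.mem_ball_self one_pos)
  have e1 : (fun w => f (Complex.exp w)) = fun w => ∑' n : ℤ, c n * Complex.exp (n * w) := by
    funext w
    rw [(hf _ (Complex.exp_ne_zero w)).2]
    simp only [Complex.exp_int_mul]
  have e2 : ∑' n : ℤ, n * c n = ∑' n : ℤ, c n * (n * Complex.exp (n * 0)) := by
    simp [mul_comm]
  rw [e1, e2]
  exact hd

end IsLaurent

theorem isLaurent_thetaJ {q : ℂ} (hq0 : q ≠ 0) (hq : ‖q‖ < 1) :
    IsLaurent (thetaJ q) (fun n => (-1) ^ n * q ^ (n * (n - 1) / 2)) :=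
  fun _ hx => ⟨summable_norm_thetaJ hq0 hq hx, rfl⟩

end Laurent

section QProducts

variable {𝕜 : Type*} [NormedField 𝕜] [CompleteSpace 𝕜] {q : 𝕜}

theorem qInf_eq_prod_pow (hq : ‖q‖ < 1) (a : 𝕜) {k : ℕ} (hk : k ≠ 0) :
    qInf a q = ∏ i ∈ Finset.range k, qInf (a * q ^ i) (q ^ k) := by
  have hqk : ‖q ^ k‖ < 1 := by
    rw [norm_pow]
    exact pow_lt_one₀ (norm_nonneg _) hq hk
  have h1 := (tendsto_qInf hq (a := a)).comp (tendsto_id.const_mul_atTop' (Nat.pos_of_ne_zero hk))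
  have h2 := tendsto_finsetProd (Finset.range k) fun i _ => tendsto_qInf hqk (a := a * q ^ i)
  refine tendsto_nhds_unique (h1.congr fun N => ?_) h2
  simp only [Function.comp_apply, id]
  induction N with
  | zero => simp
  | succ N ih =>
    rw [mul_add, mul_one, Finset.prod_range_add, ih]
    simp only [Finset.prod_range_succ _ N]
    rw [Finset.prod_mul_distrib]
    congr 1
    refine Finset.prod_congr rfl fun i _ => ?_
    ring

theorem qInf_eq_mul_sq (hq : ‖q‖ < 1) (a : 𝕜) :
    qInf a q = qInf a (q ^ 2) * qInf (a * q) (q ^ 2) := by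
  rw [qInf_eq_prod_pow hq a two_ne_zero]
  simp [Finset.prod_range_succ]

theorem qInf_mul_qInf_neg (hq : ‖q‖ < 1) (a : 𝕜) :
    qInf a q * qInf (-a) q = qInf (a ^ 2) (q ^ 2) := by
  have hq2 : ‖q ^ 2‖ < 1 := by
    rw [norm_pow]
    exact pow_lt_one₀ (norm_nonneg _) hq two_ne_zero
  refine tendsto_nhds_unique ((tendsto_qInf hq (a := a)).mul (tendsto_qInf hq (a := -a)))
    ((tendsto_qInf hq2 (a := a ^ 2)).congr fun N => ?_)
  rw [← Finset.prod_mul_distrib]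
  refine Finset.prod_congr rfl fun i _ => ?_
  ring

theorem qInf_eq_one_sub_mul (hq : ‖q‖ < 1) (a : 𝕜) : qInf a q = (1 - a) * qInf (a * q) q := by
  refine tendsto_nhds_unique ((tendsto_qInf hq (a := a)).comp (tendsto_add_atTop_nat 1))
    (((tendsto_qInf hq (a := a * q)).const_mul (1 - a)).congr fun N => ?_)
  simp only [Function.comp_apply]
  rw [Finset.prod_range_succ', mul_comm]
  simp [pow_succ', mul_assoc]

@[simp] theorem qInf_one (hq : ‖q‖ < 1) : qInf 1 q = 0 := by
  rw [qInf_eq_one_sub_mul hq]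
  simp

end QProducts

theorem Int.mul_sub_one_ediv_two_add (n : ℤ) : n * (n - 1) / 2 + n = (n + 1) * n / 2 := by
  rw [show (n + 1) * n = n * (n - 1) + n * 2 by ring, Int.add_mul_ediv_right _ _ two_ne_zero]

section ThetaFunctional

variable {𝕜 : Type*} [NormedField 𝕜] {q x : 𝕜}

theorem thetaJ_mul_left (hq0 : q ≠ 0) (hx : x ≠ 0) :
    thetaJ q (q * x) = -x⁻¹ * thetaJ q x := by
  unfold thetaJ
  rw [← tsum_mul_left]
  conv_rhs => rw [← (Equiv.addRight (1 : ℤ)).tsum_eq]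
  refine tsum_congr fun n => ?_
  simp only [Equiv.coe_addRight]
  rw [add_sub_cancel_right, ← Int.mul_sub_one_ediv_two_add, mul_zpow, zpow_add₀ hq0, zpow_add₀ hx,
    zpow_add₀ (by simp : (-1 : 𝕜) ≠ 0)]
  field_simp

theorem thetaJ_div (hq0 : q ≠ 0) : thetaJ q (q / x) = thetaJ q x := by
  unfold thetaJ
  rw [← (Equiv.neg ℤ).tsum_eq]
  refine tsum_congr fun n => ?_
  simp only [Equiv.neg_apply]
  rw [div_zpow, zpow_neg x, div_eq_mul_inv, inv_inv, show -n * (-n - 1) = (n + 1) * n by ring,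
    ← Int.mul_sub_one_ediv_two_add, zpow_add₀ hq0, zpow_neg q,
    show (-1 : 𝕜) ^ (-n) = (-1) ^ n by rw [zpow_neg, ← inv_zpow]; norm_num]
  have := zpow_ne_zero n hq0
  field_simp

theorem thetaJ_inv (hq0 : q ≠ 0) (hx : x ≠ 0) : thetaJ q x⁻¹ = -x⁻¹ * thetaJ q x := by
  have h := thetaJ_div (x := x⁻¹) hq0
  rw [div_inv_eq_mul, thetaJ_mul_left hq0 hx] at h
  exact h.symm

theorem thetaJ_one [CompleteSpace 𝕜] (hq0 : q ≠ 0) (hq : ‖q‖ < 1) : thetaJ q 1 = 0 := by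
  rw [thetaJ_eq_qInf hq0 hq one_ne_zero, qInf_one hq]
  simp

end ThetaFunctional

theorem Int.eq_of_succ_eq {α : Type*} {e : ℤ → α} (h : ∀ n, e (n + 1) = e n) (n : ℤ) :
    e n = e 0 := by
  induction n using Int.induction_on with
  | zero => rfl
  | succ n ih => rw [h, ih]
  | pred n ih => rw [← ih, ← h, sub_add_cancel]

theorem coeff_of_recurrence {q : ℂ} (hq0 : q ≠ 0) {c : ℤ → ℂ} {a : ℂ} (ha : a ≠ 0)
    (h : ∀ n, c (n + 1) = -(a * q ^ n) * c n) (n : ℤ) :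
    c n = c 0 * ((-1) ^ n * q ^ (n * (n - 1) / 2) * a ^ n) := by
  have hd : ∀ n : ℤ, (-1 : ℂ) ^ n * q ^ (n * (n - 1) / 2) * a ^ n ≠ 0 := fun n =>
    mul_ne_zero (mul_ne_zero (zpow_ne_zero _ (by simp)) (zpow_ne_zero _ hq0)) (zpow_ne_zero _ ha)
  have key := Int.eq_of_succ_eq (e := fun n => c n / ((-1) ^ n * q ^ (n * (n - 1) / 2) * a ^ n))
    (fun n => by
      rw [div_eq_div_iff (hd _) (hd _), h, add_sub_cancel_right, ← Int.mul_sub_one_ediv_two_add,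
        zpow_add₀ hq0, zpow_add₀ (by simp : (-1 : ℂ) ≠ 0), zpow_add₀ ha,
        zpow_one, zpow_one]
      ring) n
  simp only [zpow_zero] at key
  rw [div_eq_iff (hd n)] at key
  simpa using key

namespace IsLaurent

variable {f g : ℂ → ℂ} {c d : ℤ → ℂ} {q : ℂ}

theorem comp_pow (hf : IsLaurent f c) {k : ℕ} (hk : k ≠ 0) :
    IsLaurent (fun x => f (x ^ k)) (Function.extend (fun n : ℤ => k * n) c 0) := fun x hx => by
  have hi : Function.Injective fun n : ℤ => (k : ℤ) * n :=
    mul_right_injective₀ (by exact_mod_cast hk)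
  have h := hf (x ^ k) (pow_ne_zero k hx)
  have e : ∀ n : ℤ, Function.extend (fun n : ℤ => (k : ℤ) * n) c 0 (k * n) * x ^ ((k : ℤ) * n) =
      c n * (x ^ k) ^ n := fun n => by
    rw [hi.extend_apply, _root_.zpow_mul, zpow_natCast]
  have ez : ∀ N ∉ Set.range (fun n : ℤ => (k : ℤ) * n),
      Function.extend (fun n : ℤ => (k : ℤ) * n) c 0 N * x ^ N = 0 := fun N hN => by
    rw [Function.extend_apply' _ _ _ (by simpa using hN)]
    simp
  constructor
  · rw [← hi.summable_iff (fun N hN => by rw [ez N hN, norm_zero])]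
    simpa only [Function.comp_def, e] using h.1
  · beta_reduce
    rw [h.2, ← hi.tsum_eq (f := fun N => Function.extend (fun n : ℤ => (k : ℤ) * n) c 0 N * x ^ N)
      (fun N hN => by
        by_contra hc
        exact hN (ez N hc))]
    simp only [e]

/-- Laurent series with the functional equation of `thetaJ` are multiples of it. -/
theorem eq_const_mul_thetaJ (hf : IsLaurent f c) (hq0 : q ≠ 0)
    (h : ∀ x ≠ 0, f (q * x) = -x⁻¹ * f x) : ∃ C, ∀ x ≠ 0, f x = C * thetaJ q x := by
  have hc := (hf.comp_mul_left hq0).coeff_eq ((hf.zpow_mul (-1)).const_mul (-1)) (fun x hx => by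
    rw [h x hx, zpow_neg_one]
    ring)
  have hr : ∀ n, c (n + 1) = -(1 * q ^ n) * c n := fun n => by
    have := hc n
    rw [sub_neg_eq_add] at this
    linear_combination this
  refine ⟨c 0, fun x hx => ?_⟩
  rw [(hf x hx).2, thetaJ, ← tsum_mul_left]
  refine tsum_congr fun n => ?_
  rw [coeff_of_recurrence hq0 one_ne_zero hr n, one_zpow]
  ring

end IsLaurent

theorem tsum_int_eq_sum_mod {E : Type*} [NormedAddCommGroup E] [CompleteSpace E] {g : ℤ → E}
    (hg : Summable g) (k : ℕ) [NeZero k] :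
    ∑' n, g n = ∑ i : Fin k, ∑' m : ℤ, g (k * m + (i : ℕ)) := by
  let e : Fin k × ℤ ≃ ℤ := (Equiv.prodComm _ _).trans (Int.divModEquiv k).symm
  have he : ∀ p, e p = k * p.2 + (p.1 : ℕ) := fun p => by
    simp [e, Int.divModEquiv]
    ring
  rw [← e.tsum_eq, Summable.tsum_prod (f := fun p => g (e p)) (e.summable_iff.mpr hg),
    tsum_fintype]
  simp only [he]

theorem tsum_int_eq_mod_three {E : Type*} [NormedAddCommGroup E] [CompleteSpace E] {g : ℤ → E}
    (hg : Summable g) :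
    ∑' n, g n = ∑' m, g (3 * m) + ∑' m, g (3 * m + 1) + ∑' m, g (3 * m + 2) := by
  rw [tsum_int_eq_sum_mod hg 3, Fin.sum_univ_three]
  simp

theorem tsum_int_eq_mod_two {E : Type*} [NormedAddCommGroup E] [CompleteSpace E] {g : ℤ → E}
    (hg : Summable g) : ∑' n, g n = ∑' m, g (2 * m) + ∑' m, g (2 * m + 1) := by
  rw [tsum_int_eq_sum_mod hg 2, Fin.sum_univ_two]
  simp

/-- The series side of the quintuple product identity. -/
noncomputable def quint (q x : ℂ) : ℂ :=
  thetaJ (q ^ 3) (q * x ^ 3) + x * thetaJ (q ^ 3) (q ^ 2 * x ^ 3)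

/-- Laurent series with the functional equations of `quint` are multiples of it. -/
theorem IsLaurent.eq_const_mul_quint {f : ℂ → ℂ} {c : ℤ → ℂ} {q : ℂ} (hf : IsLaurent f c)
    (hq0 : q ≠ 0) (h : ∀ x ≠ 0, f (q * x) = -q⁻¹ * (x ^ 3)⁻¹ * f x)
    (h' : ∀ x ≠ 0, f x⁻¹ = x⁻¹ * f x) : ∃ C, ∀ x ≠ 0, f x = C * quint q x := by
  have hc := (hf.comp_mul_left hq0).coeff_eq ((hf.zpow_mul (-3)).const_mul (-q⁻¹)) (fun x hx => by
    rw [h x hx, zpow_neg]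
    norm_cast
    ring)
  have hc' := hf.comp_inv.coeff_eq (hf.zpow_mul (-1)) (fun x hx => by rw [h' x hx, zpow_neg_one])
  have hr : ∀ N, c (N + 3) = -(q * q ^ N) * c N := fun N => by
    have := hc N
    rw [sub_neg_eq_add] at this
    field_simp at this
    linear_combination this
  have hs : ∀ N, c (-N) = c (N + 1) := fun N => by
    have := hc' N
    rwa [sub_neg_eq_add] at this
  have h10 : c 1 = c 0 := by simpa using (hs 0).symm
  have h2 : c 2 = 0 := by
    have e1 := hs 1
    have e2 := hr (-1)
    norm_num at e1 e2
    rw [mul_inv_cancel₀ hq0, one_mul] at e2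
    have : c 2 + c 2 = 0 := by nth_rewrite 1 [e2]; rw [e1]; ring
    simpa using this
  have hq3 : q ^ 3 ≠ 0 := pow_ne_zero 3 hq0
  have e0 : ∀ m : ℤ, c (3 * m) = c 0 * ((-1) ^ m * (q ^ 3) ^ (m * (m - 1) / 2) * q ^ m) :=
    fun m => by
    have := coeff_of_recurrence (c := fun m => c (3 * m)) hq3 hq0 (fun m => by
      have := hr (3 * m)
      rw [_root_.zpow_mul] at this
      rw [mul_add, mul_one, this]
      norm_cast) m
    simpa using this
  have e1 : ∀ m : ℤ, c (3 * m + 1) =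
      c 0 * ((-1) ^ m * (q ^ 3) ^ (m * (m - 1) / 2) * (q ^ 2) ^ m) := fun m => by
    have := coeff_of_recurrence (c := fun m => c (3 * m + 1)) hq3 (pow_ne_zero 2 hq0) (fun m => by
      have := hr (3 * m + 1)
      rw [zpow_add₀ hq0, _root_.zpow_mul, zpow_one] at this
      rw [show 3 * (m + 1) + 1 = 3 * m + 1 + 3 by ring, this, zpow_ofNat]
      ring) m
    simpa [h10] using this
  have e2 : ∀ m : ℤ, c (3 * m + 2) = 0 := fun m => by
    have := coeff_of_recurrence (c := fun m => c (3 * m + 2)) hq3 (pow_ne_zero 3 hq0) (fun m => by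
      have := hr (3 * m + 2)
      rw [zpow_add₀ hq0, _root_.zpow_mul, zpow_ofNat q 2] at this
      rw [show 3 * (m + 1) + 2 = 3 * m + 2 + 3 by ring, this, zpow_ofNat]
      ring) m
    simpa [h2] using this
  refine ⟨c 0, fun x hx => ?_⟩
  have t2 : ∀ m : ℤ, c (3 * m + 2) * x ^ (3 * m + 2) = 0 := fun m => by rw [e2, zero_mul]
  have t1 : ∀ m : ℤ, c (3 * m + 1) * x ^ (3 * m + 1) =
      c 0 * x * ((-1) ^ m * (q ^ 3) ^ (m * (m - 1) / 2) * (q ^ 2 * x ^ 3) ^ m) := fun m => by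
    rw [e1, zpow_add₀ hx, mul_zpow, _root_.zpow_mul, zpow_one, zpow_ofNat x]
    ring
  have t0 : ∀ m : ℤ, c (3 * m) * x ^ (3 * m) =
      c 0 * ((-1) ^ m * (q ^ 3) ^ (m * (m - 1) / 2) * (q * x ^ 3) ^ m) := fun m => by
    rw [e0, mul_zpow, _root_.zpow_mul, zpow_ofNat x]
    ring
  rw [(hf x hx).2, tsum_int_eq_mod_three (hf x hx).1.of_norm]
  simp only [t0, t1, t2, tsum_mul_left, tsum_zero, quint, thetaJ]
  ring

theorem norm_pow_lt_one {𝕜 : Type*} [NormedField 𝕜] {q : 𝕜} (hq : ‖q‖ < 1) {k : ℕ} (hk : k ≠ 0) : ‖q ^ k‖ < 1 := by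
  rw [norm_pow]
  exact pow_lt_one₀ (norm_nonneg _) hq hk

section QProducts

variable {𝕜 : Type*} [NormedField 𝕜] [CompleteSpace 𝕜] {q : 𝕜}

theorem qInf_self_ne_zero (hq : ‖q‖ < 1) : qInf q q ≠ 0 := qInf_ne_zero_of_norm_lt hq hq

theorem qInf_self_eq_sq (hq : ‖q‖ < 1) : qInf q q = qInf q (q ^ 2) * qInf (q ^ 2) (q ^ 2) := by
  rw [qInf_eq_mul_sq hq, ← sq]

/-- Euler's identity on partitions into odd and distinct parts. -/
theorem qInf_neg_mul_qInf_sq (hq : ‖q‖ < 1) : qInf (-q) q * qInf q (q ^ 2) = 1 := by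
  have h1 := qInf_mul_qInf_neg hq q
  rw [qInf_self_eq_sq hq] at h1
  have h2 := qInf_self_ne_zero (norm_pow_lt_one hq two_ne_zero)
  refine mul_right_cancel₀ h2 ?_
  linear_combination h1

theorem thetaJ_cube_self (hq0 : q ≠ 0) (hq : ‖q‖ < 1) : thetaJ (q ^ 3) q = qInf q q := by
  rw [thetaJ_eq_qInf (pow_ne_zero 3 hq0) (norm_pow_lt_one hq three_ne_zero) hq0,
    qInf_eq_prod_pow hq q three_ne_zero, show q ^ 3 / q = q ^ 2 by field_simp]
  simp only [Finset.prod_range_succ, Finset.prod_range_zero]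
  ring_nf

theorem thetaJ_sq_self (hq0 : q ≠ 0) (hq : ‖q‖ < 1) :
    thetaJ (q ^ 2) q = qInf q (q ^ 2) ^ 2 * qInf (q ^ 2) (q ^ 2) := by
  rw [thetaJ_eq_qInf (pow_ne_zero 2 hq0) (norm_pow_lt_one hq two_ne_zero) hq0,
    show q ^ 2 / q = q by field_simp]
  ring

theorem thetaJ_neg_one (hq0 : q ≠ 0) (hq : ‖q‖ < 1) :
    thetaJ q (-1) = 2 * qInf (-q) q ^ 2 * qInf q q := by
  rw [thetaJ_eq_qInf hq0 hq (by simp), qInf_eq_one_sub_mul hq, div_neg, div_one, neg_one_mul]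
  ring

end QProducts

section Quintuple

variable {q : ℂ}

theorem isLaurent_quintuple (hq0 : q ≠ 0) (hq : ‖q‖ < 1) :
    ∃ c, IsLaurent (fun x => thetaJ q (-x) * thetaJ (q ^ 2) (q * x ^ 2)) c := by
  have h1 := (isLaurent_thetaJ hq0 hq).comp_mul_left (a := -1) (by simp)
  have h2 := ((isLaurent_thetaJ (pow_ne_zero 2 hq0)
    (norm_pow_lt_one hq two_ne_zero)).comp_mul_left hq0).comp_pow two_ne_zero
  exact ⟨_, (h1.mul h2).congr fun x _ => by simp⟩

/-- The quintuple product identity. -/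
theorem thetaJ_neg_mul_thetaJ (hq0 : q ≠ 0) (hq : ‖q‖ < 1) {x : ℂ} (hx : x ≠ 0) :
    thetaJ q (-x) * thetaJ (q ^ 2) (q * x ^ 2) = qInf (q ^ 2) (q ^ 2) * quint q x := by
  obtain ⟨c, hc⟩ := isLaurent_quintuple hq0 hq
  have hq2 := pow_ne_zero 2 hq0
  obtain ⟨C, hC⟩ := hc.eq_const_mul_quint hq0 (fun x hx => by
    have hx2 := mul_ne_zero hq0 (pow_ne_zero 2 hx)
    rw [← mul_neg, thetaJ_mul_left hq0 (neg_ne_zero.mpr hx),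
      show q * (q * x) ^ 2 = q ^ 2 * (q * x ^ 2) by ring, thetaJ_mul_left hq2 hx2]
    field_simp) (fun x hx => by
    rw [← inv_neg, thetaJ_inv hq0 (neg_ne_zero.mpr hx),
      show q * x⁻¹ ^ 2 = q ^ 2 / (q * x ^ 2) by field_simp, thetaJ_div hq2]
    field_simp)
  have h1 := hC 1 one_ne_zero
  have hq3 := pow_ne_zero 3 hq0
  have e : thetaJ (q ^ 3) (q ^ 2) = thetaJ (q ^ 3) q := by
    rw [← thetaJ_div hq3, show q ^ 3 / q ^ 2 = q by field_simp]
  simp only [one_pow, mul_one, quint, one_mul] at h1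
  rw [e, thetaJ_cube_self hq0 hq, thetaJ_neg_one hq0 hq, thetaJ_sq_self hq0 hq] at h1
  have hP := qInf_neg_mul_qInf_sq hq
  have hz := qInf_self_ne_zero hq
  have hCe : C = qInf (q ^ 2) (q ^ 2) := by
    refine mul_right_cancel₀ (mul_ne_zero two_ne_zero hz) ?_
    linear_combination -h1 + 2 * qInf q q * qInf (q ^ 2) (q ^ 2) *
      (qInf (-q) q * qInf q (q ^ 2) + 1) * hP
  rw [← hCe]
  exact hC x hx

end Quintuple

section JacobiDerivative

variable {q : ℂ}

theorem continuous_qInf (hq : ‖q‖ < 1) : Continuous fun a => qInf a q := by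
  rw [continuous_iff_continuousAt]
  intro a
  have hs : Summable fun n : ℕ => (‖a‖ + 1) * ‖q‖ ^ n :=
    (summable_geometric_of_lt_one (norm_nonneg _) hq).mul_left _
  have h := hs.hasProdLocallyUniformlyOn_nat_one_add (f := fun n (b : ℂ) => -(b * q ^ n))
    (K := Metric.ball a 1) Metric.isOpen_ball (Eventually.of_forall fun n b hb => by
      rw [norm_neg, norm_mul, norm_pow]
      have : ‖b‖ ≤ ‖a‖ + 1 := by
        have h1 : ‖b - a‖ < 1 := by simpa [dist_eq_norm] using hb
        have := norm_le_norm_add_norm_sub' b a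
        linarith
      gcongr) (fun n => by fun_prop)
  have h2 : ContinuousOn (fun a => qInf a q) (Metric.ball a 1) := by
    refine (h.tendstoLocallyUniformlyOn_finsetRange.congr_right fun b _ => ?_).continuousOn ?_
    · simp [qInf, sub_eq_add_neg]
    · exact Frequently.of_forall fun n => by fun_prop
  exact h2.continuousAt (Metric.isOpen_ball.mem_nhds (Metric.mem_ball_self one_pos))

theorem hasDerivAt_thetaJ_exp (hq0 : q ≠ 0) (hq : ‖q‖ < 1) :
    HasDerivAt (fun w => thetaJ q (Complex.exp w)) (-qInf q q ^ 3) 0 := by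
  have hc := continuous_qInf hq
  let g : ℂ → ℂ := fun w =>
    qInf (Complex.exp w * q) q * qInf (q / Complex.exp w) q * qInf q q
  have hg : ContinuousAt g 0 := by
    have h1 : Continuous fun w => qInf (Complex.exp w * q) q := hc.comp (by fun_prop)
    have h2 : Continuous fun w => qInf (q / Complex.exp w) q :=
      hc.comp (by fun_prop (disch := simp))
    exact (by fun_prop : Continuous g).continuousAt
  have e : (fun w => thetaJ q (Complex.exp w)) = fun w => (1 - Complex.exp w) * g w := by
    funext w
    rw [thetaJ_eq_qInf hq0 hq (Complex.exp_ne_zero w), qInf_eq_one_sub_mul hq (Complex.exp w)]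
    simp only [g]
    ring
  rw [e, hasDerivAt_iff_tendsto_slope]
  have hs := (hasDerivAt_iff_tendsto_slope.mp (Complex.hasDerivAt_exp 0)).neg.mul
    (hg.tendsto.mono_left (nhdsWithin_le_nhds (s := {0}ᶜ)))
  have hv : -Complex.exp 0 * g 0 = -qInf q q ^ 3 := by
    simp [g]
    ring
  rw [hv] at hs
  refine hs.congr fun w => ?_
  simp [slope_def_field]
  ring

end JacobiDerivative

section ThetaDerivatives

theorem hasDerivAt_thetaJ_mul_exp {p a : ℂ} (hp0 : p ≠ 0) (hp : ‖p‖ < 1) (ha : a ≠ 0) (k : ℂ) :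
    HasDerivAt (fun w => thetaJ p (a * Complex.exp (k * w)))
      (k * ∑' n : ℤ, n * ((-1) ^ n * p ^ (n * (n - 1) / 2) * a ^ n)) 0 := by
  have h := ((isLaurent_thetaJ hp0 hp).comp_mul_left ha).hasDerivAt_exp
  have hk : HasDerivAt (fun w : ℂ => k * w) k 0 := by
    simpa using (hasDerivAt_id (0 : ℂ)).const_mul k
  have h' := HasDerivAt.comp_of_eq (0 : ℂ) h hk (mul_zero k).symm
  rw [mul_comm k]
  exact h'

theorem summable_int_mul_thetaJ {p a : ℂ} (hp0 : p ≠ 0) (hp : ‖p‖ < 1) (ha : a ≠ 0) :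
    Summable fun n : ℤ => n * ((-1) ^ n * p ^ (n * (n - 1) / 2) * a ^ n) := by
  have h1 := (summable_norm_thetaJ hp0 hp (mul_ne_zero two_ne_zero ha))
  have h2 := (summable_norm_thetaJ hp0 hp (mul_ne_zero (inv_ne_zero (two_ne_zero (α := ℂ))) ha))
  refine Summable.of_norm_bounded (h1.add h2) fun n => ?_
  simp only [mul_zpow, norm_mul]
  have e : ‖(n : ℂ)‖ ≤ ‖(2 : ℂ) ^ n‖ + ‖(2⁻¹ : ℂ) ^ n‖ := by
    rw [Complex.norm_intCast, norm_zpow, norm_zpow, norm_inv, Complex.norm_ofNat]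
    have hb : ∀ m : ℕ, (m : ℝ) ≤ 2 ^ m := fun m => by exact_mod_cast (Nat.lt_two_pow_self).le
    rcases Int.eq_nat_or_neg n with ⟨m, rfl | rfl⟩
    · have : (0 : ℝ) < 2⁻¹ ^ (m : ℤ) := by positivity
      have := hb m
      rw [zpow_natCast]
      simp only [Int.cast_natCast, Nat.abs_cast]
      linarith
    · have : (0 : ℝ) < 2 ^ (-m : ℤ) := by positivity
      have := hb m
      rw [zpow_neg 2⁻¹, inv_zpow, inv_inv, zpow_natCast]
      simp only [Int.cast_natCast, Int.cast_neg, abs_neg, Nat.abs_cast]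
      linarith
  have h0 : 0 ≤ ‖(-1 : ℂ) ^ n‖ * ‖p ^ (n * (n - 1) / 2)‖ * ‖a ^ n‖ := by positivity
  nlinarith

variable {Q : ℂ}

theorem thetaJ_coeff_mul {Q : ℂ} (hQ : Q ≠ 0) (n k : ℤ) :
    (-1) ^ n * (Q ^ 6) ^ (n * (n - 1) / 2) * (-Q ^ k) ^ n = Q ^ (3 * n ^ 2 + (k - 3) * n) := by
  obtain ⟨m, hm⟩ : ∃ m, n * (n - 1) = 2 * m := (Int.even_mul_pred_self n).two_dvd
  rw [hm, Int.mul_ediv_cancel_left _ two_ne_zero, neg_eq_neg_one_mul (Q ^ k), mul_zpow, ← zpow_natCast Q 6,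
    ← zpow_mul, ← zpow_mul]
  have : (-1 : ℂ) ^ n * (-1) ^ n = 1 := by rw [← mul_zpow]; simp
  rw [show 3 * n ^ 2 + (k - 3) * n = ((6 : ℕ) : ℤ) * m + k * n by
    push_cast
    linear_combination (3 : ℤ) * hm, zpow_add₀ hQ]
  linear_combination Q ^ (((6 : ℕ) : ℤ) * m) * Q ^ (k * n) * this

theorem tsum_six_mul_add_one_mul_pow (hQ0 : Q ≠ 0) (hQ : ‖Q‖ < 1) :
    qInf (Q ^ 4) (Q ^ 4) * ∑' n : ℤ, (6 * n + 1) * Q ^ (3 * n ^ 2 + n) =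
      qInf (Q ^ 2) (Q ^ 2) ^ 3 * thetaJ (Q ^ 4) (Q ^ 2) := by
  have hq0 := pow_ne_zero 2 hQ0
  have hq := norm_pow_lt_one hQ two_ne_zero
  have h60 := pow_ne_zero 6 hQ0
  have h6 := norm_pow_lt_one hQ (k := 6) (by norm_num)
  have h40 := pow_ne_zero 4 hQ0
  have h4 := norm_pow_lt_one hQ (k := 4) (by norm_num)
  have z2 : -Q ^ (2 : ℤ) ≠ 0 := neg_ne_zero.mpr (zpow_ne_zero _ hQ0)
  have z4 : -Q ^ (4 : ℤ) ≠ 0 := neg_ne_zero.mpr (zpow_ne_zero _ hQ0)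
  have hL := (hasDerivAt_thetaJ_exp hq0 hq).mul (hasDerivAt_thetaJ_mul_exp h40 h4 hq0 2)
  have hR := ((hasDerivAt_thetaJ_mul_exp h60 h6 z2 3).sub
    ((Complex.hasDerivAt_exp 0).mul (hasDerivAt_thetaJ_mul_exp h60 h6 z4 3))).const_mul
      (qInf (Q ^ 4) (Q ^ 4))
  have e : (fun w => thetaJ (Q ^ 2) (Complex.exp w)) *
      (fun w => thetaJ (Q ^ 4) (Q ^ 2 * Complex.exp (2 * w))) =
      fun w => qInf (Q ^ 4) (Q ^ 4) *
        ((fun w => thetaJ (Q ^ 6) (-Q ^ (2 : ℤ) * Complex.exp (3 * w))) -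
          Complex.exp * (fun w => thetaJ (Q ^ 6) (-Q ^ (4 : ℤ) * Complex.exp (3 * w)))) w := by
    funext w
    have := thetaJ_neg_mul_thetaJ hq0 hq (neg_ne_zero.mpr (Complex.exp_ne_zero w))
    simp only [quint, neg_neg, ← pow_mul] at this
    norm_num at this
    simp only [Pi.mul_apply, Pi.sub_apply]
    rw [show Complex.exp (2 * w) = Complex.exp w ^ 2 by rw [← Complex.exp_nat_mul]; norm_num,
      show Complex.exp (3 * w) = Complex.exp w ^ 3 by rw [← Complex.exp_nat_mul]; norm_num, this,
      zpow_ofNat, zpow_ofNat]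
    ring_nf
  rw [e] at hL
  have key := hL.unique hR
  simp only [mul_zero, Complex.exp_zero, mul_one, thetaJ_one hq0 hq, zero_mul, add_zero, one_mul]
    at key
  have s1 := summable_int_mul_thetaJ h60 h6 z4
  have s0 := (summable_norm_thetaJ h60 h6 z4).of_norm
  simp only [thetaJ_coeff_mul hQ0] at key s1 s0
  have eT : thetaJ (Q ^ 6) (-Q ^ (4 : ℤ)) = ∑' n : ℤ, Q ^ (3 * n ^ 2 + (4 - 3) * n) := by
    simp only [thetaJ, thetaJ_coeff_mul hQ0]
  have e2 : ∑' n : ℤ, (n : ℂ) * Q ^ (3 * n ^ 2 + (2 - 3) * n) =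
      -∑' n : ℤ, (n : ℂ) * Q ^ (3 * n ^ 2 + (4 - 3) * n) := by
    rw [← (Equiv.neg ℤ).tsum_eq, ← tsum_neg]
    refine tsum_congr fun n => ?_
    simp only [Equiv.neg_apply, Int.cast_neg]
    ring_nf
  rw [e2, eT] at key
  have e3 : ∑' n : ℤ, (6 * n + 1) * Q ^ (3 * n ^ 2 + n) =
      6 * ∑' n : ℤ, (n : ℂ) * Q ^ (3 * n ^ 2 + (4 - 3) * n) +
        ∑' n : ℤ, Q ^ (3 * n ^ 2 + (4 - 3) * n) := by
    rw [← tsum_mul_left, ← (s1.mul_left 6).tsum_add s0]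
    refine tsum_congr fun n => ?_
    ring_nf
  rw [e3]
  linear_combination key

theorem tsum_six_mul_sub_two_mul_pow (hQ0 : Q ≠ 0) (hQ : ‖Q‖ < 1) :
    ∑' n : ℤ, (6 * n - 2) * Q ^ (3 * n ^ 2 - 2 * n) =
      -(2 * thetaJ (Q ^ 2) Q * qInf (Q ^ 4) (Q ^ 4) ^ 2) := by
  have hq0 := pow_ne_zero 2 hQ0
  have hq := norm_pow_lt_one hQ two_ne_zero
  have h60 := pow_ne_zero 6 hQ0
  have h6 := norm_pow_lt_one hQ (k := 6) (by norm_num)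
  have h40 := pow_ne_zero 4 hQ0
  have h4 := norm_pow_lt_one hQ (k := 4) (by norm_num)
  have z1 : -Q ^ (-1 : ℤ) ≠ 0 := neg_ne_zero.mpr (zpow_ne_zero _ hQ0)
  have z2 : -Q ^ (1 : ℤ) ≠ 0 := neg_ne_zero.mpr (zpow_ne_zero _ hQ0)
  have h2 : HasDerivAt (fun w : ℂ => thetaJ (Q ^ 4) (Complex.exp (2 * w)))
      (-qInf (Q ^ 4) (Q ^ 4) ^ 3 * 2) 0 := by
    have hk : HasDerivAt (fun w : ℂ => 2 * w) 2 0 := by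
      simpa using (hasDerivAt_id (0 : ℂ)).const_mul 2
    exact HasDerivAt.comp_of_eq (0 : ℂ) (hasDerivAt_thetaJ_exp h40 h4) hk (mul_zero 2).symm
  have hL := (hasDerivAt_thetaJ_mul_exp hq0 hq (inv_ne_zero hQ0) 1).mul h2
  have hR := ((hasDerivAt_thetaJ_mul_exp h60 h6 z1 3).sub
    (((Complex.hasDerivAt_exp 0).const_mul Q⁻¹).mul
      (hasDerivAt_thetaJ_mul_exp h60 h6 z2 3))).const_mul (qInf (Q ^ 4) (Q ^ 4))
  have e : (fun w => thetaJ (Q ^ 2) (Q⁻¹ * Complex.exp (1 * w))) *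
      (fun w => thetaJ (Q ^ 4) (Complex.exp (2 * w))) =
      fun w => qInf (Q ^ 4) (Q ^ 4) *
        ((fun w => thetaJ (Q ^ 6) (-Q ^ (-1 : ℤ) * Complex.exp (3 * w))) -
          (fun w => Q⁻¹ * Complex.exp w) *
          (fun w => thetaJ (Q ^ 6) (-Q ^ (1 : ℤ) * Complex.exp (3 * w)))) w := by
    funext w
    have := thetaJ_neg_mul_thetaJ hq0 hq
      (neg_ne_zero.mpr (mul_ne_zero (inv_ne_zero hQ0) (Complex.exp_ne_zero w)))
    simp only [quint, neg_neg, ← pow_mul] at this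
    rw [show Q ^ 2 * (-(Q⁻¹ * Complex.exp w)) ^ 2 = Complex.exp w ^ 2 by field_simp,
      show Q ^ 2 * (-(Q⁻¹ * Complex.exp w)) ^ 3 = -Q⁻¹ * Complex.exp w ^ 3 by field_simp,
      show Q ^ (2 * 2) * (-(Q⁻¹ * Complex.exp w)) ^ 3 = -Q * Complex.exp w ^ 3 by
        field_simp] at this
    norm_num at this
    simp only [Pi.mul_apply, Pi.sub_apply]
    rw [show Complex.exp (2 * w) = Complex.exp w ^ 2 by rw [← Complex.exp_nat_mul]; norm_num,
      show Complex.exp (3 * w) = Complex.exp w ^ 3 by rw [← Complex.exp_nat_mul]; norm_num,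
      one_mul, this, zpow_neg_one, zpow_one]
    ring_nf
  rw [e] at hL
  have key := hL.unique hR
  simp only [mul_zero, Complex.exp_zero, mul_one, thetaJ_one h40 h4, zero_add]
    at key
  rw [thetaJ_inv hq0 hQ0] at key
  have s1 := summable_int_mul_thetaJ h60 h6 z2
  have s0 := (summable_norm_thetaJ h60 h6 z2).of_norm
  simp only [thetaJ_coeff_mul hQ0] at key s1 s0
  have eT : thetaJ (Q ^ 6) (-Q ^ (1 : ℤ)) = ∑' n : ℤ, Q ^ (3 * n ^ 2 + (1 - 3) * n) := by
    simp only [thetaJ, thetaJ_coeff_mul hQ0]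
  have e2 : ∑' n : ℤ, (n : ℂ) * Q ^ (3 * n ^ 2 + (-1 - 3) * n) =
      Q⁻¹ * (∑' n : ℤ, Q ^ (3 * n ^ 2 + (1 - 3) * n) -
        ∑' n : ℤ, (n : ℂ) * Q ^ (3 * n ^ 2 + (1 - 3) * n)) := by
    rw [← (Equiv.subLeft (1 : ℤ)).tsum_eq, ← s0.tsum_sub s1, ← tsum_mul_left]
    refine tsum_congr fun n => ?_
    simp only [Equiv.subLeft_apply, Int.cast_sub, Int.cast_one]
    rw [show 3 * (1 - n) ^ 2 + (-1 - 3) * (1 - n) = (3 * n ^ 2 + (1 - 3) * n) - 1 by ring,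
      zpow_sub_one₀ hQ0]
    ring
  rw [e2, eT] at key
  have e3 : ∑' n : ℤ, (6 * n - 2) * Q ^ (3 * n ^ 2 - 2 * n) =
      6 * ∑' n : ℤ, (n : ℂ) * Q ^ (3 * n ^ 2 + (1 - 3) * n) -
        2 * ∑' n : ℤ, Q ^ (3 * n ^ 2 + (1 - 3) * n) := by
    rw [← tsum_mul_left, ← tsum_mul_left, ← (s1.mul_left 6).tsum_sub (s0.mul_left 2)]
    refine tsum_congr fun n => ?_
    ring_nf
  rw [e3]
  have hz := qInf_self_ne_zero h4
  refine mul_left_cancel₀ (mul_ne_zero hz (inv_ne_zero hQ0)) ?_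
  linear_combination key

end ThetaDerivatives

section Gaussian

theorem Real.exp_intCast_mul (n : ℤ) (x : ℝ) : rexp (n * x) = rexp x ^ n := by
  rw [mul_comm, Real.exp_mul, Real.rpow_intCast]

theorem exp_gauss_eq_thetaJ_term (s : ℝ) (a b : ℝ) (n : ℤ) :
    rexp (-s * (a * n + b) ^ 2) = rexp (-s * b ^ 2) *
      (rexp (-2 * s * a ^ 2) ^ (n * (n - 1) / 2) * rexp (-s * a ^ 2 - 2 * s * a * b) ^ n) := by
  obtain ⟨m, hm⟩ : ∃ m, n * (n - 1) = 2 * m := (Int.even_mul_pred_self n).two_dvd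
  rw [hm, Int.mul_ediv_cancel_left _ two_ne_zero, ← Real.exp_intCast_mul, ← Real.exp_intCast_mul,
    ← Real.exp_add, ← Real.exp_add]
  have : (n : ℝ) * (n - 1) = 2 * m := by exact_mod_cast hm
  congr 1
  linear_combination -s * a ^ 2 * this

theorem summable_exp_gauss {s : ℝ} (hs : 0 < s) {a : ℝ} (ha : a ≠ 0) (b : ℝ) :
    Summable fun n : ℤ => rexp (-s * (a * n + b) ^ 2) := by
  simp only [exp_gauss_eq_thetaJ_term]
  have h := summable_norm_thetaJ (q := rexp (-2 * s * a ^ 2))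
    (x := rexp (-s * a ^ 2 - 2 * s * a * b)) (Real.exp_ne_zero _) (by
      rw [Real.norm_eq_abs, abs_of_pos (Real.exp_pos _), Real.exp_lt_one_iff]
      have : 0 < s * a ^ 2 := by positivity
      linarith) (Real.exp_ne_zero _)
  refine (h.congr fun n => ?_).mul_left _
  simp [norm_mul, norm_zpow]

/-- Products of one-variable Gaussians are summable along an injection. -/
theorem summable_exp_gauss_prod {s t : ℝ} (hs : 0 < s) (ht : 0 < t) {a c : ℝ} (ha : a ≠ 0)
    (hc : c ≠ 0) (b d : ℝ) :
    Summable fun p : ℤ × ℤ => rexp (-s * (a * p.1 + b) ^ 2) * rexp (-t * (c * p.2 + d) ^ 2) :=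
  (summable_exp_gauss hs ha b).mul_of_nonneg (summable_exp_gauss ht hc d)
    (fun _ => (Real.exp_pos _).le) (fun _ => (Real.exp_pos _).le)

noncomputable def theta2 (s : ℝ) : ℝ := ∑' n : ℤ, rexp (-s * (n + 1 / 2) ^ 2)
noncomputable def theta3 (s : ℝ) : ℝ := ∑' n : ℤ, rexp (-s * n ^ 2)
noncomputable def theta4 (s : ℝ) : ℝ := ∑' n : ℤ, (-1) ^ n * rexp (-s * n ^ 2)

/-- Dedekind's eta function at nome `exp (-s)`. -/
noncomputable def etaR (s : ℝ) : ℝ := ∑' n : ℤ, (-1) ^ n * rexp (-s / 24 * (6 * n + 1) ^ 2)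

variable {s : ℝ}

theorem summable_theta2 (hs : 0 < s) : Summable fun n : ℤ => rexp (-s * (n + 1 / 2) ^ 2) := by
  simpa using summable_exp_gauss hs one_ne_zero (1 / 2)

theorem summable_theta3 (hs : 0 < s) : Summable fun n : ℤ => rexp (-s * n ^ 2) := by
  simpa using summable_exp_gauss hs one_ne_zero 0

theorem summable_neg_one_zpow_mul {f : ℤ → ℝ} (hf : Summable f) (h0 : ∀ n, 0 ≤ f n) :
    Summable fun n : ℤ => (-1) ^ n * f n :=
  Summable.of_norm_bounded hf fun n => by simp [abs_of_nonneg (h0 n)]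

theorem summable_theta4 (hs : 0 < s) : Summable fun n : ℤ => (-1) ^ n * rexp (-s * n ^ 2) :=
  summable_neg_one_zpow_mul (summable_theta3 hs) fun _ => (Real.exp_pos _).le

theorem summable_etaR (hs : 0 < s) :
    Summable fun n : ℤ => (-1) ^ n * rexp (-s / 24 * (6 * n + 1) ^ 2) := by
  refine summable_neg_one_zpow_mul ?_ fun _ => (Real.exp_pos _).le
  simpa [neg_div] using summable_exp_gauss (s := s / 24) (by positivity) (a := 6) (by norm_num) 1

theorem theta3_eq_add (hs : 0 < s) : theta3 s = theta3 (4 * s) + theta2 (4 * s) := by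
  rw [theta3, tsum_int_eq_mod_two (summable_theta3 hs), theta3, theta2]
  congr 1 <;> refine tsum_congr fun n => ?_ <;> congr 1 <;> push_cast <;> ring

theorem theta4_eq_sub (hs : 0 < s) : theta4 s = theta3 (4 * s) - theta2 (4 * s) := by
  rw [theta4, tsum_int_eq_mod_two (summable_theta4 hs), theta3, theta2, sub_eq_add_neg, ← tsum_neg]
  have e : ∀ m : ℤ, (-1 : ℝ) ^ (2 * m + 1) = -1 := fun m => Odd.neg_one_zpow ⟨m, rfl⟩
  congr 1 <;> refine tsum_congr fun n => ?_
  · rw [Even.neg_one_zpow ⟨n, by ring⟩, one_mul]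
    congr 1
    push_cast
    ring
  · rw [e, neg_one_mul]
    congr 2
    push_cast
    ring

theorem theta3_inversion (hs : 0 < s) : theta3 s = √(π / s) * theta3 (π ^ 2 / s) := by
  have h := Real.tsum_exp_neg_mul_int_sq (a := s / π) (by positivity)
  rw [theta3, theta3]
  have e1 : ∀ n : ℤ, -π * (s / π) * (n : ℝ) ^ 2 = -s * n ^ 2 := fun n => by
    field_simp
  have e2 : ∀ n : ℤ, -π / (s / π) * (n : ℝ) ^ 2 = -(π ^ 2 / s) * n ^ 2 := fun n => by
    field_simp
  simp only [e1, e2] at h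
  rw [h, ← Real.sqrt_eq_rpow, Real.sqrt_div' _ hs.le, Real.sqrt_div' _ Real.pi_pos.le]
  field_simp

theorem theta2_inversion (hs : 0 < s) : theta2 s = √(π / s) * theta4 (π ^ 2 / s) := by
  have h1 := theta3_eq_add (s := s / 4) (by positivity)
  have h2 := theta3_inversion (s := s / 4) (by positivity)
  have h3 := theta3_inversion hs
  have h4 := theta4_eq_sub (s := π ^ 2 / s) (by positivity)
  have h5 := theta3_eq_add (s := π ^ 2 / s) (by positivity)
  rw [show 4 * (s / 4) = s by ring] at h1
  rw [show π / (s / 4) = 2 ^ 2 * (π / s) by field_simp; norm_num,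
    Real.sqrt_mul (by positivity), Real.sqrt_sq (by norm_num),
    show π ^ 2 / (s / 4) = 4 * (π ^ 2 / s) by field_simp] at h2
  rw [h4]
  linear_combination h2 - h1 - h3 - √(π / s) * h5

theorem theta4_inversion (hs : 0 < s) : theta4 s = √(π / s) * theta2 (π ^ 2 / s) := by
  have h := theta2_inversion (s := π ^ 2 / s) (by positivity)
  rw [h, show π ^ 2 / (π ^ 2 / s) = s by field_simp, ← mul_assoc, ← Real.sqrt_mul (by positivity),
    show π / s * (π / (π ^ 2 / s)) = 1 by field_simp]
  simp

theorem theta3_pos (hs : 0 < s) : 0 < theta3 s :=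
  (summable_theta3 hs).tsum_pos (fun _ => (Real.exp_pos _).le) 0 (Real.exp_pos _)

theorem theta2_pos (hs : 0 < s) : 0 < theta2 s :=
  (summable_theta2 hs).tsum_pos (fun _ => (Real.exp_pos _).le) 0 (Real.exp_pos _)

theorem theta4_pos (hs : 0 < s) : 0 < theta4 s := by
  rw [theta4_inversion hs]
  have := theta2_pos (s := π ^ 2 / s) (by positivity)
  positivity

end Gaussian

section Isometries

variable {s : ℝ}

theorem tsum_mul_tsum_int {f g : ℤ → ℝ} (hf : Summable fun n => ‖f n‖)
    (hg : Summable fun n => ‖g n‖) :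
    (∑' n, f n) * ∑' n, g n = ∑' n, ∑' m, f m * g n := by
  rw [mul_comm, tsum_mul_tsum_of_summable_norm hg hf,
    (summable_mul_of_summable_norm hg hf).tsum_prod]
  simp only [mul_comm]

theorem neg_one_zpow_mul_self (n : ℤ) : (-1 : ℝ) ^ n * (-1) ^ n = 1 := by
  rw [← mul_zpow]
  simp

theorem neg_one_zpow_sub (n m : ℤ) : (-1 : ℝ) ^ (n - m) = (-1) ^ n * (-1) ^ m := by
  rw [zpow_sub₀ (by norm_num), div_eq_mul_inv, ← inv_zpow]
  norm_num

theorem neg_one_zpow_add (n m : ℤ) : (-1 : ℝ) ^ (n + m) = (-1) ^ n * (-1) ^ m :=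
  zpow_add₀ (by norm_num) _ _

/-- The product of eta functions at nomes `q` and `q ^ 5`, via the isometry
`(a - 5 b) ^ 2 + 5 (a + b) ^ 2 = 6 (a ^ 2 + 5 b ^ 2)`. -/
theorem two_mul_etaR_mul_etaR (hs : 0 < s) :
    2 * (etaR s * etaR (5 * s)) =
      theta2 s * theta3 (5 * s) - theta3 s * theta2 (5 * s) := by
  have hs5 : 0 < 5 * s := by positivity
  let G : ℤ × ℤ → ℝ := fun p =>
    (-1) ^ p.2 * rexp (-s * ((2 * p.1 + 1 - p.2) ^ 2 / 4) - 5 * s * (p.2 ^ 2 / 4))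
  have hG : Summable G := by
    have h := (summable_exp_gauss_prod (s := s / 4) (t := 5 * s / 4) (a := 1) (c := 1)
      (by positivity) (by positivity) one_ne_zero one_ne_zero 0 0).comp_injective
      (i := fun p : ℤ × ℤ => (2 * p.1 + 1 - p.2, p.2)) (fun p p' h => by
        simp only [Prod.mk.injEq] at h
        ext <;> omega)
    refine Summable.of_norm_bounded h fun p => ?_
    simp only [G, Function.comp_apply, norm_mul, norm_zpow, norm_neg, norm_one, one_zpow, one_mul,
      Real.norm_eq_abs, Real.abs_exp, ← Real.exp_add]
    apply le_of_eq
    congr 1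
    push_cast
    ring
  have hG' : Summable fun p : ℤ × ℤ => G p.swap := (Equiv.prodComm ℤ ℤ).summable_iff.mpr hG
  have h1 : ∑' p, G p = theta2 s * theta3 (5 * s) - theta3 s * theta2 (5 * s) := by
    rw [← (Equiv.prodComm ℤ ℤ).tsum_eq]
    simp only [Equiv.prodComm_apply]
    rw [hG'.tsum_prod, tsum_int_eq_mod_two hG'.prod, theta2, theta3,
      tsum_mul_tsum_int (summable_theta2 hs).norm (summable_theta3 hs5).norm, theta2, theta3,
      tsum_mul_tsum_int (summable_theta3 hs).norm (summable_theta2 hs5).norm, sub_eq_add_neg,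
      ← tsum_neg]
    simp only [← tsum_neg]
    congr 1 <;> refine tsum_congr fun b => ?_
    · rw [← (Equiv.addRight b).tsum_eq]
      refine tsum_congr fun a => ?_
      simp only [G, Equiv.coe_addRight, Prod.swap_prod_mk, ← Real.exp_add]
      rw [Even.neg_one_zpow ⟨b, by ring⟩, one_mul]
      congr 1
      push_cast
      ring
    · rw [← (Equiv.addRight b).tsum_eq]
      refine tsum_congr fun a => ?_
      simp only [G, Equiv.coe_addRight, Prod.swap_prod_mk, ← Real.exp_add]
      rw [Odd.neg_one_zpow ⟨b, rfl⟩, neg_one_mul]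
      congr 2
      push_cast
      ring
  have h2 : ∑' p, G p = 2 * (etaR s * etaR (5 * s)) := by
    let v : ℝ → ℤ → ℝ → ℝ := fun i n s => (-1) ^ n * rexp (-s / 24 * (6 * n + i) ^ 2)
    have hv : ∀ i s, 0 < s → Summable fun n => ‖v i n s‖ := fun i s hs => by
      have := summable_exp_gauss (s := s / 24) (by positivity) (a := 6) (by norm_num) i
      refine this.congr fun n => ?_
      simp [v, neg_div]
    have key : ∀ i : ℤ, ∑' n : ℤ, ∑' b, G (3 * n + i, b) =
        (∑' n, v (2 * i + 1) n s) * ∑' n, v (2 * i + 1) n (5 * s) := fun i => by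
      rw [tsum_mul_tsum_int (hv _ _ hs) (hv _ _ hs5)]
      refine tsum_congr fun n => ?_
      rw [← (Equiv.subLeft n).tsum_eq]
      refine tsum_congr fun m => ?_
      simp only [G, v, Equiv.subLeft_apply]
      rw [mul_mul_mul_comm, ← Real.exp_add, neg_one_zpow_sub, mul_comm ((-1 : ℝ) ^ n)]
      congr 2
      push_cast
      ring
    have k0 := key 0
    have k1 := key 1
    have k2 := key 2
    norm_num at k0 k1 k2
    have r3 : ∑' n, v 3 n s = 0 := by
      have : ∑' n, v 3 n s = -∑' n, v 3 n s := by
        nth_rewrite 1 [← (Equiv.subLeft (-1 : ℤ)).tsum_eq]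
        rw [← tsum_neg]
        refine tsum_congr fun n => ?_
        simp only [v, Equiv.subLeft_apply]
        rw [neg_one_zpow_sub]
        push_cast
        ring_nf
      linarith
    have r5 : ∀ s, ∑' n, v 5 n s = -∑' n, v 1 n s := fun s => by
      rw [← (Equiv.subLeft (-1 : ℤ)).tsum_eq, ← tsum_neg]
      refine tsum_congr fun n => ?_
      simp only [v, Equiv.subLeft_apply]
      rw [neg_one_zpow_sub]
      push_cast
      ring_nf
    rw [hG.tsum_prod, tsum_int_eq_mod_three hG.prod, k0, k1, k2, r3, r5, r5]
    simp only [v, etaR]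
    ring
  rw [← h1, h2]

theorem tsum_sub_neg_one_zpow_mul {f : ℤ → ℝ} (hf : Summable f) :
    ∑' n : ℤ, (1 - (-1) ^ n) * f n = 2 * ∑' n, f (2 * n + 1) := by
  have hs : Summable fun n : ℤ => (1 - (-1) ^ n) * f n := by
    refine Summable.of_norm_bounded (hf.norm.mul_left 2) fun n => ?_
    rw [norm_mul]
    gcongr
    rcases Int.even_or_odd n with h | h <;> rw [h.neg_one_zpow] <;> norm_num
  rw [tsum_int_eq_mod_two hs, ← tsum_mul_left]
  have e0 : ∀ n : ℤ, (1 - (-1 : ℝ) ^ (2 * n)) * f (2 * n) = 0 := fun n => by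
    rw [Even.neg_one_zpow ⟨n, by ring⟩]
    simp
  simp only [e0, tsum_zero, zero_add]
  refine tsum_congr fun n => ?_
  rw [Odd.neg_one_zpow ⟨n, rfl⟩]
  ring

theorem tsum_add_neg_one_zpow_mul {f : ℤ → ℝ} (hf : Summable f) :
    ∑' n : ℤ, (1 + (-1) ^ n) * f n = 2 * ∑' n, f (2 * n) := by
  have hs : Summable fun n : ℤ => (1 + (-1) ^ n) * f n := by
    refine Summable.of_norm_bounded (hf.norm.mul_left 2) fun n => ?_
    rw [norm_mul]
    gcongr
    rcases Int.even_or_odd n with h | h <;> rw [h.neg_one_zpow] <;> norm_num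
  rw [tsum_int_eq_mod_two hs, ← tsum_mul_left]
  have e0 : ∀ n : ℤ, (1 + (-1 : ℝ) ^ (2 * n + 1)) * f (2 * n + 1) = 0 := fun n => by
    rw [Odd.neg_one_zpow ⟨n, rfl⟩]
    simp
  simp only [e0, tsum_zero, add_zero]
  refine tsum_congr fun n => ?_
  rw [Even.neg_one_zpow ⟨n, by ring⟩]
  ring

theorem Summable.neg_one_zpow_mul {f : ℤ → ℝ} (hf : Summable f) :
    Summable fun n : ℤ => (-1) ^ n * f n :=
  Summable.of_norm_bounded hf.norm fun n => by simp

theorem tsum_add_tsum_neg_one_zpow_mul {f : ℤ → ℝ} (hf : Summable f) (n : ℤ) :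
    ∑' m, f m + (-1) ^ n * ∑' m : ℤ, (-1) ^ m * f m = 2 * ∑' m, f (2 * m + n) := by
  have hg : Summable fun m => f (m + n) := (Equiv.addRight n).summable_iff.mpr hf
  rw [← tsum_add_neg_one_zpow_mul hg, ← tsum_mul_left, ← (Equiv.addRight n).tsum_eq f,
    ← (Equiv.addRight n).tsum_eq fun m : ℤ => (-1 : ℝ) ^ n * ((-1) ^ m * f m)]
  simp only [Equiv.coe_addRight]
  rw [← hg.tsum_add]
  · refine tsum_congr fun m => ?_
    rw [neg_one_zpow_add]
    linear_combination (-1) ^ m * f (m + n) * neg_one_zpow_mul_self n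
  · exact (hf.neg_one_zpow_mul.mul_left _).comp_injective (add_left_injective n)

theorem tsum_sub_tsum_neg_one_zpow_mul {f : ℤ → ℝ} (hf : Summable f) (n : ℤ) :
    ∑' m, f m - (-1) ^ n * ∑' m : ℤ, (-1) ^ m * f m = 2 * ∑' m, f (2 * m + 1 + n) := by
  have hg : Summable fun m => f (m + n) := (Equiv.addRight n).summable_iff.mpr hf
  rw [← tsum_sub_neg_one_zpow_mul hg, ← tsum_mul_left, ← (Equiv.addRight n).tsum_eq f,
    ← (Equiv.addRight n).tsum_eq fun m : ℤ => (-1 : ℝ) ^ n * ((-1) ^ m * f m)]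
  simp only [Equiv.coe_addRight]
  rw [← hg.tsum_sub]
  · refine tsum_congr fun m => ?_
    rw [neg_one_zpow_add]
    linear_combination -(-1) ^ m * f (m + n) * neg_one_zpow_mul_self n
  · exact (hf.neg_one_zpow_mul.mul_left _).comp_injective (add_left_injective n)

theorem tsum_mul_tsum_add {f g : ℤ → ℝ} (hf : Summable f) (hg : Summable g) :
    (∑' m, f m) * ∑' n, g n + (∑' m : ℤ, (-1) ^ m * f m) * ∑' n : ℤ, (-1) ^ n * g n =
      2 * ∑' n, ∑' m, f (2 * m + n) * g n := by
  rw [← tsum_mul_left, ← tsum_mul_left, ← tsum_mul_left, ← (hg.mul_left _).tsum_add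
    (hg.neg_one_zpow_mul.mul_left _)]
  refine tsum_congr fun n => ?_
  rw [tsum_mul_right]
  linear_combination g n * tsum_add_tsum_neg_one_zpow_mul hf n

theorem tsum_mul_tsum_sub {f g : ℤ → ℝ} (hf : Summable f) (hg : Summable g) :
    (∑' m, f m) * ∑' n, g n - (∑' m : ℤ, (-1) ^ m * f m) * ∑' n : ℤ, (-1) ^ n * g n =
      2 * ∑' n, ∑' m, f (2 * m + 1 + n) * g n := by
  rw [← tsum_mul_left, ← tsum_mul_left, ← tsum_mul_left, ← (hg.mul_left _).tsum_sub
    (hg.neg_one_zpow_mul.mul_left _)]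
  refine tsum_congr fun n => ?_
  rw [tsum_mul_right]
  linear_combination g n * tsum_sub_tsum_neg_one_zpow_mul hf n

theorem theta_sq_add (hs : 0 < s) : theta3 s ^ 2 + theta4 s ^ 2 = 2 * theta3 (2 * s) ^ 2 := by
  have hs2 : 0 < 2 * s := by positivity
  have hp : Summable fun p : ℤ × ℤ => rexp (-s * p.1 ^ 2) * rexp (-s * p.2 ^ 2) := by
    simpa using summable_exp_gauss_prod hs hs one_ne_zero one_ne_zero 0 0
  have hq : Summable fun p : ℤ × ℤ =>
      rexp (-s * ((2 * p.1 + p.2 : ℤ) : ℝ) ^ 2) * rexp (-s * p.2 ^ 2) :=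
    hp.comp_injective (i := fun p : ℤ × ℤ => (2 * p.1 + p.2, p.2)) (fun p p' h => by
        simp only [Prod.mk.injEq] at h
        ext <;> omega)
  rw [sq, sq, sq]
  have h := tsum_mul_tsum_add (summable_theta3 hs) (summable_theta3 hs)
  rw [hq.tsum_comm] at h
  refine h.trans ?_
  rw [theta3, tsum_mul_tsum_int (summable_theta3 hs2).norm (summable_theta3 hs2).norm]
  congr 1
  refine tsum_congr fun m => ?_
  rw [← (Equiv.subRight m).tsum_eq]
  refine tsum_congr fun n => ?_
  simp only [Equiv.subRight_apply, ← Real.exp_add]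
  congr 1
  push_cast
  ring

set_option maxHeartbeats 1000000 in
/-- The modular equation of degree three. -/
theorem theta3_mul_theta3 (hs : 0 < s) :
    theta3 s * theta3 (3 * s) = theta2 s * theta2 (3 * s) + theta4 s * theta4 (3 * s) := by
  have hs3 : 0 < 3 * s := by positivity
  have hp : Summable fun p : ℤ × ℤ => rexp (-s * p.1 ^ 2) * rexp (-(3 * s) * p.2 ^ 2) := by
    simpa using summable_exp_gauss_prod hs hs3 one_ne_zero one_ne_zero 0 0
  have hq : Summable fun p : ℤ × ℤ =>
      rexp (-s * ((2 * p.1 + 1 + p.2 : ℤ) : ℝ) ^ 2) * rexp (-(3 * s) * p.2 ^ 2) :=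
    hp.comp_injective (i := fun p : ℤ × ℤ => (2 * p.1 + 1 + p.2, p.2)) (fun p p' h => by
        simp only [Prod.mk.injEq] at h
        ext <;> omega)
  rw [← sub_eq_iff_eq_add]
  rw [theta3, theta3, theta4, theta4, tsum_mul_tsum_sub (summable_theta3 hs) (summable_theta3 hs3),
    hq.tsum_comm]
  rw [theta2, theta2, tsum_mul_tsum_int (summable_theta2 hs).norm (summable_theta2 hs3).norm,
    ← tsum_mul_left]
  refine tsum_congr fun y => ?_
  have hx : Summable fun x : ℤ => rexp (-s * (x + 1 / 2) ^ 2) * rexp (-(3 * s) * (y + 1 / 2) ^ 2) :=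
    (summable_theta2 hs).mul_right _
  have hx' : Summable fun x : ℤ => rexp (-s * (((Equiv.addRight y) x : ℤ) + 1 / 2) ^ 2) *
      rexp (-(3 * s) * (y + 1 / 2) ^ 2) := (Equiv.addRight y).summable_iff.mpr hx
  rw [← (Equiv.addRight y).tsum_eq fun x : ℤ =>
    rexp (-s * (x + 1 / 2) ^ 2) * rexp (-(3 * s) * (y + 1 / 2) ^ 2),
    tsum_int_eq_mod_two hx', two_mul]
  congr 1
  · refine tsum_congr fun n => ?_
    simp only [Equiv.coe_addRight, ← Real.exp_add]
    congr 1
    push_cast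
    ring
  · rw [← (Equiv.subLeft (-1 - y)).tsum_eq]
    refine tsum_congr fun n => ?_
    simp only [Equiv.coe_addRight, Equiv.subLeft_apply, ← Real.exp_add]
    congr 1
    push_cast
    ring

end Isometries

section ThetaProducts

variable {s : ℝ}

theorem norm_exp_neg_lt_one (hs : 0 < s) : ‖rexp (-s)‖ < 1 := by
  rw [Real.norm_eq_abs, Real.abs_exp, Real.exp_lt_one_iff]
  linarith

theorem theta3_eq_thetaJ (s : ℝ) : theta3 s = thetaJ (rexp (-s) ^ 2) (-rexp (-s)) := by
  rw [theta3, thetaJ]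
  refine tsum_congr fun n => ?_
  have h := exp_gauss_eq_thetaJ_term s 1 0 n
  rw [show -s * (1 * (n : ℝ) + 0) ^ 2 = -s * n ^ 2 by ring,
    show -2 * s * 1 ^ 2 = (2 : ℕ) * -s by push_cast; ring, Real.exp_nat_mul,
    show -s * 1 ^ 2 - 2 * s * 1 * 0 = -s by ring] at h
  rw [h, neg_eq_neg_one_mul (rexp (-s)), mul_zpow]
  simp only [ne_eq, OfNat.ofNat_ne_zero, not_false_eq_true, zero_pow, mul_zero, Real.exp_zero,
    one_mul]
  linear_combination -(rexp (-s) ^ 2) ^ (n * (n - 1) / 2) * rexp (-s) ^ n * neg_one_zpow_mul_self n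

theorem theta4_eq_thetaJ (s : ℝ) : theta4 s = thetaJ (rexp (-s) ^ 2) (rexp (-s)) := by
  rw [theta4, thetaJ]
  refine tsum_congr fun n => ?_
  have h := exp_gauss_eq_thetaJ_term s 1 0 n
  rw [show -s * (1 * (n : ℝ) + 0) ^ 2 = -s * n ^ 2 by ring,
    show -2 * s * 1 ^ 2 = (2 : ℕ) * -s by push_cast; ring, Real.exp_nat_mul,
    show -s * 1 ^ 2 - 2 * s * 1 * 0 = -s by ring] at h
  rw [h]
  simp only [ne_eq, OfNat.ofNat_ne_zero, not_false_eq_true, zero_pow, mul_zero, Real.exp_zero,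
    one_mul]
  ring

theorem theta2_eq_thetaJ (s : ℝ) :
    theta2 s = rexp (-s / 4) * thetaJ (rexp (-s) ^ 2) (-rexp (-s) ^ 2) := by
  rw [theta2, thetaJ, ← tsum_mul_left]
  refine tsum_congr fun n => ?_
  have h := exp_gauss_eq_thetaJ_term s 1 (1 / 2) n
  rw [show -s * (1 * (n : ℝ) + 1 / 2) ^ 2 = -s * (n + 1 / 2) ^ 2 by ring,
    show -2 * s * 1 ^ 2 = (2 : ℕ) * -s by push_cast; ring, Real.exp_nat_mul,
    show -s * 1 ^ 2 - 2 * s * 1 * (1 / 2) = (2 : ℕ) * -s by push_cast; ring, Real.exp_nat_mul,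
    show -s * (1 / 2) ^ 2 = -s / 4 by ring] at h
  rw [h, neg_eq_neg_one_mul (rexp (-s) ^ 2), mul_zpow]
  linear_combination -rexp (-s / 4) * (rexp (-s) ^ 2) ^ (n * (n - 1) / 2) *
    (rexp (-s) ^ 2) ^ n * neg_one_zpow_mul_self n

theorem etaR_eq_qInf (hs : 0 < s) : etaR s = rexp (-s / 24) * qInf (rexp (-s)) (rexp (-s)) := by
  rw [← thetaJ_cube_self (Real.exp_ne_zero _) (norm_exp_neg_lt_one hs),
    ← thetaJ_div (pow_ne_zero 3 (Real.exp_ne_zero (-s))),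
    show rexp (-s) ^ 3 / rexp (-s) = rexp (-s) ^ 2 by field_simp, etaR, thetaJ, ← tsum_mul_left]
  refine tsum_congr fun n => ?_
  have h := exp_gauss_eq_thetaJ_term (s / 24) 6 1 n
  rw [show -(s / 24) * (6 * (n : ℝ) + 1) ^ 2 = -s / 24 * (6 * n + 1) ^ 2 by ring,
    show -2 * (s / 24) * 6 ^ 2 = (3 : ℕ) * -s by push_cast; ring, Real.exp_nat_mul,
    show -(s / 24) * 6 ^ 2 - 2 * (s / 24) * 6 * 1 = (2 : ℕ) * -s by push_cast; ring,
    Real.exp_nat_mul, show -(s / 24) * 1 ^ 2 = -s / 24 by ring] at h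
  rw [h]
  ring

theorem theta4_eq_qInf (hs : 0 < s) : theta4 s =
    qInf (rexp (-s)) (rexp (-s) ^ 2) ^ 2 * qInf (rexp (-s) ^ 2) (rexp (-s) ^ 2) := by
  rw [theta4_eq_thetaJ, thetaJ_sq_self (Real.exp_ne_zero _) (norm_exp_neg_lt_one hs)]

theorem theta3_eq_qInf (hs : 0 < s) : theta3 s =
    qInf (-rexp (-s)) (rexp (-s) ^ 2) ^ 2 * qInf (rexp (-s) ^ 2) (rexp (-s) ^ 2) := by
  have := thetaJ_sq_self (neg_ne_zero.mpr (Real.exp_ne_zero (-s)))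
    (by simpa using norm_exp_neg_lt_one hs)
  rwa [neg_sq, ← theta3_eq_thetaJ] at this

theorem theta2_eq_qInf (hs : 0 < s) : theta2 s = 2 * rexp (-s / 4) *
    qInf (-rexp (-s) ^ 2) (rexp (-s) ^ 2) ^ 2 * qInf (rexp (-s) ^ 2) (rexp (-s) ^ 2) := by
  have h2 := norm_pow_lt_one (norm_exp_neg_lt_one hs) two_ne_zero
  have h0 := pow_ne_zero 2 (Real.exp_ne_zero (-s))
  rw [theta2_eq_thetaJ, thetaJ_eq_qInf h0 h2 (neg_ne_zero.mpr h0),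
    show rexp (-s) ^ 2 / -rexp (-s) ^ 2 = -1 by field_simp, qInf_eq_one_sub_mul h2 (-1),
    neg_one_mul]
  ring

theorem exp_neg_mul_eq_pow (s : ℝ) (k : ℕ) : rexp (-(k * s)) = rexp (-s) ^ k := by
  rw [← Real.exp_nat_mul]
  ring_nf

theorem etaR_pos (hs : 0 < s) : 0 < etaR s := by
  rw [etaR_eq_qInf hs]
  have h1 := norm_exp_neg_lt_one hs
  have : 0 ≤ qInf (rexp (-s)) (rexp (-s)) := by
    refine ge_of_tendsto' (tendsto_qInf h1) fun n => Finset.prod_nonneg fun i _ => ?_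
    rw [← pow_succ', sub_nonneg]
    exact pow_le_one₀ (Real.exp_pos _).le (by rw [Real.exp_le_one_iff]; linarith)
  have := lt_of_le_of_ne this (qInf_self_ne_zero h1).symm
  positivity

theorem etaR_sq (hs : 0 < s) : etaR s ^ 2 = theta4 s * etaR (2 * s) := by
  have h1 := norm_exp_neg_lt_one hs
  have hQ : rexp (-(2 * s)) = rexp (-s) ^ 2 := by exact_mod_cast exp_neg_mul_eq_pow s 2
  rw [etaR_eq_qInf hs, theta4_eq_qInf hs, etaR_eq_qInf (s := 2 * s) (by positivity), hQ,
    qInf_self_eq_sq h1, mul_pow, ← Real.exp_nat_mul, show -(2 * s) / 24 = (2 : ℕ) * (-s / 24) by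
      push_cast; ring]
  ring

theorem etaR_four_mul_sq (hs : 0 < s) : 2 * etaR (4 * s) ^ 2 = theta2 s * etaR (2 * s) := by
  have h1 := norm_exp_neg_lt_one hs
  have h2 := norm_pow_lt_one h1 two_ne_zero
  have hQ : rexp (-(2 * s)) = rexp (-s) ^ 2 := by exact_mod_cast exp_neg_mul_eq_pow s 2
  have hQ4 : rexp (-(4 * s)) = (rexp (-s) ^ 2) ^ 2 := by
    rw [← pow_mul]
    exact_mod_cast exp_neg_mul_eq_pow s 4
  have e : rexp (-(4 * s) / 24) ^ 2 = rexp (-s / 4) * rexp (-(2 * s) / 24) := by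
    rw [← Real.exp_nat_mul, ← Real.exp_add]
    push_cast
    ring_nf
  rw [etaR_eq_qInf (s := 4 * s) (by positivity), theta2_eq_qInf hs,
    etaR_eq_qInf (s := 2 * s) (by positivity), hQ, hQ4, ← qInf_mul_qInf_neg h2, mul_pow, e]
  ring

theorem theta2_mul_theta3_mul_theta4 (hs : 0 < s) :
    theta2 s * theta3 s * theta4 s = 2 * etaR (2 * s) ^ 3 := by
  have h1 := norm_exp_neg_lt_one hs
  have h2 := norm_pow_lt_one h1 two_ne_zero
  have hQ : rexp (-(2 * s)) = rexp (-s) ^ 2 := by exact_mod_cast exp_neg_mul_eq_pow s 2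
  have e : rexp (-(2 * s) / 24) ^ 3 = rexp (-s / 4) := by
    rw [← Real.exp_nat_mul]
    push_cast
    ring_nf
  have k1 := qInf_mul_qInf_neg h2 (rexp (-s))
  have k2 := qInf_neg_mul_qInf_sq h2
  rw [theta2_eq_qInf hs, theta3_eq_qInf hs, theta4_eq_qInf hs,
    etaR_eq_qInf (s := 2 * s) (by positivity), hQ, mul_pow, e]
  rw [← k1] at k2
  generalize qInf (-rexp (-s) ^ 2) (rexp (-s) ^ 2) = a at *
  generalize qInf (-rexp (-s)) (rexp (-s) ^ 2) = b at *
  generalize qInf (rexp (-s)) (rexp (-s) ^ 2) = c at *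
  linear_combination 2 * rexp (-s / 4) * qInf (rexp (-s) ^ 2) (rexp (-s) ^ 2) ^ 3 *
    (a * (c * b) + 1) * k2

theorem etaR_pow_six (hs : 0 < s) : 2 * etaR s ^ 6 = theta4 s ^ 4 * theta2 s * theta3 s := by
  have h1 := etaR_sq hs
  have h2 := theta2_mul_theta3_mul_theta4 hs
  calc 2 * etaR s ^ 6 = 2 * (etaR s ^ 2) ^ 3 := by ring
    _ = _ := by
      rw [h1]
      linear_combination -theta4 s ^ 3 * h2

theorem etaR_four_mul_pow_six (hs : 0 < s) :
    16 * etaR (4 * s) ^ 6 = theta2 s ^ 4 * theta3 s * theta4 s := by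
  have h1 := etaR_four_mul_sq hs
  have h2 := theta2_mul_theta3_mul_theta4 hs
  calc 16 * etaR (4 * s) ^ 6 = 2 * (2 * etaR (4 * s) ^ 2) ^ 3 := by ring
    _ = _ := by
      rw [h1]
      linear_combination -theta2 s ^ 3 * h2

theorem theta2_sq (hs : 0 < s) : theta2 s ^ 2 = 2 * theta2 (2 * s) * theta3 (2 * s) := by
  have h1 := norm_exp_neg_lt_one hs
  have h2 := norm_pow_lt_one h1 two_ne_zero
  have h4 := norm_pow_lt_one h2 two_ne_zero
  have hQ : rexp (-(2 * s)) = rexp (-s) ^ 2 := by exact_mod_cast exp_neg_mul_eq_pow s 2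
  have e : rexp (-s / 4) ^ 2 = rexp (-(2 * s) / 4) := by
    rw [← Real.exp_nat_mul]
    push_cast
    ring_nf
  have k1 := qInf_eq_mul_sq h2 (-rexp (-s) ^ 2)
  have k2 := qInf_mul_qInf_neg h2 (rexp (-s) ^ 2)
  rw [show -rexp (-s) ^ 2 * rexp (-s) ^ 2 = -(rexp (-s) ^ 2) ^ 2 by ring] at k1
  rw [theta2_eq_qInf hs, theta2_eq_qInf (s := 2 * s) (by positivity),
    theta3_eq_qInf (s := 2 * s) (by positivity), hQ, ← k2, mul_pow, mul_pow, mul_pow, e, k1]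
  ring

theorem theta_sq_sub (hs : 0 < s) : theta3 s ^ 2 - theta4 s ^ 2 = 2 * theta2 (2 * s) ^ 2 := by
  rw [theta2_sq (s := 2 * s) (by positivity), theta3_eq_add hs, theta4_eq_sub hs,
    show 2 * (2 * s) = 4 * s by ring]
  ring

theorem jacobi_theta (hs : 0 < s) : theta3 s ^ 4 = theta2 s ^ 4 + theta4 s ^ 4 := by
  have h1 := theta_sq_add hs
  have h2 := theta_sq_sub hs
  have h3 := theta2_sq hs
  rw [show theta2 s ^ 4 = (theta2 s ^ 2) ^ 2 by ring, h3]
  linear_combination (theta3 s ^ 2 + theta4 s ^ 2) * h2 + 2 * theta2 (2 * s) ^ 2 * h1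

theorem theta3_mul_theta4_sub (hs : 0 < s) :
    theta3 s * theta4 (5 * s) - theta4 s * theta3 (5 * s) =
      4 * (etaR (4 * s) * etaR (5 * (4 * s))) := by
  have h := two_mul_etaR_mul_etaR (s := 4 * s) (by positivity)
  rw [theta3_eq_add hs, theta4_eq_sub hs, theta3_eq_add (s := 5 * s) (by positivity),
    theta4_eq_sub (s := 5 * s) (by positivity), show 4 * (5 * s) = 5 * (4 * s) by ring]
  linear_combination -2 * h

theorem ofReal_qInf {a q : ℝ} (hq : ‖q‖ < 1) : ((qInf a q : ℝ) : ℂ) = qInf (a : ℂ) (q : ℂ) := by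
  refine tendsto_nhds_unique ((Complex.continuous_ofReal.tendsto _).comp (tendsto_qInf hq))
    ((tendsto_qInf (by simpa using hq)).congr fun n => ?_)
  simp

theorem ofReal_thetaJ (q x : ℝ) : ((thetaJ q x : ℝ) : ℂ) = thetaJ (q : ℂ) (x : ℂ) := by
  rw [thetaJ, thetaJ, Complex.ofReal_tsum]
  simp

/-- A weight `3 / 2` theta series as an eta quotient. -/
theorem etaR_sq_mul_theta3 (hs : 0 < s) :
    etaR s ^ 2 * theta3 s = ∑' n : ℤ, (6 * n + 1) * rexp (-s / 12 * (6 * n + 1) ^ 2) := by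
  have h1 := norm_exp_neg_lt_one hs
  have h2 := norm_pow_lt_one h1 two_ne_zero
  have h4 := norm_pow_lt_one h1 four_ne_zero
  have h := tsum_six_mul_add_one_mul_pow (Q := ((rexp (-s) : ℝ) : ℂ))
    (Complex.ofReal_ne_zero.mpr (Real.exp_ne_zero _)) (by rwa [Complex.norm_real])
  have h' : qInf (rexp (-s) ^ 4) (rexp (-s) ^ 4) *
      ∑' n : ℤ, (6 * n + 1) * rexp (-s) ^ (3 * n ^ 2 + n) =
      qInf (rexp (-s) ^ 2) (rexp (-s) ^ 2) ^ 3 * thetaJ (rexp (-s) ^ 4) (rexp (-s) ^ 2) := by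
    apply Complex.ofReal_injective
    simp only [Complex.ofReal_mul, Complex.ofReal_pow, ofReal_qInf h2, ofReal_qInf h4,
      ofReal_thetaJ, Complex.ofReal_tsum, Complex.ofReal_zpow, Complex.ofReal_add,
      Complex.ofReal_intCast, Complex.ofReal_one, Complex.ofReal_ofNat]
    exact h
  have e : ∀ n : ℤ, (6 * n + 1) * rexp (-s / 12 * (6 * n + 1) ^ 2) =
      rexp (-s / 24) ^ 2 * ((6 * n + 1) * rexp (-s) ^ (3 * n ^ 2 + n)) := fun n => by
    rw [← Real.exp_intCast_mul, ← Real.exp_nat_mul, mul_left_comm, ← Real.exp_add]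
    congr 2
    push_cast
    ring
  rw [tsum_congr e, tsum_mul_left]
  refine mul_left_cancel₀ (qInf_self_ne_zero h4) ?_
  rw [mul_left_comm _ (rexp (-s / 24) ^ 2), h', etaR_eq_qInf hs, theta3_eq_qInf hs,
    show rexp (-s) ^ 4 = (rexp (-s) ^ 2) ^ 2 by ring,
    thetaJ_sq_self (pow_ne_zero 2 (Real.exp_ne_zero _)) h2, ← qInf_mul_qInf_neg h2 (rexp (-s)),
    qInf_self_eq_sq h1]
  ring

/-- A weight `3 / 2` theta series as an eta quotient. -/
theorem etaR_sq_mul_theta2 (hs : 0 < s) :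
    etaR s ^ 2 * theta2 s = -∑' n : ℤ, (6 * n - 2) * rexp (-s / 12 * (6 * n - 2) ^ 2) := by
  have h1 := norm_exp_neg_lt_one hs
  have h2 := norm_pow_lt_one h1 two_ne_zero
  have h4 := norm_pow_lt_one h1 four_ne_zero
  have h := tsum_six_mul_sub_two_mul_pow (Q := ((rexp (-s) : ℝ) : ℂ))
    (Complex.ofReal_ne_zero.mpr (Real.exp_ne_zero _)) (by rwa [Complex.norm_real])
  have h' : ∑' n : ℤ, (6 * n - 2) * rexp (-s) ^ (3 * n ^ 2 - 2 * n) =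
      -(2 * thetaJ (rexp (-s) ^ 2) (rexp (-s)) * qInf (rexp (-s) ^ 4) (rexp (-s) ^ 4) ^ 2) := by
    apply Complex.ofReal_injective
    simp only [Complex.ofReal_neg, Complex.ofReal_mul, Complex.ofReal_pow, ofReal_qInf h4,
      ofReal_thetaJ, Complex.ofReal_tsum, Complex.ofReal_zpow, Complex.ofReal_sub,
      Complex.ofReal_intCast, Complex.ofReal_ofNat]
    exact h
  have e : ∀ n : ℤ, (6 * n - 2) * rexp (-s / 12 * (6 * n - 2) ^ 2) =
      rexp (-s / 24) ^ 2 * rexp (-s / 4) * ((6 * n - 2) * rexp (-s) ^ (3 * n ^ 2 - 2 * n)) :=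
    fun n => by
    rw [← Real.exp_intCast_mul, ← Real.exp_nat_mul, mul_left_comm, ← Real.exp_add, ← Real.exp_add]
    congr 2
    push_cast
    ring
  rw [tsum_congr e, tsum_mul_left, h', etaR_eq_qInf hs, theta2_eq_qInf hs,
    show rexp (-s) ^ 4 = (rexp (-s) ^ 2) ^ 2 by ring,
    thetaJ_sq_self (Real.exp_ne_zero _) h1, ← qInf_mul_qInf_neg h2, qInf_self_eq_sq h1]
  ring

end ThetaProducts

section SingularValue

theorem eq_half_of_sextic {e : ℝ} (he0 : 0 < e) (hpos : 0 < 1 - 8 * e ^ 5) (hw : e ^ 3 ≤ 1 / 4)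
    (h : (1 - 8 * e ^ 5) ^ 2 = 4 * e ^ 3 * (1 - 8 * e ^ 6) + 8 * e ^ 6) : e = 1 / 2 := by
  have hw0 : 0 < e ^ 3 := by positivity
  have hf : (1 - 8 * e ^ 5) ^ 2 - (3 / 4) ^ 2 =
      (e ^ 3 - 1 / 8) * (-32 * (e ^ 3) ^ 2 + 4 * e ^ 3 + 9 / 2) := by
    rw [h]
    ring
  have hg : 0 < -32 * (e ^ 3) ^ 2 + 4 * e ^ 3 + 9 / 2 := by
    have : (e ^ 3) ^ 2 ≤ (1 / 4) ^ 2 := by gcongr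
    linarith
  rcases lt_trichotomy e (1 / 2) with h | h | h
  · exfalso
    have i3 : e ^ 3 < (1 / 2) ^ 3 := pow_lt_pow_left₀ h he0.le three_ne_zero
    have i5 : e ^ 5 < (1 / 2) ^ 5 := pow_lt_pow_left₀ h he0.le (by norm_num)
    have j1 : (3 / 4) ^ 2 < (1 - 8 * e ^ 5) ^ 2 :=
      pow_lt_pow_left₀ (by linarith) (by norm_num) two_ne_zero
    have := mul_neg_of_neg_of_pos (show e ^ 3 - 1 / 8 < 0 by linarith) hg
    linarith
  · exact h
  · exfalso
    have i3 : (1 / 2) ^ 3 < e ^ 3 := pow_lt_pow_left₀ h (by norm_num) three_ne_zero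
    have i5 : (1 / 2) ^ 5 < e ^ 5 := pow_lt_pow_left₀ h (by norm_num) (by norm_num)
    have j1 : (1 - 8 * e ^ 5) ^ 2 < (3 / 4) ^ 2 :=
      pow_lt_pow_left₀ (by linarith) hpos.le two_ne_zero
    have := mul_pos (show 0 < e ^ 3 - 1 / 8 by linarith) hg
    linarith

/-- The real algebra behind the singular moduli of `ℚ(√-15)`. -/
theorem mul_eq_of_modular_relations {a b c d : ℝ} (ha : 0 < a) (hb : 0 < b) (hc : 0 < c)
    (hd : 0 < d) (h3 : a * c + b * d = 1) (ha4 : a ^ 4 + b ^ 4 = 1) (hc4 : c ^ 4 + d ^ 4 = 1)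
    (h1 : (c - b) ^ 6 = 16 * d ^ 4 * a ^ 4 * c * b) (h1' : 0 < c - b)
    (h2 : (a - d) ^ 6 = 16 * c ^ 4 * d * b ^ 4 * a) (h2' : 0 < a - d) (hbd : b ≤ d) :
    c * d = (3 + √5) / 8 ∧ a * b = (3 - √5) / 8 := by
  set P := a * b * (c * d) with hP
  have hP0 : 0 < P := by positivity
  obtain ⟨e, he0, he⟩ : ∃ e : ℝ, 0 < e ∧ 4 * e ^ 6 = P := by
    refine ⟨(P / 4) ^ ((6 : ℕ) : ℝ)⁻¹, by positivity, ?_⟩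
    rw [Real.rpow_inv_natCast_pow (by positivity) (by norm_num)]
    ring
  have k1 : (c - b) ^ 2 = 4 * d * a * e ^ 2 := by
    refine (pow_left_inj₀ (by positivity) (by positivity) three_ne_zero).mp ?_
    linear_combination h1 - 16 * d ^ 3 * a ^ 3 * he
  have k2 : (a - d) ^ 2 = 4 * c * b * e ^ 2 := by
    refine (pow_left_inj₀ (by positivity) (by positivity) three_ne_zero).mp ?_
    linear_combination h2 - 16 * c ^ 3 * b ^ 3 * he
  have k3 : (c - b) * (a - d) = 8 * e ^ 5 := by
    refine (pow_left_inj₀ (by positivity) (by positivity) two_ne_zero).mp ?_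
    rw [mul_pow, k1, k2]
    linear_combination -16 * e ^ 4 * he
  have k4 : a * b + c * d = 1 - 8 * e ^ 5 := by linear_combination h3 - k3
  have k5 : a ^ 2 * d ^ 2 + c ^ 2 * b ^ 2 = 4 * e ^ 3 := by
    refine (pow_left_inj₀ (by positivity) (by positivity) two_ne_zero).mp ?_
    have : (a * c) ^ 4 + (b * d) ^ 4 = (1 - 2 * P) ^ 2 - 2 * P ^ 2 := by
      rw [hP]
      have : b * d = 1 - a * c := by linarith
      rw [show a * b * (c * d) = a * c * (b * d) by ring, this]
      ring
    linear_combination ha4 * (c ^ 4 + d ^ 4) + hc4 - this - 4 * he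
  have k6 : (a * b) ^ 2 + (c * d) ^ 2 = 4 * e ^ 3 * (1 - 2 * P) := by
    rw [← k5, show 1 - 2 * P = a ^ 2 * c ^ 2 + b ^ 2 * d ^ 2 by
      linear_combination (-a * c - b * d - 1) * h3]
    linear_combination -(c * d) ^ 2 * ha4 - (a * b) ^ 2 * hc4
  have k7 : (1 - 8 * e ^ 5) ^ 2 = 4 * e ^ 3 * (1 - 8 * e ^ 6) + 8 * e ^ 6 := by
    rw [← k4]
    linear_combination k6 + (2 - 8 * e ^ 3) * he * (-1)
  have hP4 : P ≤ 1 / 4 := by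
    have : P = a * c * (b * d) := by ring
    nlinarith [sq_nonneg (a * c - b * d)]
  have hw : e ^ 3 ≤ 1 / 4 := by
    have : (e ^ 3) ^ 2 ≤ (1 / 4) ^ 2 := by nlinarith
    exact le_of_pow_le_pow_left₀ two_ne_zero (by norm_num) this
  have hpos : 0 < 1 - 8 * e ^ 5 := by rw [← k4]; positivity
  have hhalf := eq_half_of_sextic he0 hpos hw k7
  rw [hhalf] at k4 he
  have hle : a * b ≤ c * d := by
    refine le_of_pow_le_pow_left₀ four_ne_zero (by positivity) ?_
    have i1 : b ^ 4 ≤ d ^ 4 := by gcongr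
    have i2 : d ^ 4 < a ^ 4 := pow_lt_pow_left₀ (by linarith) hd.le four_ne_zero
    rw [mul_pow, mul_pow]
    have e1 : b ^ 4 = 1 - a ^ 4 := by linarith
    have e2 : d ^ 4 = 1 - c ^ 4 := by linarith
    rw [e1, e2] at *
    nlinarith [mul_nonneg (show 0 ≤ a ^ 4 - c ^ 4 by linarith)
      (show 0 ≤ a ^ 4 + c ^ 4 - 1 by linarith)]
  have h5 : √5 = 4 * (c * d - a * b) := by
    rw [Real.sqrt_eq_iff_mul_self_eq (by norm_num) (by linarith)]
    have hs : a * b + c * d = 3 / 4 := by rw [k4]; norm_num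
    have hp : a * b * (c * d) = 1 / 16 := by rw [← hP, ← he]; norm_num
    linear_combination -16 * (a * b + c * d + 3 / 4) * hs + 64 * hp
  constructor <;> linarith

variable {s : ℝ}

theorem qInf_nonneg_of_le_one {a q : ℝ} (hq0 : 0 ≤ q) (hq : q < 1) (ha : a ≤ 1) :
    0 ≤ qInf a q := by
  refine ge_of_tendsto' (tendsto_qInf (by rwa [Real.norm_eq_abs, abs_of_nonneg hq0])) fun n =>
    Finset.prod_nonneg fun i _ => ?_
  have h1 : q ^ i ≤ 1 := pow_le_one₀ hq0 hq.le
  have h0 : 0 ≤ q ^ i := by positivity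
  nlinarith

theorem qInf_neg_pos {a q : ℝ} (hq0 : 0 ≤ q) (hq : q < 1) (ha : 0 ≤ a) :
    0 < qInf (-a) q := by
  refine lt_of_le_of_ne (qInf_nonneg_of_le_one hq0 hq (by linarith)) (Ne.symm ?_)
  refine qInf_ne_zero (by rwa [Real.norm_eq_abs, abs_of_nonneg hq0]) fun n h => ?_
  have : 0 ≤ q ^ n := by positivity
  nlinarith

theorem theta4_div_theta3_le {s t : ℝ} (hs : 0 < s) (hst : s ≤ t) :
    theta4 s / theta3 s ≤ theta4 t / theta3 t := by
  have ht := hs.trans_le hst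
  have key : ∀ u, 0 < u → theta4 u / theta3 u =
      (qInf (rexp (-u)) (rexp (-u) ^ 2) / qInf (-rexp (-u)) (rexp (-u) ^ 2)) ^ 2 := fun u hu => by
    rw [theta4_eq_qInf hu, theta3_eq_qInf hu, div_pow, mul_div_mul_right]
    exact qInf_self_ne_zero (norm_pow_lt_one (norm_exp_neg_lt_one hu) two_ne_zero)
  have hlt : ∀ u, 0 < u → rexp (-u) < 1 := fun u hu => by rw [Real.exp_lt_one_iff]; linarith
  have hlt2 : ∀ u, 0 < u → rexp (-u) ^ 2 < 1 := fun u hu =>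
    pow_lt_one₀ (Real.exp_pos _).le (hlt u hu) two_ne_zero
  have hst' : rexp (-t) ≤ rexp (-s) := by
    rw [Real.exp_le_exp]
    linarith
  rw [key s hs, key t ht]
  have hn := norm_pow_lt_one (norm_exp_neg_lt_one hs) two_ne_zero
  have hn' := norm_pow_lt_one (norm_exp_neg_lt_one ht) two_ne_zero
  have h0 : 0 ≤ qInf (rexp (-s)) (rexp (-s) ^ 2) :=
    qInf_nonneg_of_le_one (by positivity) (hlt2 s hs) (hlt s hs).le
  have h0' : 0 < qInf (-rexp (-t)) (rexp (-t) ^ 2) :=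
    qInf_neg_pos (by positivity) (hlt2 t ht) (Real.exp_pos _).le
  have h0'' : 0 < qInf (-rexp (-s)) (rexp (-s) ^ 2) :=
    qInf_neg_pos (by positivity) (hlt2 s hs) (Real.exp_pos _).le
  have i1 : qInf (rexp (-s)) (rexp (-s) ^ 2) ≤ qInf (rexp (-t)) (rexp (-t) ^ 2) := by
    refine le_of_tendsto_of_tendsto' (tendsto_qInf hn) (tendsto_qInf hn') fun n =>
      Finset.prod_le_prod (fun i _ => ?_) fun i _ => ?_
    · rw [sub_nonneg, ← pow_mul, ← pow_succ']
      exact pow_le_one₀ (Real.exp_pos _).le (hlt s hs).le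
    · gcongr
  have i2 : qInf (-rexp (-t)) (rexp (-t) ^ 2) ≤ qInf (-rexp (-s)) (rexp (-s) ^ 2) := by
    refine le_of_tendsto_of_tendsto' (tendsto_qInf hn') (tendsto_qInf hn) fun n =>
      Finset.prod_le_prod (fun i _ => ?_) fun i _ => ?_
    · rw [neg_mul, sub_neg_eq_add]
      positivity
    · rw [neg_mul, sub_neg_eq_add, neg_mul, sub_neg_eq_add]
      gcongr
  gcongr
  exact h0.trans i1

/-- The Weber function `f` in terms of theta constants. -/
theorem weber_pow_six (hs : 0 < s) :
    (rexp (s / 24) * qInf (-rexp (-s)) (rexp (-s) ^ 2)) ^ 6 *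
      (theta2 s / theta3 s * (theta4 s / theta3 s)) = 2 := by
  have h := theta2_mul_theta3_mul_theta4 hs
  have h3 := theta3_eq_qInf hs
  have hη := etaR_pos (s := 2 * s) (by positivity)
  have hη2 := etaR_eq_qInf (s := 2 * s) (by positivity)
  have hQ : rexp (-(2 * s)) = rexp (-s) ^ 2 := by exact_mod_cast exp_neg_mul_eq_pow s 2
  rw [hQ] at hη2
  have h0 := theta3_pos hs
  have e : rexp (s / 24) ^ 6 * rexp (-(2 * s) / 24) ^ 3 = 1 := by
    rw [← Real.exp_nat_mul, ← Real.exp_nat_mul, ← Real.exp_add, Real.exp_eq_one_iff]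
    push_cast
    ring
  have k : (rexp (s / 24) * qInf (-rexp (-s)) (rexp (-s) ^ 2)) ^ 6 * etaR (2 * s) ^ 3 =
      theta3 s ^ 3 := by
    rw [hη2, h3]
    linear_combination (qInf (-rexp (-s)) (rexp (-s) ^ 2)) ^ 6 *
      qInf (rexp (-s) ^ 2) (rexp (-s) ^ 2) ^ 3 * e
  generalize (rexp (s / 24) * qInf (-rexp (-s)) (rexp (-s) ^ 2)) ^ 6 = F at *
  field_simp
  refine mul_right_cancel₀ h0.ne' ?_
  linear_combination F * h + 2 * k

theorem theta2_div_theta3_sub (hs : 0 < s) :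
    0 < theta2 s / theta3 s - theta2 (5 * s) / theta3 (5 * s) ∧
    (theta2 s / theta3 s - theta2 (5 * s) / theta3 (5 * s)) ^ 6 =
      16 * (theta4 s / theta3 s) ^ 4 * (theta4 (5 * s) / theta3 (5 * s)) ^ 4 *
        (theta2 s / theta3 s) * (theta2 (5 * s) / theta3 (5 * s)) := by
  have hs5 : 0 < 5 * s := by positivity
  have h := two_mul_etaR_mul_etaR hs
  have p := theta3_pos hs
  have p5 := theta3_pos hs5
  have n := etaR_pow_six hs
  have n5 := etaR_pow_six hs5
  have q := etaR_pos hs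
  have q5 := etaR_pos hs5
  generalize theta3 (5 * s) = u3 at *
  generalize theta2 (5 * s) = u2 at *
  generalize theta4 (5 * s) = u4 at *
  generalize etaR (5 * s) = v at *
  have d : theta2 s / theta3 s - u2 / u3 = 2 * (etaR s * v) / (theta3 s * u3) := by
    rw [h]
    field_simp
  rw [d]
  refine ⟨by positivity, ?_⟩
  field_simp
  linear_combination 16 * 2 * v ^ 6 * n + 16 * theta4 s ^ 4 * theta2 s * theta3 s * n5

theorem theta4_div_theta3_sub (hs : 0 < s) :
    0 < theta4 (5 * s) / theta3 (5 * s) - theta4 s / theta3 s ∧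
    (theta4 (5 * s) / theta3 (5 * s) - theta4 s / theta3 s) ^ 6 =
      16 * (theta2 s / theta3 s) ^ 4 * (theta4 s / theta3 s) *
        (theta2 (5 * s) / theta3 (5 * s)) ^ 4 * (theta4 (5 * s) / theta3 (5 * s)) := by
  have hs5 : 0 < 5 * s := by positivity
  have h := theta3_mul_theta4_sub hs
  have p := theta3_pos hs
  have p5 := theta3_pos hs5
  have n := etaR_four_mul_pow_six hs
  have n5 := etaR_four_mul_pow_six hs5
  have q := etaR_pos (s := 4 * s) (by positivity)
  have q5 := etaR_pos (s := 5 * (4 * s)) (by positivity)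
  rw [show 4 * (5 * s) = 5 * (4 * s) by ring] at n5
  generalize theta3 (5 * s) = u3 at *
  generalize theta2 (5 * s) = u2 at *
  generalize theta4 (5 * s) = u4 at *
  generalize etaR (5 * (4 * s)) = v at *
  generalize etaR (4 * s) = w at *
  have d : u4 / u3 - theta4 s / theta3 s = 4 * (w * v) / (theta3 s * u3) := by
    rw [← h]
    field_simp
  rw [d]
  refine ⟨by positivity, ?_⟩
  field_simp
  linear_combination 16 * 16 * v ^ 6 * n + 16 * theta2 s ^ 4 * theta3 s * theta4 s * n5

theorem singular_value :
    2 * rexp (-(π / √15) / 3) * qInf (-rexp (-(π / √15))) (rexp (-(π / √15)) ^ 2) /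
      qInf (-rexp (-(3 * (π / √15)))) (rexp (-(3 * (π / √15))) ^ 2) ^ 3 =
      ((1 + √5) / 2) ^ ((4 : ℝ) / 3) := by
  set s := π / √15 with hs
  have h15 : √15 ^ 2 = 15 := Real.sq_sqrt (by norm_num)
  have hs0 : 0 < s := by positivity
  have hs3 : 0 < 3 * s := by positivity
  have hs15 : 0 < 5 * (3 * s) := by positivity
  have hinv : π ^ 2 / (5 * (3 * s)) = s := by
    rw [hs]
    field_simp
    rw [h15]
    norm_num
  have p1 := theta3_pos hs0
  have p3 := theta3_pos hs3
  have p15 := theta3_pos hs15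
  have e1 : theta2 (5 * (3 * s)) / theta3 (5 * (3 * s)) = theta4 s / theta3 s := by
    rw [theta2_inversion hs15, theta3_inversion hs15, hinv, mul_div_mul_left]
    positivity
  have e2 : theta4 (5 * (3 * s)) / theta3 (5 * (3 * s)) = theta2 s / theta3 s := by
    rw [theta4_inversion hs15, theta3_inversion hs15, hinv, mul_div_mul_left]
    positivity
  obtain ⟨d1, d1'⟩ := theta2_div_theta3_sub hs3
  obtain ⟨d2, d2'⟩ := theta4_div_theta3_sub hs3
  rw [e1] at d1
  rw [e2] at d2
  rw [e1, e2] at d1' d2'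
  have w1 := weber_pow_six hs0
  have w3 := weber_pow_six hs3
  have key := mul_eq_of_modular_relations (a := theta2 s / theta3 s) (b := theta4 s / theta3 s)
    (c := theta2 (3 * s) / theta3 (3 * s)) (d := theta4 (3 * s) / theta3 (3 * s))
    (div_pos (theta2_pos hs0) p1) (div_pos (theta4_pos hs0) p1) (div_pos (theta2_pos hs3) p3)
    (div_pos (theta4_pos hs3) p3)
    (by
      have := theta3_mul_theta3 hs0
      field_simp
      linarith)
    (by
      have := jacobi_theta hs0
      rw [div_pow, div_pow, ← add_div, ← this]
      field_simp)
    (by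
      have := jacobi_theta hs3
      rw [div_pow, div_pow, ← add_div, ← this]
      field_simp)
    d1' d1 d2' d2
    (theta4_div_theta3_le hs0 (by linarith))
  rw [key.1] at w3
  rw [key.2] at w1
  have hq : rexp (-s) ^ 2 < 1 :=
    pow_lt_one₀ (Real.exp_pos _).le (by rw [Real.exp_lt_one_iff]; linarith) two_ne_zero
  have hq3 : rexp (-(3 * s)) ^ 2 < 1 :=
    pow_lt_one₀ (Real.exp_pos _).le (by rw [Real.exp_lt_one_iff]; linarith) two_ne_zero
  have f1 := qInf_neg_pos (by positivity) hq (Real.exp_pos (-s)).le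
  have f3 := qInf_neg_pos (by positivity) hq3 (Real.exp_pos (-(3 * s))).le
  have e : rexp (-s / 3) ^ 6 * (rexp (3 * s / 24) ^ 6) ^ 3 = rexp (s / 24) ^ 6 := by
    rw [← pow_mul, ← Real.exp_nat_mul, ← Real.exp_nat_mul, ← Real.exp_nat_mul, ← Real.exp_add]
    congr 1
    push_cast
    ring
  have hφ : 0 < (1 + √5) / 2 := by positivity
  have h5 : √5 ^ 2 = 5 := Real.sq_sqrt (by norm_num)
  have h5' : 0 < 3 - √5 := by nlinarith [Real.sqrt_nonneg 5]
  refine (pow_left_inj₀ (by positivity) (by positivity) (show 6 ≠ 0 by norm_num)).mp ?_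
  rw [← Real.rpow_mul_natCast hφ.le, show (4 : ℝ) / 3 * (6 : ℕ) = (8 : ℕ) by norm_num,
    Real.rpow_natCast]
  rw [mul_pow] at w1 w3
  generalize qInf (-rexp (-s)) (rexp (-s) ^ 2) = F at *
  generalize qInf (-rexp (-(3 * s))) (rexp (-(3 * s)) ^ 2) = G at *
  have hE : 0 < rexp (s / 24) ^ 6 := by positivity
  have hE3 : 0 < rexp (3 * s / 24) ^ 6 := by positivity
  rw [div_pow, mul_pow, mul_pow, ← pow_mul, show G ^ (3 * 6) = (G ^ 6) ^ 3 by ring]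
  generalize rexp (s / 24) ^ 6 = E at *
  generalize rexp (3 * s / 24) ^ 6 = H at *
  generalize rexp (-s / 3) ^ 6 = K at *
  have hF : F ^ 6 = 16 / (E * (3 - √5)) := by
    field_simp
    linear_combination 8 * w1
  have hG : G ^ 6 = 16 / (H * (3 + √5)) := by
    field_simp
    linear_combination 8 * w3
  rw [hF, hG, ← e]
  have hK : 0 < K := by
    rcases lt_or_ge 0 K with h | h
    · exact h
    · nlinarith [pow_pos hE3 3]
  field_simp
  have g1 : (1 + √5) ^ 8 = 16 * (3 + √5) ^ 4 := by
    rw [show (1 + √5) ^ 8 = ((1 + √5) ^ 2) ^ 4 by ring,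
      show (1 + √5) ^ 2 = 2 * (3 + √5) by linear_combination h5]
    ring
  rw [g1]
  linear_combination 16 ^ 3 * (3 + √5) ^ 3 * h5

end SingularValue

section BoxLimit

open MeasureTheory Set

theorem integrableOn_mul_exp_neg {c : ℝ} (hc : 0 < c) :
    IntegrableOn (fun t : ℝ => t * rexp (-(c * t))) (Ioi 0) := by
  refine (integrableOn_rpow_mul_exp_neg_mul_rpow (s := 1) (p := 1) (by norm_num) one_pos hc).congr_fun
    (fun t _ => ?_) measurableSet_Ioi
  simp

theorem integral_mul_exp_neg {c : ℝ} (hc : 0 < c) :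
    ∫ t in Ioi (0 : ℝ), t * rexp (-(c * t)) = 1 / c ^ 2 := by
  have h := Real.integral_rpow_mul_exp_neg_mul_Ioi (a := 2) two_pos hc
  have e : Real.Gamma 2 = 1 := by
    simp
  rw [e, mul_one, show (1 / c) ^ (2 : ℝ) = 1 / c ^ 2 by
    rw [show (2 : ℝ) = (2 : ℕ) by norm_num, Real.rpow_natCast]; ring] at h
  rw [← h]
  refine setIntegral_congr_fun measurableSet_Ioi fun t _ => ?_
  norm_num

theorem alternating_sum_mem_Icc {f : ℕ → ℝ} (hf : Antitone f) (h0 : ∀ n, 0 ≤ f n) (n : ℕ) :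
    ∑ i ∈ Finset.range n, (-1) ^ i * f i ∈ Icc 0 (f 0) := by
  induction n generalizing f with
  | zero => simp [h0]
  | succ n ih =>
    have := ih (f := fun i => f (i + 1)) (fun a b hab => hf (by omega)) fun n => h0 _
    rw [Finset.sum_range_succ']
    have e : ∑ i ∈ Finset.range n, (-1) ^ (i + 1) * f (i + 1) =
        -∑ i ∈ Finset.range n, (-1) ^ i * f (i + 1) := by
      rw [← Finset.sum_neg_distrib]
      exact Finset.sum_congr rfl fun i _ => by ring
    rw [e]
    have h1 := hf (Nat.zero_le 1)
    simp only [mem_Icc, zero_add] at this ⊢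
    constructor <;> simp <;> linarith

theorem sum_Icc_neg_eq {f : ℤ → ℝ} (v : ℕ) :
    ∑ n ∈ Finset.Icc (-(v : ℤ)) v, f n =
      ∑ i ∈ Finset.range (v + 1), f i + ∑ i ∈ Finset.range v, f (-(i + 1 : ℕ)) := by
  induction v with
  | zero => simp
  | succ v ih =>
    rw [show Finset.Icc (-((v + 1 : ℕ) : ℤ)) ((v + 1 : ℕ) : ℤ) =
      insert ((v + 1 : ℕ) : ℤ) (insert (-((v + 1 : ℕ) : ℤ)) (Finset.Icc (-(v : ℤ)) v)) by
        ext x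
        simp only [Finset.mem_Icc, Finset.mem_insert]
        omega, Finset.sum_insert (by simp; omega), Finset.sum_insert (by simp), ih,
      Finset.sum_range_succ _ (v + 1),
      Finset.sum_range_succ (fun i : ℕ => f (-(i + 1 : ℕ))) v]
    ring

/-- The partial sums of the eta series. -/
noncomputable def etaPartial (v : ℕ) (t : ℝ) : ℝ :=
  ∑ n ∈ Finset.Icc (-(v : ℤ)) v, (-1) ^ n * rexp (-((6 * n + 1) ^ 2 * t))

theorem abs_etaPartial_le (v : ℕ) {t : ℝ} (ht : 0 ≤ t) : |etaPartial v t| ≤ rexp (-t) := by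
  rw [etaPartial, sum_Icc_neg_eq]
  have h1 := alternating_sum_mem_Icc (f := fun n => rexp (-((6 * n + 1) ^ 2 * t)))
    (fun a b hab => by
      have : (a : ℝ) ≤ b := by exact_mod_cast hab
      simp only [Real.exp_le_exp]
      gcongr) (fun n => (Real.exp_pos _).le) (v + 1)
  have h2 := alternating_sum_mem_Icc (f := fun n => rexp (-((6 * n + 5) ^ 2 * t)))
    (fun a b hab => by
      have : (a : ℝ) ≤ b := by exact_mod_cast hab
      simp only [Real.exp_le_exp]
      gcongr) (fun n => (Real.exp_pos _).le) v
  have e1 : ∑ i ∈ Finset.range (v + 1), (-1 : ℝ) ^ (i : ℤ) *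
      rexp (-((6 * ((i : ℤ) : ℝ) + 1) ^ 2 * t)) =
      ∑ i ∈ Finset.range (v + 1), (-1 : ℝ) ^ i * rexp (-((6 * i + 1) ^ 2 * t)) := by
    simp
  have e2 : ∑ i ∈ Finset.range v, (-1 : ℝ) ^ (-((i + 1 : ℕ) : ℤ)) *
      rexp (-((6 * ((-((i + 1 : ℕ) : ℤ) : ℤ) : ℝ) + 1) ^ 2 * t)) =
      -∑ i ∈ Finset.range v, (-1 : ℝ) ^ i * rexp (-((6 * i + 5) ^ 2 * t)) := by
    rw [← Finset.sum_neg_distrib]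
    refine Finset.sum_congr rfl fun i _ => ?_
    rw [zpow_neg, zpow_natCast, ← inv_pow, show ((-1 : ℝ)⁻¹) = -1 by norm_num, pow_succ,
      show (6 * ((-((i + 1 : ℕ) : ℤ) : ℤ) : ℝ) + 1) ^ 2 = (6 * i + 5) ^ 2 by push_cast; ring]
    ring
  rw [e1, e2]
  have h3 : rexp (-(25 * t)) ≤ rexp (-t) := by
    rw [Real.exp_le_exp]
    linarith
  simp only [mem_Icc] at h1 h2
  norm_num at h1 h2
  rw [abs_le]
  constructor <;> linarith [h1.1, h1.2, h2.1, h2.2]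

theorem tendsto_etaPartial {t : ℝ} (ht : 0 < t) :
    Tendsto (fun v => etaPartial v t) atTop (𝓝 (etaR (24 * t))) := by
  have h := (summable_etaR (s := 24 * t) (by positivity)).hasSum
  have h' := h.comp Finset.tendsto_Icc_neg
  refine h'.congr fun v => ?_
  simp only [Function.comp_apply, etaPartial]
  refine Finset.sum_congr rfl fun n _ => ?_
  congr 2
  ring

theorem boxSum_eq_integral (v : ℕ) :
    boxSum 1 5 5 5 v = ∫ t in Ioi (0 : ℝ), t * etaPartial v t * etaPartial v (5 * t) ^ 3 := by
  have hX : ∀ n₁ n₂ n₃ n₄ : ℤ, (0 : ℝ) < 1 * ((6 * n₁ + 1 : ℤ) : ℝ) ^ 2 +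
      5 * ((6 * n₂ + 1 : ℤ) : ℝ) ^ 2 + 5 * ((6 * n₃ + 1 : ℤ) : ℝ) ^ 2 +
      5 * ((6 * n₄ + 1 : ℤ) : ℝ) ^ 2 := fun n₁ n₂ n₃ n₄ => by
    have : ((6 * n₁ + 1 : ℤ) : ℝ) ≠ 0 := by
      rw [Int.cast_ne_zero]
      omega
    positivity
  have e : ∀ t : ℝ, t * etaPartial v t * etaPartial v (5 * t) ^ 3 =
      ∑ n₁ ∈ Finset.Icc (-(v:ℤ)) (v:ℤ), ∑ n₂ ∈ Finset.Icc (-(v:ℤ)) (v:ℤ),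
      ∑ n₃ ∈ Finset.Icc (-(v:ℤ)) (v:ℤ), ∑ n₄ ∈ Finset.Icc (-(v:ℤ)) (v:ℤ),
        (-1:ℝ)^(n₁+n₂+n₃+n₄) * (t * rexp (-((1 * ((6 * n₁ + 1 : ℤ) : ℝ) ^ 2 +
        5 * ((6 * n₂ + 1 : ℤ) : ℝ) ^ 2 + 5 * ((6 * n₃ + 1 : ℤ) : ℝ) ^ 2 +
        5 * ((6 * n₄ + 1 : ℤ) : ℝ) ^ 2) * t))) := fun t => by
    rw [pow_three, mul_assoc, etaPartial, etaPartial, Finset.sum_mul, Finset.mul_sum]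
    refine Finset.sum_congr rfl fun n₁ _ => ?_
    rw [Finset.sum_mul, Finset.mul_sum, Finset.mul_sum]
    refine Finset.sum_congr rfl fun n₂ _ => ?_
    rw [Finset.sum_mul, Finset.mul_sum, Finset.mul_sum, Finset.mul_sum]
    refine Finset.sum_congr rfl fun n₃ _ => ?_
    rw [Finset.mul_sum, Finset.mul_sum, Finset.mul_sum, Finset.mul_sum]
    refine Finset.sum_congr rfl fun n₄ _ => ?_
    rw [neg_one_zpow_add, neg_one_zpow_add, neg_one_zpow_add, show
      rexp (-((1 * ((6 * n₁ + 1 : ℤ) : ℝ) ^ 2 + 5 * ((6 * n₂ + 1 : ℤ) : ℝ) ^ 2 +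
        5 * ((6 * n₃ + 1 : ℤ) : ℝ) ^ 2 + 5 * ((6 * n₄ + 1 : ℤ) : ℝ) ^ 2) * t)) =
      rexp (-((6 * n₁ + 1) ^ 2 * t)) * rexp (-((6 * n₂ + 1) ^ 2 * (5 * t))) *
        rexp (-((6 * n₃ + 1) ^ 2 * (5 * t))) * rexp (-((6 * n₄ + 1) ^ 2 * (5 * t))) by
        rw [← Real.exp_add, ← Real.exp_add, ← Real.exp_add]
        push_cast
        ring_nf]
    ring
  have hi : ∀ n₁ n₂ n₃ n₄ : ℤ, Integrable (fun t : ℝ => (-1:ℝ)^(n₁+n₂+n₃+n₄) *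
      (t * rexp (-((1 * ((6 * n₁ + 1 : ℤ) : ℝ) ^ 2 +
        5 * ((6 * n₂ + 1 : ℤ) : ℝ) ^ 2 + 5 * ((6 * n₃ + 1 : ℤ) : ℝ) ^ 2 +
        5 * ((6 * n₄ + 1 : ℤ) : ℝ) ^ 2) * t)))) (volume.restrict (Ioi 0)) := fun n₁ n₂ n₃ n₄ =>
    (integrableOn_mul_exp_neg (hX n₁ n₂ n₃ n₄)).const_mul _
  simp only [e]
  rw [integral_finsetSum _ fun n₁ _ => integrable_finsetSum _ fun n₂ _ =>
    integrable_finsetSum _ fun n₃ _ => integrable_finsetSum _ fun n₄ _ => hi n₁ n₂ n₃ n₄]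
  refine Finset.sum_congr rfl fun n₁ _ => ?_
  rw [integral_finsetSum _ fun n₂ _ => 
    integrable_finsetSum _ fun n₃ _ => integrable_finsetSum _ fun n₄ _ => hi n₁ n₂ n₃ n₄]
  refine Finset.sum_congr rfl fun n₂ _ => ?_
  rw [integral_finsetSum _ fun n₃ _ => integrable_finsetSum _ fun n₄ _ => hi n₁ n₂ n₃ n₄]
  refine Finset.sum_congr rfl fun n₃ _ => ?_
  rw [integral_finsetSum _ fun n₄ _ => hi n₁ n₂ n₃ n₄]
  refine Finset.sum_congr rfl fun n₄ _ => ?_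
  rw [integral_const_mul, integral_mul_exp_neg (hX n₁ n₂ n₃ n₄)]
  ring

theorem tendsto_boxSum : Tendsto (boxSum 1 5 5 5) atTop
    (𝓝 (∫ t in Ioi (0 : ℝ), t * etaR (24 * t) * etaR (24 * (5 * t)) ^ 3)) := by
  have h : boxSum 1 5 5 5 = fun v => ∫ t in Ioi (0 : ℝ),
      t * etaPartial v t * etaPartial v (5 * t) ^ 3 := funext boxSum_eq_integral
  rw [h]
  refine tendsto_integral_of_dominated_convergence (fun t => t * rexp (-(16 * t))) ?_
    (integrableOn_mul_exp_neg (by norm_num)) ?_ ?_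
  · intro v
    refine Continuous.aestronglyMeasurable ?_
    unfold etaPartial
    fun_prop
  · intro v
    refine (ae_restrict_mem measurableSet_Ioi).mono fun t (ht : 0 < t) => ?_
    have h1 := abs_etaPartial_le v ht.le
    have h2 := abs_etaPartial_le v (t := 5 * t) (by positivity)
    rw [norm_mul, norm_mul, norm_pow, Real.norm_eq_abs, Real.norm_eq_abs, Real.norm_eq_abs,
      abs_of_pos ht]
    calc t * |etaPartial v t| * |etaPartial v (5 * t)| ^ 3
        ≤ t * rexp (-t) * rexp (-(5 * t)) ^ 3 := by gcongr
      _ = t * rexp (-(16 * t)) := by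
        rw [← Real.exp_nat_mul, mul_assoc, ← Real.exp_add]
        congr 2
        push_cast
        ring
  · refine (ae_restrict_mem measurableSet_Ioi).mono fun t (ht : 0 < t) => ?_
    exact ((tendsto_etaPartial ht).const_mul t).mul
      ((tendsto_etaPartial (t := 5 * t) (by positivity)).pow 3)

end BoxLimit

section LatticeEvaluation

open MeasureTheory Set

/-- The Lambert summand of the evaluated lattice sum. -/
noncomputable def lambertTerm (p : ℝ) : ℝ := p * (1 - p ^ 2) / (1 + p + p ^ 2) ^ 2

theorem one_add_add_sq_pos (p : ℝ) : 0 < 1 + p + p ^ 2 := by nlinarith [sq_nonneg (p + 1 / 2)]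

theorem abs_lambertTerm_le {p : ℝ} (hp : |p| ≤ 1) : |lambertTerm p| ≤ 16 / 9 * |p| := by
  have h1 : 3 / 4 ≤ 1 + p + p ^ 2 := by nlinarith [sq_nonneg (p + 1 / 2)]
  have h3 : p ^ 2 ≤ 1 := by rw [← sq_abs]; exact pow_le_one₀ (abs_nonneg p) hp
  have h2 : |1 - p ^ 2| ≤ 1 := by
    rw [abs_le]
    constructor <;> nlinarith [sq_nonneg p]
  rw [lambertTerm, abs_div, abs_mul, abs_of_pos (pow_pos (one_add_add_sq_pos p) 2),
    div_le_iff₀ (by positivity)]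
  nlinarith [mul_le_of_le_one_right (abs_nonneg p) h2, abs_nonneg p,
    mul_nonneg (abs_nonneg p) (show 0 ≤ (1 + p + p ^ 2) ^ 2 - 9 / 16 by nlinarith)]

theorem HasSum.congr_eq {ι : Type*} {f g : ι → ℝ} {a b : ℝ} (h : HasSum f a)
    (hfg : ∀ i, g i = f i) (hab : b = a) : HasSum g b := by
  rw [hab, funext hfg]
  exact h

theorem summable_inv_add_sq (z : ℂ) : Summable fun n : ℤ => 1 / (z + n) ^ 2 := by
  have := EisensteinSeries.linear_right_summable z 1 (k := 2) le_rfl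
  refine this.congr fun n => ?_
  rw [Int.cast_one, one_mul, one_div]
  norm_cast

theorem tsum_inv_add_sq {z : ℂ} (hz : 0 < z.im) : ∑' n : ℤ, 1 / (z + n) ^ 2 =
    -4 * π ^ 2 * (Complex.exp (2 * π * Complex.I * z) /
      (1 - Complex.exp (2 * π * Complex.I * z)) ^ 2) := by
  have h := EisensteinSeries.qExpansion_identity (k := 1) le_rfl ⟨z, hz⟩
  have hn : ‖Complex.exp (2 * π * Complex.I * z)‖ < 1 := by
    rw [Complex.norm_exp, Real.exp_lt_one_iff]
    have : (2 * π * Complex.I * z).re = -(2 * π * z.im) := by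
      simp [Complex.mul_re, Complex.mul_im]
    rw [this]
    have := Real.pi_pos
    linarith [mul_pos (mul_pos two_pos Real.pi_pos) hz]
  have h2 := tsum_coe_mul_geometric_of_norm_lt_one hn
  simp only [pow_one, Nat.factorial_one, Nat.cast_one, div_one] at h
  rw [h2] at h
  refine Eq.trans h ?_
  have : (-2 * (π : ℂ) * Complex.I) ^ 2 = -4 * π ^ 2 := by
    rw [mul_pow, Complex.I_sq]; ring
  rw [show 1 + 1 = 2 from rfl, this]

theorem hasSum_odd_kernel {e w p : ℝ} (hw : 0 < w)
    (hQ : Complex.exp (2 * π * Complex.I * ((e + w * Complex.I) / 6)) =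
      p * (-1 / 2 - √3 / 2 * Complex.I)) :
    HasSum (fun n : ℤ => (6 * n + e) / ((6 * n + e) ^ 2 + w ^ 2) ^ 2)
      (-(π ^ 2 * √3 / (36 * w)) * lambertTerm p) := by
  set z : ℂ := (e + w * Complex.I) / 6 with hz
  have hzim : z.im = w / 6 := by
    rw [hz, show (e + w * Complex.I) / 6 = ((e / 6 : ℝ) : ℂ) + ((w / 6 : ℝ) : ℂ) * Complex.I by
      push_cast; ring]
    simp
  have h := (summable_inv_add_sq z).hasSum
  rw [tsum_inv_add_sq (by rw [hzim]; positivity), hQ] at h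
  have h1 := (Complex.hasSum_im h).mul_left (-1 / (72 * w))
  have h3 : √3 ^ 2 = 3 := Real.sq_sqrt (by norm_num)
  have hp := (one_add_add_sq_pos p).ne'
  have hI := Complex.I_sq
  have e1 : (fun n : ℤ => (6 * n + e) / ((6 * n + e) ^ 2 + w ^ 2) ^ 2) =
      fun n : ℤ => -1 / (72 * w) * (1 / (z + n) ^ 2).im := by
    funext n
    have hz' : z + n = (((6 * n + e : ℝ) : ℂ) + w * Complex.I) / 6 := by
      rw [hz]; push_cast; ring
    have hne : (6 * n + e) ^ 2 + w ^ 2 ≠ 0 := by positivity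
    rw [hz']
    generalize (6 * n + e : ℝ) = u at *
    have hN : ((u : ℂ) + w * Complex.I) * (u - w * Complex.I) = ((u ^ 2 + w ^ 2 : ℝ) : ℂ) := by
      push_cast
      linear_combination (-(w : ℂ) ^ 2) * hI
    have hv : ((u : ℂ) + w * Complex.I) ≠ 0 := fun h0 => by
      rw [h0, zero_mul] at hN
      exact hne (by exact_mod_cast hN.symm)
    have hv' : ((u : ℂ) - w * Complex.I) ≠ 0 := fun h0 => by
      rw [h0, mul_zero] at hN
      exact hne (by exact_mod_cast hN.symm)
    have : 1 / (((u : ℂ) + w * Complex.I) / 6) ^ 2 =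
        (((36 * (u ^ 2 - w ^ 2) / (u ^ 2 + w ^ 2) ^ 2 : ℝ)) : ℂ)
        + ((-72 * w * u / (u ^ 2 + w ^ 2) ^ 2 : ℝ) : ℂ) * Complex.I := by
      rw [Complex.ofReal_div, Complex.ofReal_div, Complex.ofReal_pow, ← hN]
      push_cast
      field_simp
      linear_combination (36 * (w : ℂ) ^ 2) * hI
    rw [this]
    simp only [Complex.add_im, Complex.ofReal_im, Complex.im_ofReal_mul, Complex.I_im]
    field_simp
    ring
  have e2 : -(π ^ 2 * √3 / (36 * w)) * lambertTerm p = -1 / (72 * w) *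
      (-4 * (π : ℂ) ^ 2 * (p * (-1 / 2 - √3 / 2 * Complex.I) /
        (1 - p * (-1 / 2 - √3 / 2 * Complex.I)) ^ 2)).im := by
    have h3' : (√3 : ℂ) ^ 2 = 3 := by exact_mod_cast h3
    have hN : (1 - (p : ℂ) * (-1 / 2 - √3 / 2 * Complex.I)) *
        (1 - (p : ℂ) * (-1 / 2 + √3 / 2 * Complex.I)) = ((1 + p + p ^ 2 : ℝ) : ℂ) := by
      push_cast
      linear_combination (-(p : ℂ) ^ 2 * √3 ^ 2 / 4) * hI + (p ^ 2 / 4 : ℂ) * h3'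
    have hv : (1 - (p : ℂ) * (-1 / 2 - √3 / 2 * Complex.I)) ≠ 0 := fun h0 => by
      rw [h0, zero_mul] at hN
      exact hp (by exact_mod_cast hN.symm)
    have hv' : (1 - (p : ℂ) * (-1 / 2 + √3 / 2 * Complex.I)) ≠ 0 := fun h0 => by
      rw [h0, mul_zero] at hN
      exact hp (by exact_mod_cast hN.symm)
    have : (-4 * (π : ℂ) ^ 2 * (p * (-1 / 2 - √3 / 2 * Complex.I) /
        (1 - p * (-1 / 2 - √3 / 2 * Complex.I)) ^ 2)) = ((-4 * π ^ 2 *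
        ((-p / 2 - 2 * p ^ 2 - p ^ 3 / 2) / (1 + p + p ^ 2) ^ 2) : ℝ) : ℂ) +
        ((-4 * π ^ 2 * (-(√3 / 2) * lambertTerm p) : ℝ) : ℂ) * Complex.I := by
      have : (p * (-1 / 2 - √3 / 2 * Complex.I) / (1 - p * (-1 / 2 - √3 / 2 * Complex.I)) ^ 2) =
          (p * (-1 / 2 - √3 / 2 * Complex.I) * (1 - p * (-1 / 2 + √3 / 2 * Complex.I)) ^ 2) /
            ((1 + p + p ^ 2 : ℝ) : ℂ) ^ 2 := by
        rw [← hN, mul_pow, mul_div_mul_right _ _ (pow_ne_zero 2 hv')]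
      rw [this, lambertTerm]
      have hp' : (1 + p + p ^ 2 : ℂ) ≠ 0 := by exact_mod_cast hp
      push_cast
      field_simp
      ring_nf
      simp only [hI, h3', show Complex.I ^ 3 = -Complex.I by rw [pow_succ, hI]; ring,
        show (√3 : ℂ) ^ 3 = 3 * √3 by rw [pow_succ, h3']]
      ring
    rw [this]
    simp only [Complex.add_im, Complex.ofReal_im, Complex.im_ofReal_mul, Complex.I_im]
    field_simp
    ring
  rw [e1, e2]
  exact h1

theorem summable_inv_abs_cube (e : ℝ) : Summable fun n : ℤ => (|6 * n + e| ^ 3)⁻¹ := by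
  have := (EisensteinSeries.linear_right_summable (e / 6 : ℂ) 1 (k := 3) (by norm_num)).norm
  refine (this.mul_left (1 / 216)).congr fun n => ?_
  have h1 : ((1 : ℤ) * (e / 6 : ℂ) + n) = (((6 * n + e) / 6 : ℝ) : ℂ) := by
    push_cast; ring
  rw [h1, norm_inv, norm_zpow, Complex.norm_real, Real.norm_eq_abs, abs_div]
  norm_cast
  rw [div_pow, inv_div]
  norm_num
  ring

theorem hasSum_integral_exp_mul {c e : ℝ} (hc : 0 ≤ c) (he : ∀ n : ℤ, 6 * (n : ℝ) + e ≠ 0) :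
    HasSum (fun n : ℤ => (6 * n + e) / (10 * (6 * n + e) ^ 2 + c) ^ 2)
      (∫ t in Ioi (0 : ℝ), t * rexp (-(c * t)) *
        ∑' n : ℤ, (6 * n + e) * rexp (-(10 * (6 * n + e) ^ 2 * t))) := by
  have hX : ∀ n : ℤ, 0 < 10 * (6 * n + e) ^ 2 + c := fun n => by
    have := he n
    positivity
  have hF : ∀ (n : ℤ) (t : ℝ), t * rexp (-(c * t)) *
      ((6 * n + e) * rexp (-(10 * (6 * n + e) ^ 2 * t))) =
      (6 * n + e) * (t * rexp (-((10 * (6 * n + e) ^ 2 + c) * t))) := fun n t => by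
    rw [show -((10 * (6 * n + e) ^ 2 + c) * t) = -(c * t) + -(10 * (6 * n + e) ^ 2 * t) by ring,
      Real.exp_add]
    ring
  simp only [← tsum_mul_left, hF]
  have h := hasSum_integral_of_summable_integral_norm (μ := volume.restrict (Ioi (0 : ℝ)))
    (F := fun (n : ℤ) t => (6 * n + e) * (t * rexp (-((10 * (6 * n + e) ^ 2 + c) * t))))
    (fun n => (integrableOn_mul_exp_neg (hX n)).const_mul _) ?_
  · refine h.congr_eq (fun n => ?_) rfl
    rw [integral_const_mul, integral_mul_exp_neg (hX n), mul_one_div]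
  · refine Summable.of_nonneg_of_le (fun n => integral_nonneg fun _ => norm_nonneg _) (fun n => ?_)
      (summable_inv_abs_cube e)
    have : ∫ t in Ioi (0 : ℝ), ‖(6 * n + e) * (t * rexp (-((10 * (6 * n + e) ^ 2 + c) * t)))‖ =
        ∫ t in Ioi (0 : ℝ), |6 * n + e| * (t * rexp (-((10 * (6 * n + e) ^ 2 + c) * t))) :=
      setIntegral_congr_fun measurableSet_Ioi fun t (ht : 0 < t) => by
        simp [abs_of_pos ht]
    rw [this, integral_const_mul, integral_mul_exp_neg (hX n), mul_one_div]
    have h0 := abs_pos.2 (he n)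
    rw [← sq_abs (6 * n + e), inv_eq_one_div, div_le_div_iff₀ (by positivity) (by positivity)]
    generalize |6 * n + e| = u at *
    calc u * u ^ 3 = 1 * (u ^ 2) ^ 2 := by ring
      _ ≤ 1 * (10 * u ^ 2 + c) ^ 2 := by
        gcongr
        nlinarith [sq_nonneg u]

/-- The nome `exp (-π / √15)`. -/
noncomputable def nome : ℝ := rexp (-(π / √15))

theorem nome_pos : 0 < nome := Real.exp_pos _

theorem nome_lt_one : nome < 1 := by
  rw [nome, Real.exp_lt_one_iff]
  have := Real.pi_pos
  have : 0 < π / √15 := by positivity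
  linarith

/-- The inner lattice sums. -/
noncomputable def latticeTerm (d : ℕ) : ℝ :=
  if d = 0 then -(π ^ 3 * √3 / 48600)
  else -(π ^ 2 * √5 / (3600 * d)) * lambertTerm ((-nome) ^ d)

theorem hasSum_latticeTerm {d : ℕ} (hd : d ≠ 0) {e : ℝ}
    (he : Complex.exp (π * Complex.I * e / 3) = (-1) ^ d * (-1 / 2 - √3 / 2 * Complex.I)) :
    HasSum (fun n : ℤ => (6 * n + e) / (10 * (6 * n + e) ^ 2 + 6 * (d : ℝ) ^ 2) ^ 2)
      (latticeTerm d) := by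
  have hd' : (0 : ℝ) < d := by positivity
  have hw : 0 < d * √(3 / 5) := by positivity
  have h35 : √(3 / 5) ^ 2 = 3 / 5 := Real.sq_sqrt (by norm_num)
  have h := (hasSum_odd_kernel (e := e) (p := (-nome) ^ d) hw ?_).mul_left (1 / 100)
  · rw [latticeTerm, if_neg hd]
    have hs : √(3 / 5) = √3 / √5 := Real.sqrt_div (by norm_num) _
    have e1 : -(π ^ 2 * √5 / (3600 * d)) * lambertTerm ((-nome) ^ d) =
      1 / 100 * (-(π ^ 2 * √3 / (36 * (d * √(3 / 5)))) * lambertTerm ((-nome) ^ d)) := by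
      rw [hs]
      have : √5 ≠ 0 := by positivity
      have : √3 ≠ 0 := by positivity
      field_simp
      ring
    rw [e1]
    refine h.congr_eq (fun n => ?_) rfl
    rw [mul_pow (d : ℝ), h35, show 10 * (6 * n + e) ^ 2 + 6 * (d : ℝ) ^ 2 =
      10 * ((6 * n + e) ^ 2 + d ^ 2 * (3 / 5)) by ring, mul_pow]
    field_simp
    norm_num
  · rw [show 2 * π * Complex.I * ((e + (d * √(3 / 5) : ℝ) * Complex.I) / 6) =
      π * Complex.I * e / 3 + ((d * -(π * √(3 / 5) / 3) : ℝ) : ℂ) by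
        push_cast
        linear_combination (π * d * √(3 / 5) / 3 : ℂ) * Complex.I_sq, Complex.exp_add, he,
      ← Complex.ofReal_exp, Real.exp_nat_mul]
    have : rexp (-(π * √(3 / 5) / 3)) = nome := by
      rw [nome]
      congr 2
      rw [mul_div_assoc, div_eq_mul_inv π]
      congr 1
      rw [eq_comm, inv_eq_one_div, div_eq_div_iff (by positivity) (by norm_num), ← Real.sqrt_mul (by norm_num),
        show (3 / 5 * 15 : ℝ) = 3 ^ 2 by norm_num, Real.sqrt_sq (by norm_num)]
      norm_num
    rw [this, neg_pow nome]
    push_cast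
    ring

theorem cexp_neg_two_pi_div_three :
    Complex.exp (π * Complex.I * ((-2 : ℝ) : ℂ) / 3) = -1 / 2 - √3 / 2 * Complex.I := by
  have h : π * Complex.I * ((-2 : ℝ) : ℂ) / 3 = ((π / 3 - π : ℝ) : ℂ) * Complex.I := by
    push_cast; ring
  rw [h, Complex.exp_mul_I, ← Complex.ofReal_cos, ← Complex.ofReal_sin, Real.cos_sub_pi,
    Real.sin_sub_pi, Real.cos_pi_div_three, Real.sin_pi_div_three]
  push_cast
  ring

theorem cexp_pi_div_three :
    Complex.exp (π * Complex.I * ((1 : ℝ) : ℂ) / 3) = -1 * (-1 / 2 - √3 / 2 * Complex.I) := by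
  have h : π * Complex.I * ((1 : ℝ) : ℂ) / 3 = ((π / 3 : ℝ) : ℂ) * Complex.I := by
    push_cast; ring
  rw [h, Complex.exp_mul_I, ← Complex.ofReal_cos, ← Complex.ofReal_sin,
    Real.cos_pi_div_three, Real.sin_pi_div_three]
  push_cast
  ring

theorem hasSum_inv_cube : HasSum (fun n : ℤ => 1 / (6 * n - 2 : ℝ) ^ 3) (-(π ^ 3 * √3 / 486)) := by
  have h := hasSum_one_div_nat_pow_mul_sin (k := 1) one_ne_zero (x := 1 / 3) (by norm_num)
  have hb : (Polynomial.map (algebraMap ℚ ℝ) (Polynomial.bernoulli (2 * 1 + 1))).eval (1 / 3 : ℝ) =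
      1 / 27 := by
    have h0 : ¬ (bernoulli 3 : ℚ) ≠ 0 := by
      simp [bernoulli_eq_bernoulli'_of_ne_one]
    simp [Polynomial.bernoulli_def, Finset.sum_range_succ, bernoulli_eq_bernoulli'_of_ne_one]
    norm_num [Nat.choose]
  rw [hb] at h
  set f : ℤ → ℝ := fun n => 1 / (n : ℝ) ^ 3 * Real.sin (2 * π * n * (1 / 3)) with hf
  have hfe : ∀ n, f (-n) = f n := fun n => by
    simp only [hf]
    push_cast
    rw [show 2 * π * -(n : ℝ) * (1 / 3) = -(2 * π * n * (1 / 3)) by ring, Real.sin_neg,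
      Odd.neg_pow (by decide)]
    ring
  have hS : HasSum f (2 * ((2 * π) ^ 3 / 2 / 6 * (1 / 27))) := by
    have h' : HasSum (fun n : ℕ => f n) ((2 * π) ^ 3 / 2 / 6 * (1 / 27)) := by
      refine h.congr_eq (fun n => by simp [hf]) ?_
      norm_num [Nat.factorial]
    have := HasSum.of_nat_of_neg h' (by simpa only [hfe] using h')
    refine this.congr_eq (fun n => rfl) ?_
    simp only [hf]
    norm_num
    ring
  have h3 := tsum_int_eq_mod_three hS.summable
  rw [hS.tsum_eq] at h3
  have e0 : ∀ m : ℤ, f (3 * m) = 0 := fun m => by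
    simp only [hf]
    push_cast
    rw [show 2 * π * (3 * (m : ℝ)) * (1 / 3) = (2 * m : ℤ) * π by push_cast; ring,
      Real.sin_int_mul_pi, mul_zero]
  have e1 : ∑' m : ℤ, f (3 * m + 1) = ∑' m : ℤ, f (3 * m + 2) := by
    rw [← (Equiv.subLeft (-1 : ℤ)).tsum_eq]
    refine tsum_congr fun m => ?_
    rw [← hfe]
    congr 1
    simp only [Equiv.subLeft_apply]
    ring
  have e2 : ∀ m : ℤ, f (3 * (m - 1) + 2) = -4 * √3 * (1 / (6 * m - 2 : ℝ) ^ 3) := fun m => by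
    simp only [hf]
    push_cast
    rw [show 2 * π * (3 * ((m : ℝ) - 1) + 2) * (1 / 3) = -(π - π / 3) + (m : ℝ) * (2 * π) by ring,
      Real.sin_add_int_mul_two_pi, Real.sin_neg, Real.sin_pi_sub, Real.sin_pi_div_three,
      show (6 * m - 2 : ℝ) = 2 * (3 * (m - 1) + 2) by ring, mul_pow]
    field_simp
    norm_num
  have hs : Summable fun n : ℤ => 1 / (6 * n - 2 : ℝ) ^ 3 := by
    refine Summable.of_norm_bounded (summable_inv_abs_cube (-2)) fun n => ?_
    rw [norm_div, norm_one, norm_pow, Real.norm_eq_abs, one_div]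
    exact le_of_eq rfl
  refine hs.hasSum.congr_eq (fun n => rfl) ?_
  rw [e1, ← (Equiv.subRight (1 : ℤ)).tsum_eq fun m => f (3 * m + 2)] at h3
  simp only [e0, Equiv.subRight_apply, e2, tsum_zero, tsum_mul_left] at h3
  have h33 : √3 ^ 2 = 3 := Real.sq_sqrt (by norm_num)
  have h30 : √3 ≠ 0 := by positivity
  apply mul_left_cancel₀ h30
  linear_combination (-1 / 8) * h3 - π ^ 3 / 486 * h33

theorem integral_theta2_eta (d : ℕ) (hd : Even d) :
    ∫ t in Ioi (0 : ℝ), t * rexp (-(6 * (d : ℝ) ^ 2 * t)) *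
      (etaR (120 * t) ^ 2 * theta2 (120 * t)) = -latticeTerm d := by
  have hne : ∀ n : ℤ, 6 * (n : ℝ) + (-2) ≠ 0 := fun n h => by
    have : (6 * n + (-2) : ℤ) = 0 := by exact_mod_cast h
    omega
  have h := hasSum_integral_exp_mul (c := 6 * (d : ℝ) ^ 2) (by positivity) hne
  have hI : ∫ t in Ioi (0 : ℝ), t * rexp (-(6 * (d : ℝ) ^ 2 * t)) *
      (etaR (120 * t) ^ 2 * theta2 (120 * t)) = -∫ t in Ioi (0 : ℝ),
        t * rexp (-(6 * (d : ℝ) ^ 2 * t)) *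
        ∑' n : ℤ, (6 * n + (-2)) * rexp (-(10 * (6 * n + (-2)) ^ 2 * t)) := by
    rw [← integral_neg]
    refine setIntegral_congr_fun measurableSet_Ioi fun t (ht : 0 < t) => ?_
    rw [etaR_sq_mul_theta2 (by positivity), mul_neg]
    congr 3
    ext n
    rw [← sub_eq_add_neg]
    congr 2
    ring
  rw [hI, neg_inj]
  refine h.unique ?_
  rcases eq_or_ne d 0 with rfl | hd0
  · rw [latticeTerm, if_pos rfl]
    refine (hasSum_inv_cube.mul_left (1 / 100)).congr_eq (fun n => ?_) (by ring)
    have := hne n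
    rw [sub_eq_add_neg]
    push_cast
    field_simp
    ring
  · exact hasSum_latticeTerm hd0 (by rw [cexp_neg_two_pi_div_three, hd.neg_one_pow, one_mul])

theorem integral_theta3_eta (d : ℕ) (hd : Odd d) :
    ∫ t in Ioi (0 : ℝ), t * rexp (-(6 * (d : ℝ) ^ 2 * t)) *
      (etaR (120 * t) ^ 2 * theta3 (120 * t)) = latticeTerm d := by
  have hne : ∀ n : ℤ, 6 * (n : ℝ) + 1 ≠ 0 := fun n h => by
    have : (6 * n + 1 : ℤ) = 0 := by exact_mod_cast h
    omega
  have h := hasSum_integral_exp_mul (c := 6 * (d : ℝ) ^ 2) (by positivity) hne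
  have hI : ∫ t in Ioi (0 : ℝ), t * rexp (-(6 * (d : ℝ) ^ 2 * t)) *
      (etaR (120 * t) ^ 2 * theta3 (120 * t)) = ∫ t in Ioi (0 : ℝ),
        t * rexp (-(6 * (d : ℝ) ^ 2 * t)) *
        ∑' n : ℤ, (6 * n + 1) * rexp (-(10 * (6 * n + 1) ^ 2 * t)) := by
    refine setIntegral_congr_fun measurableSet_Ioi fun t (ht : 0 < t) => ?_
    rw [etaR_sq_mul_theta3 (by positivity)]
    congr 2
    ext n
    congr 2
    ring
  rw [hI]
  refine h.unique (hasSum_latticeTerm hd.pos.ne' ?_)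
  rw [cexp_pi_div_three, hd.neg_one_pow]

theorem latticeTerm_ne_zero (d : ℕ) : latticeTerm d ≠ 0 := by
  rw [latticeTerm]
  have := Real.pi_pos
  split_ifs with hd
  · have : 0 < π ^ 3 * √3 / 48600 := by positivity
    linarith
  · have h5 : 0 < √5 := by positivity
    have h1 : (-nome) ^ d ≠ 0 := pow_ne_zero _ (neg_ne_zero.2 nome_pos.ne')
    have h2 : ((-nome) ^ d) ^ 2 < 1 := by
      rw [← pow_mul, mul_comm, pow_mul, neg_sq]
      exact pow_lt_one₀ (by positivity) (pow_lt_one₀ nome_pos.le nome_lt_one two_ne_zero) hd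
    have h3 := one_add_add_sq_pos ((-nome) ^ d)
    have h4 : 1 - ((-nome) ^ d) ^ 2 ≠ 0 := by linarith
    refine mul_ne_zero (neg_ne_zero.2 (by positivity)) ?_
    rw [lambertTerm]
    positivity

theorem abs_latticeTerm_le (d : ℕ) : |latticeTerm d| ≤ 100 * nome ^ d := by
  have hn := nome_pos
  have hpi := Real.pi_pos
  have hp4 := Real.pi_le_four
  have h3 : √3 ≤ 2 := Real.sqrt_le_iff.2 (by norm_num)
  have h5 : √5 ≤ 3 := Real.sqrt_le_iff.2 (by norm_num)
  rw [latticeTerm]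
  split_ifs with hd
  · rw [abs_neg, abs_of_nonneg (by positivity), hd, pow_zero]
    calc π ^ 3 * √3 / 48600 ≤ 4 ^ 3 * 2 / 48600 := by gcongr
      _ ≤ 100 * 1 := by norm_num
  · have hd1 : (1 : ℝ) ≤ d := by exact_mod_cast Nat.one_le_iff_ne_zero.2 hd
    have h1 : |(-nome) ^ d| = nome ^ d := by rw [abs_pow, abs_neg, abs_of_pos nome_pos]
    have h2 := abs_lambertTerm_le (p := (-nome) ^ d)
      (by rw [h1]; exact pow_le_one₀ nome_pos.le nome_lt_one.le)
    rw [h1] at h2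
    rw [abs_mul, abs_neg, abs_of_nonneg (by positivity)]
    calc π ^ 2 * √5 / (3600 * d) * |lambertTerm ((-nome) ^ d)|
        ≤ 4 ^ 2 * 3 / (3600 * 1) * (16 / 9 * nome ^ d) := by gcongr
      _ ≤ 100 * nome ^ d := by linarith [pow_pos hn d]

theorem summable_latticeTerm : Summable fun d : ℕ => latticeTerm d :=
  Summable.of_norm_bounded
    ((summable_geometric_of_lt_one nome_pos.le nome_lt_one).mul_left 100) abs_latticeTerm_le

theorem summable_latticeTerm_int : Summable fun d : ℤ => latticeTerm d.natAbs :=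
  Summable.of_nat_of_neg (by simpa using summable_latticeTerm)
    (by simpa using summable_latticeTerm)

theorem integral_eta_eq_tsum_int :
    ∫ t in Ioi (0 : ℝ), t * etaR (24 * t) * etaR (24 * (5 * t)) ^ 3 =
      1 / 2 * ∑' d : ℤ, latticeTerm d.natAbs := by
  set F : ℤ → ℝ → ℝ := fun k t => t * rexp (-(6 * ((2 * k + 1).natAbs : ℝ) ^ 2 * t)) *
    (etaR (120 * t) ^ 2 * theta3 (120 * t)) with hF
  set G : ℤ → ℝ → ℝ := fun k t => t * rexp (-(6 * ((2 * k).natAbs : ℝ) ^ 2 * t)) *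
    (etaR (120 * t) ^ 2 * theta2 (120 * t)) with hG
  have hFi : ∀ k, ∫ t in Ioi (0 : ℝ), F k t = latticeTerm (2 * k + 1).natAbs := fun k =>
    integral_theta3_eta _ (by rw [Int.natAbs_odd]; exact odd_two_mul_add_one k)
  have hGi : ∀ k, ∫ t in Ioi (0 : ℝ), G k t = -latticeTerm (2 * k).natAbs := fun k =>
    integral_theta2_eta _ (by rw [Int.natAbs_even]; exact even_two_mul k)
  have hFI : ∀ k, Integrable (F k) (volume.restrict (Ioi 0)) := fun k =>
    Integrable.of_integral_ne_zero (by rw [hFi]; exact latticeTerm_ne_zero _)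
  have hGI : ∀ k, Integrable (G k) (volume.restrict (Ioi 0)) := fun k =>
    Integrable.of_integral_ne_zero (by rw [hGi]; exact neg_ne_zero.2 (latticeTerm_ne_zero _))
  have hs1 : Summable fun k : ℤ => latticeTerm (2 * k + 1).natAbs :=
    summable_latticeTerm_int.comp_injective (i := fun k : ℤ => 2 * k + 1)
      fun a b h => by simpa using h
  have hs0 : Summable fun k : ℤ => latticeTerm (2 * k).natAbs :=
    summable_latticeTerm_int.comp_injective (i := fun k : ℤ => 2 * k)
      fun a b h => by simpa using h
  have h := hasSum_integral_of_summable_integral_norm (μ := volume.restrict (Ioi (0 : ℝ)))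
    (F := fun k t => F k t - G k t) (fun k => (hFI k).sub (hGI k)) ?_
  · have h2 := h.tsum_eq
    rw [tsum_int_eq_mod_two summable_latticeTerm_int, add_comm, ← hs1.tsum_add hs0]
    simp only [integral_sub (hFI _) (hGI _), hFi, hGi, sub_neg_eq_add] at h2
    rw [h2, ← integral_const_mul]
    refine setIntegral_congr_fun measurableSet_Ioi fun t (ht : 0 < t) => ?_
    have k1 : ∑' k, F k t = t * theta2 (24 * t) * (etaR (120 * t) ^ 2 * theta3 (120 * t)) := by
      rw [theta2, ← tsum_mul_left, ← tsum_mul_right]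
      refine tsum_congr fun k => ?_
      simp only [hF, Nat.cast_natAbs, Int.cast_abs, sq_abs]
      push_cast
      congr 3
      ring
    have k0 : ∑' k, G k t = t * theta3 (24 * t) * (etaR (120 * t) ^ 2 * theta2 (120 * t)) := by
      rw [theta3, ← tsum_mul_left, ← tsum_mul_right]
      refine tsum_congr fun k => ?_
      simp only [hG, Nat.cast_natAbs, Int.cast_abs, sq_abs]
      push_cast
      congr 3
      ring
    have l1 : Summable fun k => F k t := by
      refine (((summable_theta2 (s := 24 * t) (by positivity)).mul_left t).mul_right
        (etaR (120 * t) ^ 2 * theta3 (120 * t))).congr fun k => ?_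
      simp only [hF, Nat.cast_natAbs, Int.cast_abs, sq_abs]
      push_cast
      congr 3
      ring
    have l0 : Summable fun k => G k t := by
      refine (((summable_theta3 (s := 24 * t) (by positivity)).mul_left t).mul_right
        (etaR (120 * t) ^ 2 * theta2 (120 * t))).congr fun k => ?_
      simp only [hG, Nat.cast_natAbs, Int.cast_abs, sq_abs]
      push_cast
      congr 3
      ring
    have hE := two_mul_etaR_mul_etaR (s := 24 * t) (by positivity)
    rw [show 5 * (24 * t) = 120 * t by ring] at hE
    rw [l1.tsum_sub l0, k1, k0, show 24 * (5 * t) = 120 * t by ring]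
    linear_combination (t * etaR (120 * t) ^ 2 / 2) * hE
  · refine Summable.of_nonneg_of_le (fun n => integral_nonneg fun _ => norm_nonneg _) (fun k => ?_)
      (hs1.sub hs0)
    rw [sub_eq_add_neg, ← hFi, ← hGi, ← integral_add (hFI k) (hGI k)]
    refine setIntegral_mono_on ((hFI k).sub (hGI k)).norm ((hFI k).add (hGI k)) measurableSet_Ioi
      fun t (ht : 0 < t) => ?_
    have p1 := theta2_pos (s := 120 * t) (by positivity)
    have p2 := theta3_pos (s := 120 * t) (by positivity)
    have q1 : 0 ≤ F k t := by simp only [hF]; positivity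
    have q2 : 0 ≤ G k t := by simp only [hG]; positivity
    rw [Real.norm_eq_abs, abs_le]
    constructor <;> linarith

/-- The value of the lattice sum in terms of a Lambert series. -/
theorem lattice_eq_lambert : 225 / (32 * √5 * π ^ 2) *
    ((1 + 5 + 5 + 5 : ℝ) ^ 2 *
      ∫ t in Ioi (0 : ℝ), t * etaR (24 * t) * etaR (24 * (5 * t)) ^ 3) =
    -(π * √15 / 270) - 1 / 2 * ∑' m : ℕ, lambertTerm ((-nome) ^ (m + 1)) / (m + 1) := by
  have hp := Real.pi_pos.ne'
  have h5 : √5 ^ 2 = 5 := Real.sq_sqrt (by norm_num)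
  have h50 : √5 ≠ 0 := by positivity
  have h15 : √15 = √3 * √5 := by rw [← Real.sqrt_mul (by norm_num)]; norm_num
  have hZ : ∑' d : ℤ, latticeTerm d.natAbs =
      2 * ∑' d : ℕ, latticeTerm d - latticeTerm 0 := by
    have hs : HasSum (fun d : ℕ => latticeTerm d) _ := summable_latticeTerm.hasSum
    have := HasSum.of_nat_of_neg (f := fun d : ℤ => latticeTerm d.natAbs) (by simpa using hs)
      (by simpa using hs)
    rw [this.tsum_eq]
    simp
    ring
  have hN : ∑' d : ℕ, latticeTerm d = latticeTerm 0 + -(π ^ 2 * √5 / 3600) *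
      ∑' m : ℕ, lambertTerm ((-nome) ^ (m + 1)) / (m + 1) := by
    rw [summable_latticeTerm.tsum_eq_zero_add, ← tsum_mul_left]
    congr 2
    ext m
    rw [latticeTerm, if_neg m.succ_ne_zero]
    push_cast
    have : (m : ℝ) + 1 ≠ 0 := by positivity
    field_simp
  rw [integral_eta_eq_tsum_int, hZ, hN, latticeTerm, if_pos rfl, h15]
  generalize ∑' m : ℕ, lambertTerm ((-nome) ^ (m + 1)) / (m + 1) = S
  field_simp
  ring_nf
  rw [h5]
  ring

end LatticeEvaluation

section CubicSubstitution

open MeasureTheory Set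

theorem lintegral_Ioo_of_deriv_pos {f f' : ℝ → ℝ} {a b : ℝ} (hab : a ≤ b)
    (hf : ContinuousOn f (Icc a b)) (hf' : ∀ x ∈ Ioo a b, HasDerivAt f (f' x) x)
    (hpos : ∀ x ∈ Ioo a b, 0 < f' x) (g : ℝ → ENNReal) :
    ∫⁻ y in Ioo (f a) (f b), g y = ∫⁻ x in Ioo a b, ENNReal.ofReal (f' x) * g (f x) := by
  have hm : StrictMonoOn f (Icc a b) := strictMonoOn_of_deriv_pos (convex_Icc a b) hf fun x hx => by
    rw [interior_Icc] at hx
    rw [(hf' x hx).deriv]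
    exact hpos x hx
  have him : f '' Ioo a b = Ioo (f a) (f b) := by
    refine Subset.antisymm ?_ (intermediate_value_Ioo hab hf)
    rintro _ ⟨x, hx, rfl⟩
    exact ⟨hm (left_mem_Icc.2 hab) (Ioo_subset_Icc_self hx) hx.1,
      hm (Ioo_subset_Icc_self hx) (right_mem_Icc.2 hab) hx.2⟩
  rw [← him, lintegral_image_eq_lintegral_deriv_mul_of_monotoneOn measurableSet_Ioo
    (fun x hx => (hf' x hx).hasDerivWithinAt) (hm.monotoneOn.mono Ioo_subset_Icc_self)]

theorem lintegral_Ioo_of_deriv_neg {f f' : ℝ → ℝ} {a b : ℝ} (hab : a ≤ b)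
    (hf : ContinuousOn f (Icc a b)) (hf' : ∀ x ∈ Ioo a b, HasDerivAt f (f' x) x)
    (hneg : ∀ x ∈ Ioo a b, f' x < 0) (g : ℝ → ENNReal) :
    ∫⁻ y in Ioo (f b) (f a), g y = ∫⁻ x in Ioo a b, ENNReal.ofReal (-f' x) * g (f x) := by
  have hm : StrictAntiOn f (Icc a b) := strictAntiOn_of_deriv_neg (convex_Icc a b) hf fun x hx => by
    rw [interior_Icc] at hx
    rw [(hf' x hx).deriv]
    exact hneg x hx
  have him : f '' Ioo a b = Ioo (f b) (f a) := by
    refine Subset.antisymm ?_ (intermediate_value_Ioo' hab hf)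
    rintro _ ⟨x, hx, rfl⟩
    exact ⟨hm (Ioo_subset_Icc_self hx) (right_mem_Icc.2 hab) hx.2,
      hm (left_mem_Icc.2 hab) (Ioo_subset_Icc_self hx) hx.1⟩
  rw [← him, lintegral_image_eq_lintegral_deriv_mul_of_antitoneOn measurableSet_Ioo
    (fun x hx => (hf' x hx).hasDerivWithinAt) (hm.antitoneOn.mono Ioo_subset_Icc_self)]

/-- The clamped arcsine has the expected derivative in the integrated sense. -/
theorem lintegral_inv_sqrt {s : ℝ} (hs : 0 < s) {k₀ : ℝ} (hk : 0 ≤ k₀) :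
    ∫⁻ k in Ioo 0 k₀, ENNReal.ofReal (1 / √(4 - (3 * k * s - s ^ 3) ^ 2)) =
      ENNReal.ofReal ((arcsin ((3 * k₀ * s - s ^ 3) / 2) - arcsin (-s ^ 3 / 2)) / (3 * s)) := by
  set F : ℝ → ℝ := fun k => arcsin ((3 * k * s - s ^ 3) / 2) / (3 * s) with hF
  have hder : ∀ k, (3 * k * s - s ^ 3) / 2 ≠ -1 → (3 * k * s - s ^ 3) / 2 ≠ 1 →
      HasDerivAt F (1 / √(4 - (3 * k * s - s ^ 3) ^ 2)) k := fun k h1 h2 => by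
    have h := ((Real.hasDerivAt_arcsin h1 h2).comp k
      (((((hasDerivAt_id k).const_mul 3).mul_const s).sub_const (s ^ 3)).div_const 2)).div_const
        (3 * s)
    refine h.congr_deriv ?_
    rw [show 4 - (3 * k * s - s ^ 3) ^ 2 = 2 ^ 2 * (1 - ((3 * k * s - s ^ 3) / 2) ^ 2) by ring,
      Real.sqrt_mul (by norm_num), Real.sqrt_sq (by norm_num)]
    field_simp
  have hcont : Continuous F := by
    rw [hF]
    exact (Real.continuous_arcsin.comp (by fun_prop)).div_const _
  have hmono : Monotone F := fun a b hab => by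
    simp only [hF]
    gcongr
  have hbad : ({k | (3 * k * s - s ^ 3) / 2 = -1} ∪ {k | (3 * k * s - s ^ 3) / 2 = 1}).Countable := by
    refine Set.Countable.union ?_ ?_ <;>
    · refine Set.Subsingleton.countable fun a ha b hb => ?_
      simp only [mem_ofPred_eq] at ha hb
      have : s * a = s * b := by linarith
      exact mul_left_cancel₀ hs.ne' this
  have hd : ∀ᵐ k, HasDerivAt F (1 / √(4 - (3 * k * s - s ^ 3) ^ 2)) k := by
    filter_upwards [hbad.ae_notMem volume] with k hk
    simp only [mem_union, mem_ofPred_eq, not_or] at hk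
    exact hder k hk.1 hk.2
  have hintg : IntervalIntegrable (fun k => 1 / √(4 - (3 * k * s - s ^ 3) ^ 2)) volume 0 k₀ :=
    ((hmono.monotoneOn _).intervalIntegrable_deriv).congr_ae
      (ae_restrict_of_ae (hd.mono fun k hk => hk.deriv))
  have hftc := integral_eq_of_hasDerivAt_off_countable_of_le F
    (fun k => 1 / √(4 - (3 * k * s - s ^ 3) ^ 2)) hk hbad hcont.continuousOn
    (fun x hx => by
      have := hx.2
      simp only [mem_union, mem_ofPred_eq, not_or] at this
      exact hder x this.1 this.2) hintg
  rw [setLIntegral_congr Ioo_ae_eq_Ioc, ← ofReal_integral_eq_lintegral_ofReal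
    ((intervalIntegrable_iff_integrableOn_Ioc_of_le hk).1 hintg)
    (Filter.Eventually.of_forall fun k => by positivity),
    ← intervalIntegral.integral_of_le hk, hftc]
  simp only [hF]
  congr 1
  rw [mul_zero, zero_mul, zero_sub]
  ring


/-- The variable `λ` of the first substitution, as a function of `t`. -/
noncomputable def cubicLam (c t : ℝ) : ℝ := (t * (1 - t) / (1 - c * t)) ^ (1 / 3 : ℝ)

theorem one_sub_mul_pos {c t : ℝ} (hc0 : 0 < c) (hc : c < 1) (ht : t ≤ 1) : 0 < 1 - c * t := by
  nlinarith

theorem cubicLam_pos {c t : ℝ} (hc0 : 0 < c) (hc : c < 1) (ht : t ∈ Ioo (0 : ℝ) 1) :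
    0 < cubicLam c t :=
  Real.rpow_pos_of_pos (div_pos (mul_pos ht.1 (by linarith [ht.2]))
    (one_sub_mul_pos hc0 hc ht.2.le)) _

theorem cubicLam_pow {c t : ℝ} (hc0 : 0 < c) (hc : c < 1) (ht : t ∈ Icc (0 : ℝ) 1) :
    cubicLam c t ^ 3 = t * (1 - t) / (1 - c * t) := by
  rw [cubicLam, ← Real.rpow_natCast, ← Real.rpow_mul]
  · norm_num
  · exact div_nonneg (mul_nonneg ht.1 (by linarith [ht.2])) (one_sub_mul_pos hc0 hc ht.2).le

theorem continuousOn_cubicLam {c : ℝ} (hc0 : 0 < c) (hc : c < 1) :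
    ContinuousOn (cubicLam c) (Icc 0 1) := by
  refine ContinuousOn.rpow_const (ContinuousOn.div (by fun_prop) (by fun_prop) fun t ht =>
    (one_sub_mul_pos hc0 hc ht.2).ne') fun t _ => Or.inr (by norm_num)

theorem hasDerivAt_cubicLam {c t : ℝ} (hc0 : 0 < c) (hc : c < 1) (ht : t ∈ Ioo (0 : ℝ) 1) :
    HasDerivAt (cubicLam c)
      ((1 - 2 * t + c * t ^ 2) / (1 - c * t) ^ 2 / (3 * cubicLam c t ^ 2)) t := by
  have hm := one_sub_mul_pos hc0 hc ht.2.le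
  have hT : 0 < t * (1 - t) / (1 - c * t) := div_pos (mul_pos ht.1 (by linarith [ht.2])) hm
  have h := ((((hasDerivAt_id t).mul ((hasDerivAt_id t).const_sub 1)).div
    (((hasDerivAt_id t).const_mul c).const_sub 1) hm.ne').rpow_const (p := 1 / 3) (Or.inl hT.ne'))
  refine h.congr_deriv ?_
  have e : cubicLam c t ^ 2 * (t * (1 - t) / (1 - c * t)) ^ ((1 / 3 : ℝ) - 1) = 1 := by
    rw [cubicLam, ← Real.rpow_natCast, ← Real.rpow_mul hT.le, ← Real.rpow_add hT]
    norm_num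
  have hl := cubicLam_pos hc0 hc ht
  simp only [Pi.mul_apply, id, Pi.div_apply]
  rw [eq_div_iff (by positivity)]
  generalize (t * (1 - t) / (1 - c * t)) ^ ((1 / 3 : ℝ) - 1) = y at *
  rw [div_mul_eq_mul_div, div_mul_eq_mul_div, div_mul_eq_mul_div]
  congr 1
  linear_combination (1 - 2 * t + c * t ^ 2) * e

theorem lintegral_cubicLam {k : ℝ} (hk0 : 0 < k) (hk : k < 1) :
    ∫⁻ t in Ioo 0 1, ENNReal.ofReal ((1 + k * cubicLam (k ^ 3) t) /
        (cubicLam (k ^ 3) t ^ 2 * (1 - k ^ 3 * t))) =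
      2 * ∫⁻ l in Ioo 0 (cubicLam (k ^ 3) (1 / (1 + √(1 - k ^ 3)))),
        ENNReal.ofReal (3 * (1 + k * l) / √((1 + k ^ 3 * l ^ 3) ^ 2 - 4 * l ^ 3)) := by
  have hc0 : 0 < k ^ 3 := by positivity
  have hc : k ^ 3 < 1 := pow_lt_one₀ hk0.le hk (by norm_num)
  set c := k ^ 3 with hcdef
  set w := √(1 - c) with hw
  have hw2 : w ^ 2 = 1 - c := Real.sq_sqrt (by linarith)
  have hw0 : 0 < w := Real.sqrt_pos.2 (by linarith)
  have hw1 : w < 1 := by nlinarith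
  set τ := 1 / (1 + w) with hτ
  have hτw : τ * (1 + w) = 1 := by rw [hτ]; field_simp
  have hτ0 : 0 < τ := by rw [hτ]; positivity
  have hτ1 : τ < 1 := by nlinarith
  have hfac : ∀ t, 1 - 2 * t + c * t ^ 2 = (1 - (1 + w) * t) * (1 - (1 - w) * t) := fun t => by
    linear_combination t ^ 2 * hw2
  have hfac2 : ∀ t ∈ Ioo (0 : ℝ) 1, 0 < 1 - (1 - w) * t := fun t ht => by nlinarith [ht.1, ht.2]
  have hsqrt : ∀ t ∈ Ioo (0 : ℝ) 1,
      √((1 + c * cubicLam c t ^ 3) ^ 2 - 4 * cubicLam c t ^ 3) =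
        |1 - 2 * t + c * t ^ 2| / (1 - c * t) := fun t ht => by
    have hm := one_sub_mul_pos hc0 hc ht.2.le
    rw [cubicLam_pow hc0 hc (Ioo_subset_Icc_self ht), ← abs_of_pos hm, ← abs_div, abs_of_pos hm,
      ← Real.sqrt_sq_eq_abs]
    congr 1
    field_simp
    ring
  have hkey : ∀ t ∈ Ioo (0 : ℝ) 1, 1 - 2 * t + c * t ^ 2 ≠ 0 →
      ENNReal.ofReal (|1 - 2 * t + c * t ^ 2| / (1 - c * t) ^ 2 / (3 * cubicLam c t ^ 2)) *
        ENNReal.ofReal (3 * (1 + k * cubicLam c t) /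
          √((1 + c * cubicLam c t ^ 3) ^ 2 - 4 * cubicLam c t ^ 3)) =
        ENNReal.ofReal ((1 + k * cubicLam c t) / (cubicLam c t ^ 2 * (1 - c * t))) :=
    fun t ht h0 => by
      have hm := one_sub_mul_pos hc0 hc ht.2.le
      have hl := cubicLam_pos hc0 hc ht
      rw [← ENNReal.ofReal_mul (by positivity), hsqrt t ht]
      congr 1
      have := abs_pos.2 h0
      generalize |1 - 2 * t + c * t ^ 2| = y at *
      field_simp
  have hL := lintegral_Ioo_of_deriv_pos hτ0.le
    ((continuousOn_cubicLam hc0 hc).mono (Icc_subset_Icc_right hτ1.le))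
    (fun t ht => hasDerivAt_cubicLam hc0 hc ⟨ht.1, ht.2.trans hτ1⟩)
    (fun t ht => by
      have h01 : t ∈ Ioo (0 : ℝ) 1 := ⟨ht.1, ht.2.trans hτ1⟩
      have hm := one_sub_mul_pos hc0 hc h01.2.le
      have hl := cubicLam_pos hc0 hc h01
      have := hfac2 t h01
      have : 0 < 1 - (1 + w) * t := by nlinarith [ht.2]
      rw [hfac]
      positivity)
    (fun l => ENNReal.ofReal (3 * (1 + k * l) / √((1 + c * l ^ 3) ^ 2 - 4 * l ^ 3)))
  have hR := lintegral_Ioo_of_deriv_neg hτ1.le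
    ((continuousOn_cubicLam hc0 hc).mono (Icc_subset_Icc_left hτ0.le))
    (fun t ht => hasDerivAt_cubicLam hc0 hc ⟨hτ0.trans ht.1, ht.2⟩)
    (fun t ht => by
      have h01 : t ∈ Ioo (0 : ℝ) 1 := ⟨hτ0.trans ht.1, ht.2⟩
      have hm := one_sub_mul_pos hc0 hc h01.2.le
      have hl := cubicLam_pos hc0 hc h01
      have h1 := hfac2 t h01
      have h2 : 1 - (1 + w) * t < 0 := by nlinarith [ht.1]
      rw [hfac]
      exact div_neg_of_neg_of_pos (div_neg_of_neg_of_pos (mul_neg_of_neg_of_pos h2 h1)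
        (by positivity)) (by positivity))
    (fun l => ENNReal.ofReal (3 * (1 + k * l) / √((1 + c * l ^ 3) ^ 2 - 4 * l ^ 3)))
  have h0 : cubicLam c 0 = 0 := by
    rw [cubicLam]; norm_num
  have h1 : cubicLam c 1 = 0 := by
    rw [cubicLam]; norm_num
  rw [h0] at hL
  rw [h1] at hR
  rw [two_mul]
  nth_rewrite 2 [hR]
  rw [hL, ← Ioc_union_Ioo_eq_Ioo hτ0.le hτ1,
    lintegral_union measurableSet_Ioo (Set.disjoint_left.2 fun x hx hx' => not_lt.2 hx.2 hx'.1),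
    setLIntegral_congr Ioo_ae_eq_Ioc.symm]
  congr 1
  · refine setLIntegral_congr_fun measurableSet_Ioo fun t ht => ?_
    have h01 : t ∈ Ioo (0 : ℝ) 1 := ⟨ht.1, ht.2.trans hτ1⟩
    have h1 := hfac2 t h01
    have h2 : 0 < 1 - (1 + w) * t := by nlinarith [ht.2]
    have hp : 0 < 1 - 2 * t + c * t ^ 2 := by rw [hfac]; positivity
    have := hkey t h01 hp.ne'
    rw [abs_of_pos hp] at this
    exact this.symm
  · refine setLIntegral_congr_fun measurableSet_Ioo fun t ht => ?_
    have h01 : t ∈ Ioo (0 : ℝ) 1 := ⟨hτ0.trans ht.1, ht.2⟩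
    have h1 := hfac2 t h01
    have h2 : 1 - (1 + w) * t < 0 := by nlinarith [ht.1]
    have hp : 1 - 2 * t + c * t ^ 2 < 0 := by rw [hfac]; exact mul_neg_of_neg_of_pos h2 h1
    have := hkey t h01 hp.ne
    rw [abs_of_neg hp] at this
    simp only [← neg_div]
    exact this.symm

end CubicSubstitution

section CubicSubstitution

open MeasureTheory Set

/-- The denominator under the square root in the second substitution. -/
noncomputable def cubicDen (k l : ℝ) : ℝ := (1 - k * l + k ^ 2 * l ^ 2) ^ 3 - l ^ 3

theorem lt_of_cubicDisc_nonneg {k l : ℝ} (hk0 : 0 < k) (hk : k < 1) (hl : 0 ≤ l)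
    (h : 0 ≤ (1 + k ^ 3 * l ^ 3) ^ 2 - 4 * l ^ 3) : l < 1 - k * l + k ^ 2 * l ^ 2 := by
  rcases hl.eq_or_lt with rfl | hl
  · norm_num
  have e : (1 + k ^ 3 * l ^ 3) ^ 2 = (1 - k * l + k ^ 2 * l ^ 2) ^ 2 *
      (1 - k * l + k ^ 2 * l ^ 2 + 3 * (k * l)) := by ring
  have hN : 0 < 1 - k * l + k ^ 2 * l ^ 2 := by nlinarith [sq_nonneg (1 - 2 * (k * l))]
  rw [e] at h
  generalize 1 - k * l + k ^ 2 * l ^ 2 = N at *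
  by_contra! hle
  have hkl : k * l < l := by nlinarith
  have h1 : N ^ 2 * (N + 3 * (k * l)) < l ^ 2 * (4 * l) :=
    mul_lt_mul_of_le_of_lt_of_nonneg_of_pos (by gcongr) (by linarith) (by positivity)
      (by positivity)
  nlinarith

theorem cubicDen_pos {k l : ℝ} (hl : 0 ≤ l) (h : l < 1 - k * l + k ^ 2 * l ^ 2) :
    0 < cubicDen k l := by
  rw [cubicDen, sub_pos]
  gcongr

/-- The variable `s` of the second substitution. -/
noncomputable def cubicParam (k l : ℝ) : ℝ := √3 * (l * (1 - k * l)) / √(cubicDen k l)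

theorem cubicParam_sq {k l : ℝ} (hl : 0 ≤ l) (h : l < 1 - k * l + k ^ 2 * l ^ 2) :
    cubicParam k l ^ 2 = 3 * (l * (1 - k * l)) ^ 2 / cubicDen k l := by
  rw [cubicParam, div_pow, mul_pow, Real.sq_sqrt (by norm_num), Real.sq_sqrt (cubicDen_pos hl h).le]

theorem four_sub_cubicParam {k l : ℝ} (hl : 0 ≤ l) (h : l < 1 - k * l + k ^ 2 * l ^ 2) :
    4 - (3 * k * cubicParam k l - cubicParam k l ^ 3) ^ 2 =
      (2 * (1 - k * l + k ^ 2 * l ^ 2) ^ 3 - 3 * (k * l) * (1 - k * l + k ^ 2 * l ^ 2) ^ 2 +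
        l ^ 3) ^ 2 * ((1 + k ^ 3 * l ^ 3) ^ 2 - 4 * l ^ 3) / cubicDen k l ^ 3 := by
  have hD := cubicDen_pos hl h
  rw [show (3 * k * cubicParam k l - cubicParam k l ^ 3) ^ 2 =
    cubicParam k l ^ 2 * (3 * k - cubicParam k l ^ 2) ^ 2 by ring, cubicParam_sq hl h]
  rw [eq_div_iff (by positivity)]
  have e : ∀ D : ℝ, D ≠ 0 → (4 - 3 * (l * (1 - k * l)) ^ 2 / D *
      (3 * k - 3 * (l * (1 - k * l)) ^ 2 / D) ^ 2) * D ^ 3 =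
      4 * D ^ 3 - 27 * (l * (1 - k * l)) ^ 2 * (k * D - (l * (1 - k * l)) ^ 2) ^ 2 := fun D hD => by
    field_simp
    ring
  rw [e _ hD.ne', cubicDen]
  ring

theorem hasDerivAt_cubicParam {k l : ℝ} (hl : 0 ≤ l) (h : l < 1 - k * l + k ^ 2 * l ^ 2) :
    HasDerivAt (cubicParam k) (√3 / 2 * ((1 + k * l) * (2 * (1 - k * l + k ^ 2 * l ^ 2) ^ 3 -
      3 * (k * l) * (1 - k * l + k ^ 2 * l ^ 2) ^ 2 + l ^ 3)) /
        (cubicDen k l * √(cubicDen k l))) l := by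
  have hD := cubicDen_pos hl h
  have hN : HasDerivAt (fun l => 1 - k * l + k ^ 2 * l ^ 2) (-k + 2 * k ^ 2 * l) l :=
    ((((hasDerivAt_id l).const_mul k).const_sub 1).add
      (((hasDerivAt_id l).pow 2).const_mul (k ^ 2))).congr_deriv (by simp; ring)
  have hD' : HasDerivAt (cubicDen k)
      (3 * (1 - k * l + k ^ 2 * l ^ 2) ^ 2 * (-k + 2 * k ^ 2 * l) - 3 * l ^ 2) l :=
    ((hN.pow 3).sub ((hasDerivAt_id l).pow 3)).congr_deriv (by simp)
  have hn : HasDerivAt (fun l => √3 * (l * (1 - k * l))) (√3 * (1 - 2 * (k * l))) l :=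
    (((hasDerivAt_id l).mul (((hasDerivAt_id l).const_mul k).const_sub 1)).const_mul
      (√3)).congr_deriv (by simp; ring)
  refine (hn.div (hD'.sqrt hD.ne') (Real.sqrt_pos.2 hD).ne').congr_deriv ?_
  have hs := Real.sq_sqrt hD.le
  have hs0 := Real.sqrt_pos.2 hD
  have key : 2 * (1 - 2 * (k * l)) * cubicDen k l - l * (1 - k * l) *
      (3 * (1 - k * l + k ^ 2 * l ^ 2) ^ 2 * (-k + 2 * k ^ 2 * l) - 3 * l ^ 2) =
      (1 + k * l) * (2 * (1 - k * l + k ^ 2 * l ^ 2) ^ 3 -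
      3 * (k * l) * (1 - k * l + k ^ 2 * l ^ 2) ^ 2 + l ^ 3) := by
    rw [cubicDen]; ring
  rw [← key]
  generalize 3 * (1 - k * l + k ^ 2 * l ^ 2) ^ 2 * (-k + 2 * k ^ 2 * l) - 3 * l ^ 2 = D'
  generalize √(cubicDen k l) = y at *
  rw [← hs]
  field_simp

theorem lintegral_cubicParam {k L : ℝ} (hk0 : 0 < k) (hk : k < 1) (hL0 : 0 < L) (hL1 : L < 1)
    (hpos : ∀ l ∈ Ioo 0 L, 0 < (1 + k ^ 3 * l ^ 3) ^ 2 - 4 * l ^ 3)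
    (hL : (1 + k ^ 3 * L ^ 3) ^ 2 - 4 * L ^ 3 = 0) :
    ∫⁻ l in Ioo 0 L, ENNReal.ofReal (3 * (1 + k * l) / √((1 + k ^ 3 * l ^ 3) ^ 2 - 4 * l ^ 3)) =
      ENNReal.ofReal (2 * √3) *
        ∫⁻ s in Ioi 0, ENNReal.ofReal (1 / √(4 - (3 * k * s - s ^ 3) ^ 2)) := by
  have hN : ∀ l ∈ Icc 0 L, l < 1 - k * l + k ^ 2 * l ^ 2 := fun l hl => by
    refine lt_of_cubicDisc_nonneg hk0 hk hl.1 ?_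
    rcases hl.1.eq_or_lt with rfl | h0
    · norm_num
    rcases hl.2.eq_or_lt with rfl | h1
    · exact hL.ge
    · exact (hpos l ⟨h0, h1⟩).le
  have hM : ∀ l ∈ Ioo 0 L, 0 < 2 * (1 - k * l + k ^ 2 * l ^ 2) ^ 3 -
      3 * (k * l) * (1 - k * l + k ^ 2 * l ^ 2) ^ 2 + l ^ 3 := fun l hl => by
    have := hN l (Ioo_subset_Icc_self hl)
    generalize 1 - k * l + k ^ 2 * l ^ 2 = N at *
    have h0 := hl.1
    have hN0 : 0 < N := h0.trans this
    have h1 : k * l * N ^ 2 < l * N ^ 2 := by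
      have : k * l < l := by nlinarith
      gcongr
    nlinarith [mul_nonneg (sq_nonneg (N - l)) (by positivity : 0 ≤ 2 * N + l)]
  have hS := lintegral_Ioo_of_deriv_pos hL0.le
    (fun l hl => (hasDerivAt_cubicParam hl.1 (hN l hl)).continuousAt.continuousWithinAt)
    (fun l hl => hasDerivAt_cubicParam hl.1.le (hN l (Ioo_subset_Icc_self hl)))
    (fun l hl => by
      have hD := cubicDen_pos hl.1.le (hN l (Ioo_subset_Icc_self hl))
      have := hM l hl
      have := hl.1
      positivity)
    (fun s => ENNReal.ofReal (1 / √(4 - (3 * k * s - s ^ 3) ^ 2)))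
  have h0 : cubicParam k 0 = 0 := by simp [cubicParam]
  set S := cubicParam k L with hSdef
  have hLmem : L ∈ Icc 0 L := ⟨hL0.le, le_rfl⟩
  have hDL := cubicDen_pos hL0.le (hN L hLmem)
  have hS0 : 0 < S := by
    rw [hSdef, cubicParam]
    have : 0 < 1 - k * L := by nlinarith
    positivity
  have hu := four_sub_cubicParam hL0.le (hN L hLmem)
  rw [hL, mul_zero, zero_div, ← hSdef] at hu
  have hu' : S ^ 3 - 3 * k * S = 2 := by
    have : (3 * k * S - S ^ 3 - 2) * (3 * k * S - S ^ 3 + 2) = 0 := by linear_combination -hu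
    rcases mul_eq_zero.1 this with h | h
    · nlinarith [mul_nonneg (sq_nonneg (S - 1)) (by positivity : 0 ≤ S + 2)]
    · linarith
  have hzero : ∀ s ∈ Ici S, ENNReal.ofReal (1 / √(4 - (3 * k * s - s ^ 3) ^ 2)) = 0 := fun s hs => by
    have hs' : S ≤ s := hs
    have hs0 : 0 ≤ s := hS0.le.trans hs'
    have hk3 : 0 < S ^ 2 - 3 * k := by
      by_contra! h
      nlinarith
    have h2 : 2 ≤ s * (s ^ 2 - 3 * k) := by
      calc 2 = S * (S ^ 2 - 3 * k) := by linarith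
        _ ≤ s * (s ^ 2 - 3 * k) := by gcongr
    rw [Real.sqrt_eq_zero_of_nonpos (by nlinarith)]
    simp
  have hsplit : ∫⁻ s in Ioi 0, ENNReal.ofReal (1 / √(4 - (3 * k * s - s ^ 3) ^ 2)) =
      ∫⁻ s in Ioo 0 S, ENNReal.ofReal (1 / √(4 - (3 * k * s - s ^ 3) ^ 2)) := by
    rw [← Ioo_union_Ici_eq_Ioi hS0, lintegral_union measurableSet_Ici
      (Set.disjoint_left.2 fun x hx hx' => not_lt.2 hx' hx.2),
      setLIntegral_congr_fun (s := Ici S) measurableSet_Ici hzero]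
    simp
  rw [h0] at hS
  rw [hsplit, hS, ← lintegral_const_mul' _ _ ENNReal.ofReal_ne_top]
  refine setLIntegral_congr_fun measurableSet_Ioo fun l hl => ?_
  have hNl := hN l (Ioo_subset_Icc_self hl)
  have hD := cubicDen_pos hl.1.le hNl
  have hMl := hM l hl
  have hp := hpos l hl
  have hl0 := hl.1
  rw [← ENNReal.ofReal_mul (by positivity), ← ENNReal.ofReal_mul (by positivity),
    four_sub_cubicParam hl.1.le hNl, Real.sqrt_div (by positivity), Real.sqrt_mul (by positivity),
    Real.sqrt_sq hMl.le, show cubicDen k l ^ 3 = cubicDen k l ^ 2 * cubicDen k l by ring,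
    Real.sqrt_mul (by positivity), Real.sqrt_sq hD.le]
  congr 1
  have h3 : √3 ^ 2 = 3 := Real.sq_sqrt (by norm_num)
  have hsD := Real.sqrt_pos.2 hD
  have hsp := Real.sqrt_pos.2 hp
  generalize √(cubicDen k l) = y at *
  generalize √((1 + k ^ 3 * l ^ 3) ^ 2 - 4 * l ^ 3) = z at *
  generalize 2 * (1 - k * l + k ^ 2 * l ^ 2) ^ 3 -
      3 * (k * l) * (1 - k * l + k ^ 2 * l ^ 2) ^ 2 + l ^ 3 = M at *
  field_simp
  rw [h3]

theorem lintegral_cubic {k : ℝ} (hk0 : 0 < k) (hk : k < 1) :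
    ∫⁻ t in Ioo 0 1, ENNReal.ofReal ((1 + k * cubicLam (k ^ 3) t) /
        (cubicLam (k ^ 3) t ^ 2 * (1 - k ^ 3 * t))) =
      ENNReal.ofReal (4 * √3) *
        ∫⁻ s in Ioi 0, ENNReal.ofReal (1 / √(4 - (3 * k * s - s ^ 3) ^ 2)) := by
  have hc0 : 0 < k ^ 3 := by positivity
  have hc : k ^ 3 < 1 := pow_lt_one₀ hk0.le hk (by norm_num)
  rw [lintegral_cubicLam hk0 hk]
  have hw2 : √(1 - k ^ 3) ^ 2 = 1 - k ^ 3 := Real.sq_sqrt (by linarith)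
  have hw0 : 0 < √(1 - k ^ 3) := Real.sqrt_pos.2 (by linarith)
  generalize √(1 - k ^ 3) = w at *
  have hw1 : w < 1 := by nlinarith
  have hτmem : 1 / (1 + w) ∈ Ioo (0 : ℝ) 1 :=
    ⟨by positivity, by rw [div_lt_one (by positivity)]; linarith⟩
  have hLpow := cubicLam_pow hc0 hc (Ioo_subset_Icc_self hτmem)
  have hL0 := cubicLam_pos hc0 hc hτmem
  have e : 1 / (1 + w) * (1 - 1 / (1 + w)) / (1 - k ^ 3 * (1 / (1 + w))) = (1 / (1 + w)) ^ 2 := by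
    have : k ^ 3 = 1 - w ^ 2 := by linarith
    rw [this, show 1 - (1 - w ^ 2) * (1 / (1 + w)) = w by field_simp; ring]
    field_simp
    ring
  rw [e] at hLpow
  generalize cubicLam (k ^ 3) (1 / (1 + w)) = L at *
  have hfac : ∀ l : ℝ, (1 + k ^ 3 * l ^ 3) ^ 2 - 4 * l ^ 3 =
      (1 - (1 + w) ^ 2 * l ^ 3) * (1 - (1 - w) ^ 2 * l ^ 3) := fun l => by
    rw [show k ^ 3 = 1 - w ^ 2 by linarith]; ring
  have hL1 : (1 + w) ^ 2 * L ^ 3 = 1 := by rw [hLpow]; field_simp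
  rw [lintegral_cubicParam hk0 hk hL0 ?_ ?_ ?_, ← mul_assoc]
  · congr 1
    rw [show (2 : ENNReal) = ENNReal.ofReal 2 by simp, ← ENNReal.ofReal_mul (by norm_num)]
    congr 1
    ring
  · refine lt_of_pow_lt_pow_left₀ 3 zero_le_one ?_
    rw [one_pow, hLpow]
    exact pow_lt_one₀ hτmem.1.le hτmem.2 (by norm_num)
  · intro l hl
    have h3 : l ^ 3 < L ^ 3 := pow_lt_pow_left₀ hl.2 hl.1.le (by norm_num)
    have h30 : 0 < l ^ 3 := pow_pos hl.1 3
    rw [hfac]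
    have h1 : (1 + w) ^ 2 * l ^ 3 < 1 :=
      (mul_lt_mul_of_pos_left h3 (by positivity)).trans_eq hL1
    have h2 : (1 - w) ^ 2 * l ^ 3 ≤ (1 + w) ^ 2 * l ^ 3 := by gcongr; nlinarith
    exact mul_pos (by linarith) (by linarith)
  · rw [hfac, hL1]; ring

end CubicSubstitution

section Pochhammer

theorem poch_succ (a : ℝ) (n : ℕ) : poch a (n + 1) = poch a n * (a + n) := by
  rw [poch, poch, Finset.prod_range_succ]

theorem poch_pos {a : ℝ} (ha : 0 < a) (n : ℕ) : 0 < poch a n :=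
  Finset.prod_pos fun i _ => by positivity

theorem poch_mul_add (a : ℝ) (n : ℕ) : poch a n * (a + n) = a * poch (a + 1) n := by
  induction n with
  | zero => simp [poch]
  | succ n ih => rw [poch_succ, poch_succ, ih]; push_cast; ring

theorem poch_le_poch {a b : ℝ} (ha : 0 < a) (hab : a ≤ b) (n : ℕ) : poch a n ≤ poch b n :=
  Finset.prod_le_prod (fun i _ => by positivity) fun i _ => by linarith

theorem poch_one (n : ℕ) : poch 1 n = n.factorial := by
  induction n with
  | zero => simp [poch]
  | succ n ih => rw [poch_succ, ih, Nat.factorial_succ]; push_cast; ring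

theorem Gamma_add_natCast {a : ℝ} (ha : 0 < a) (n : ℕ) :
    Real.Gamma (a + n) = poch a n * Real.Gamma a := by
  induction n with
  | zero => simp [poch]
  | succ n ih =>
    rw [poch_succ, show a + ((n + 1 : ℕ) : ℝ) = a + n + 1 by push_cast; ring,
      Real.Gamma_add_one (by positivity), ih]
    ring

theorem ring_choose_eq_poch (a : ℝ) (n : ℕ) :
    Ring.choose (a + n - 1) n = poch a n / n.factorial := by
  have h := Ring.factorial_nsmul_multichoose_eq_ascPochhammer a n
  rw [Polynomial.ascPochhammer_smeval_eq_eval, nsmul_eq_mul] at h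
  rw [Ring.choose, show a + n - 1 - n + 1 = a by ring, eq_div_iff (by positivity), mul_comm, h]
  clear h
  induction n with
  | zero => simp [poch]
  | succ n ih => rw [ascPochhammer_succ_eval, ih, poch_succ]

/-- The hypergeometric terms of the two series in question. -/
noncomputable def hypTerm (a : ℝ) (n : ℕ) : ℝ :=
  poch a n ^ 3 / (poch (2 * a) n * poch (a + 1) n * n.factorial)

theorem hypTerm_pos {a : ℝ} (ha : 0 < a) (n : ℕ) : 0 < hypTerm a n := by
  have := poch_pos ha n
  have := poch_pos (by positivity : 0 < 2 * a) n
  have := poch_pos (by positivity : 0 < a + 1) n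
  rw [hypTerm]
  positivity

theorem hypTerm_le_one {a : ℝ} (ha : 0 < a) (ha1 : a ≤ 1) (n : ℕ) : hypTerm a n ≤ 1 := by
  have h0 := poch_pos ha n
  have h1 := poch_pos (by positivity : 0 < 2 * a) n
  have h2 := poch_pos (by positivity : 0 < a + 1) n
  rw [hypTerm, div_le_one (by positivity), pow_succ, sq, ← poch_one]
  gcongr
  · exact poch_le_poch ha (by linarith) n
  · exact poch_le_poch ha (by linarith) n
  · exact poch_le_poch ha ha1 n

theorem summable_hypTerm {a x : ℝ} (ha : 0 < a) (ha1 : a ≤ 1) (hx0 : 0 ≤ x) (hx : x < 1) :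
    Summable fun n => hypTerm a n * x ^ n :=
  Summable.of_nonneg_of_le (fun n => mul_nonneg (hypTerm_pos ha n).le (by positivity))
    (fun n => mul_le_of_le_one_left (by positivity) (hypTerm_le_one ha ha1 n))
    (summable_geometric_of_lt_one hx0 hx)

end Pochhammer

section EulerIntegral

open MeasureTheory Set

theorem hasSum_one_sub_rpow_neg (a : ℝ) {x : ℝ} (hx0 : 0 ≤ x) (hx : x < 1) :
    HasSum (fun n : ℕ => poch a n / n.factorial * x ^ n) ((1 - x) ^ (-a)) := by
  have h := (Real.one_div_one_sub_rpow_hasFPowerSeriesOnBall_zero a).hasSum (y := x)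
    (by simp [enorm_eq_nnnorm, abs_of_nonneg hx0, ← NNReal.coe_lt_coe, hx])
  rw [zero_add, one_div, ← Real.rpow_neg (by linarith)] at h
  simpa [FormalMultilinearSeries.ofScalars_apply_eq, ring_choose_eq_poch, mul_comm] using h

theorem lintegral_beta {α β : ℝ} (hα : 0 < α) (hβ : 0 < β) :
    ∫⁻ t in Ioo 0 1, ENNReal.ofReal (t ^ (α - 1) * (1 - t) ^ (β - 1)) =
      ENNReal.ofReal (Real.Gamma α * Real.Gamma β / Real.Gamma (α + β)) := by
  have h := ProbabilityTheory.lintegral_betaPDF_eq_one hα hβ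
  have hb : 0 < ProbabilityTheory.beta α β := ProbabilityTheory.beta_pos hα hβ
  rw [ProbabilityTheory.lintegral_betaPDF] at h
  change _ = ENNReal.ofReal (ProbabilityTheory.beta α β)
  rw [← mul_one (ENNReal.ofReal (ProbabilityTheory.beta α β)), ← h,
    ← lintegral_const_mul' _ _ ENNReal.ofReal_ne_top]
  refine lintegral_congr fun t => ?_
  rw [← ENNReal.ofReal_mul hb.le]
  congr 1
  field_simp

theorem lintegral_euler {a c : ℝ} (ha : 0 < a) (hc0 : 0 ≤ c) (hc : c < 1) :
    ∫⁻ t in Ioo 0 1, ENNReal.ofReal ((t * (1 - t)) ^ (a - 1) * (1 - c * t) ^ (-a)) =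
      ∑' n : ℕ, ENNReal.ofReal (Real.Gamma a ^ 2 / Real.Gamma (2 * a) *
        (poch a n ^ 2 / (poch (2 * a) n * n.factorial)) * c ^ n) := by
  have hintg : ∀ n : ℕ, ∫⁻ t in Ioo 0 1, ENNReal.ofReal (poch a n / n.factorial * c ^ n) *
      ENNReal.ofReal (t ^ (a + n - 1) * (1 - t) ^ (a - 1)) =
      ENNReal.ofReal (Real.Gamma a ^ 2 / Real.Gamma (2 * a) *
        (poch a n ^ 2 / (poch (2 * a) n * n.factorial)) * c ^ n) := fun n => by
    have h0 := poch_pos ha n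
    have h1 := poch_pos (by positivity : 0 < 2 * a) n
    have h2 := Real.Gamma_pos_of_pos (by positivity : 0 < 2 * a)
    rw [lintegral_const_mul' _ _ ENNReal.ofReal_ne_top,
      lintegral_beta (by positivity) ha, ← ENNReal.ofReal_mul (by positivity),
      Gamma_add_natCast ha, show a + n + a = 2 * a + n by ring,
      Gamma_add_natCast (by positivity : 0 < 2 * a)]
    congr 1
    generalize Real.Gamma (2 * a) = y at *
    field_simp
  simp_rw [← hintg]
  rw [← lintegral_tsum fun n => by fun_prop]
  refine setLIntegral_congr_fun measurableSet_Ioo fun t ht => ?_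
  have h1 : 0 < 1 - t := by linarith [ht.2]
  have hct0 : 0 ≤ c * t := mul_nonneg hc0 ht.1.le
  have hct : c * t < 1 := by nlinarith [ht.1, ht.2]
  have hs := (hasSum_one_sub_rpow_neg a hct0 hct).mul_left ((t * (1 - t)) ^ (a - 1))
  rw [← hs.tsum_eq, ENNReal.ofReal_tsum_of_nonneg _ hs.summable]
  · refine tsum_congr fun n => ?_
    have h0 := poch_pos ha n
    rw [← ENNReal.ofReal_mul (by positivity), Real.mul_rpow ht.1.le h1.le, mul_pow,
      show a + n - 1 = a - 1 + n by ring, Real.rpow_add ht.1, Real.rpow_natCast]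
    congr 1
    ring
  · intro n
    have h0 := poch_pos ha n
    have := ht.1
    positivity

theorem lintegral_rpow {p b : ℝ} (hp : 0 < p) (hb : 0 ≤ b) :
    ∫⁻ k in Ioo 0 b, ENNReal.ofReal (k ^ (p - 1)) = ENNReal.ofReal (b ^ p / p) := by
  rw [setLIntegral_congr Ioo_ae_eq_Ioc, ← ofReal_integral_eq_lintegral_ofReal
    ((intervalIntegrable_iff_integrableOn_Ioc_of_le hb).1
      (intervalIntegral.intervalIntegrable_rpow' (by linarith)))
    (by filter_upwards [ae_restrict_mem measurableSet_Ioc] with k hk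
        exact Real.rpow_nonneg hk.1.le _),
    ← intervalIntegral.integral_of_le hb, integral_rpow (Or.inl (by linarith)),
    sub_add_cancel, Real.zero_rpow hp.ne', sub_zero]

theorem lintegral_lintegral_euler {a b : ℝ} (ha : 0 < a) (ha1 : a ≤ 1) (hb0 : 0 < b) (hb : b < 1) :
    ∫⁻ k in Ioo 0 b, ∫⁻ t in Ioo 0 1, ENNReal.ofReal (k ^ (3 * a - 1) *
      ((t * (1 - t)) ^ (a - 1) * (1 - k ^ 3 * t) ^ (-a))) =
      ENNReal.ofReal (Real.Gamma a ^ 2 / Real.Gamma (2 * a) * (b ^ (3 * a) / (3 * a)) *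
        ∑' n, hypTerm a n * (b ^ 3) ^ n) := by
  have hG := Real.Gamma_pos_of_pos (by positivity : 0 < 2 * a)
  have hb3 : b ^ 3 < 1 := pow_lt_one₀ hb0.le hb (by norm_num)
  have hs := summable_hypTerm ha ha1 (by positivity : 0 ≤ b ^ 3) hb3
  rw [← tsum_mul_left, ENNReal.ofReal_tsum_of_nonneg (fun n => by
    have := hypTerm_pos ha n
    positivity) (hs.mul_left _)]
  have hintg : ∀ n : ℕ, ∫⁻ k in Ioo 0 b, ENNReal.ofReal (Real.Gamma a ^ 2 / Real.Gamma (2 * a) *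
        (poch a n ^ 2 / (poch (2 * a) n * n.factorial))) *
        ENNReal.ofReal (k ^ (3 * (a + n) - 1)) =
      ENNReal.ofReal (Real.Gamma a ^ 2 / Real.Gamma (2 * a) * (b ^ (3 * a) / (3 * a)) *
        (hypTerm a n * (b ^ 3) ^ n)) := fun n => by
    have h0 := poch_pos ha n
    have h1 := poch_pos (by positivity : 0 < 2 * a) n
    have h2 := poch_pos (by positivity : 0 < a + 1) n
    rw [lintegral_const_mul' _ _ ENNReal.ofReal_ne_top, lintegral_rpow (by positivity) hb0.le,
      ← ENNReal.ofReal_mul (by positivity), hypTerm, ← pow_mul, mul_add, Real.rpow_add hb0,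
      show (3 * n : ℝ) = ((3 * n : ℕ) : ℝ) by push_cast; ring, Real.rpow_natCast]
    congr 1
    have key := poch_mul_add a n
    have hp : 0 < a + n := by positivity
    have e : poch (a + 1) n = poch a n * (a + n) / a := by rw [key]; field_simp
    rw [e]
    push_cast
    rw [← mul_add 3]
    generalize Real.Gamma (2 * a) = y at *
    generalize b ^ (3 * a) = z
    generalize poch (2 * a) n = w at *
    generalize b ^ (3 * n) = v
    field_simp
  simp_rw [← hintg]
  rw [← lintegral_tsum fun n => by fun_prop]
  refine setLIntegral_congr_fun measurableSet_Ioo fun k hk => ?_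
  have hk0 := hk.1
  have hk3 : k ^ 3 < 1 := pow_lt_one₀ hk0.le (hk.2.trans hb) (by norm_num)
  have : ∀ t, ENNReal.ofReal (k ^ (3 * a - 1) *
      ((t * (1 - t)) ^ (a - 1) * (1 - k ^ 3 * t) ^ (-a))) = ENNReal.ofReal (k ^ (3 * a - 1)) *
      ENNReal.ofReal ((t * (1 - t)) ^ (a - 1) * (1 - k ^ 3 * t) ^ (-a)) := fun t =>
    ENNReal.ofReal_mul (by positivity)
  simp_rw [this]
  rw [lintegral_const_mul' _ _ ENNReal.ofReal_ne_top, lintegral_euler ha (by positivity) hk3,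
    ← ENNReal.tsum_mul_left]
  refine tsum_congr fun n => ?_
  have h0 := poch_pos ha n
  have h1 := poch_pos (by positivity : 0 < 2 * a) n
  rw [← ENNReal.ofReal_mul (by positivity), ← ENNReal.ofReal_mul (by positivity),
    show 3 * (a + n) - 1 = 3 * a - 1 + ((3 * n : ℕ) : ℝ) by push_cast; ring, Real.rpow_add hk0,
    Real.rpow_natCast, pow_mul]
  congr 1
  ring

end EulerIntegral

section CubicSubstitution

open MeasureTheory Set

theorem ofReal_cubic_integrand {k t : ℝ} (hk0 : 0 < k) (hk : k < 1) (ht : t ∈ Ioo (0 : ℝ) 1) :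
    ENNReal.ofReal ((1 + k * cubicLam (k ^ 3) t) / (cubicLam (k ^ 3) t ^ 2 * (1 - k ^ 3 * t))) =
      ENNReal.ofReal (k ^ (3 * (1 / 3 : ℝ) - 1) *
        ((t * (1 - t)) ^ ((1 / 3 : ℝ) - 1) * (1 - k ^ 3 * t) ^ (-(1 / 3 : ℝ)))) +
      ENNReal.ofReal (k ^ (3 * (2 / 3 : ℝ) - 1) *
        ((t * (1 - t)) ^ ((2 / 3 : ℝ) - 1) * (1 - k ^ 3 * t) ^ (-(2 / 3 : ℝ)))) := by
  have hc0 : 0 < k ^ 3 := by positivity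
  have hc : k ^ 3 < 1 := pow_lt_one₀ hk0.le hk (by norm_num)
  have hm := one_sub_mul_pos hc0 hc ht.2.le
  have hT : 0 < t * (1 - t) := mul_pos ht.1 (by linarith [ht.2])
  have h3m : ((1 - k ^ 3 * t) ^ (1 / 3 : ℝ)) ^ 3 = 1 - k ^ 3 * t := by
    rw [← Real.rpow_natCast, ← Real.rpow_mul hm.le]; norm_num
  have h3T : ((t * (1 - t)) ^ (1 / 3 : ℝ)) ^ 3 = t * (1 - t) := by
    rw [← Real.rpow_natCast, ← Real.rpow_mul hT.le]; norm_num
  have hneg : ∀ x : ℝ, 0 < x → x ^ (-(1 / 3) : ℝ) = (x ^ (1 / 3 : ℝ))⁻¹ := fun x hx =>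
    Real.rpow_neg hx.le _
  have hneg2 : ∀ x : ℝ, 0 < x → x ^ (-(2 / 3) : ℝ) = ((x ^ (1 / 3 : ℝ)) ^ 2)⁻¹ := fun x hx => by
    rw [Real.rpow_neg hx.le, ← Real.rpow_natCast (x ^ (1 / 3 : ℝ)), ← Real.rpow_mul hx.le]
    norm_num
  rw [← ENNReal.ofReal_add (by positivity) (by positivity)]
  congr 1
  rw [show 3 * (1 / 3 : ℝ) - 1 = 0 by norm_num, show 3 * (2 / 3 : ℝ) - 1 = 1 by norm_num,
    show (1 / 3 : ℝ) - 1 = -(2 / 3) by norm_num, show (2 / 3 : ℝ) - 1 = -(1 / 3) by norm_num,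
    Real.rpow_zero, Real.rpow_one, hneg _ hT, hneg _ hm, hneg2 _ hT, hneg2 _ hm, cubicLam,
    Real.div_rpow hT.le hm.le]
  have hM0 := Real.rpow_pos_of_pos hm (1 / 3)
  have hT0 := Real.rpow_pos_of_pos hT (1 / 3)
  generalize (1 - k ^ 3 * t) ^ (1 / 3 : ℝ) = x at *
  generalize (t * (1 - t)) ^ (1 / 3 : ℝ) = y at *
  rw [← h3m]
  field_simp

/-- The two hypergeometric series combine into an arcsine integral. -/
theorem hypergeometric_eq_lintegral_arcsin {b : ℝ} (hb0 : 0 < b) (hb : b < 1) :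
    ENNReal.ofReal (Real.Gamma (1 / 3) ^ 2 / Real.Gamma (2 / 3) * b *
        (∑' n, hypTerm (1 / 3) n * (b ^ 3) ^ n) +
      Real.Gamma (2 / 3) ^ 2 / Real.Gamma (4 / 3) * (b ^ 2 / 2) *
        ∑' n, hypTerm (2 / 3) n * (b ^ 3) ^ n) =
      ENNReal.ofReal (4 * √3) * ∫⁻ s in Ioi 0,
        ENNReal.ofReal ((arcsin ((3 * b * s - s ^ 3) / 2) - arcsin (-s ^ 3 / 2)) / (3 * s)) := by
  have h1 := lintegral_lintegral_euler (a := 1 / 3) (by norm_num) (by norm_num) hb0 hb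
  have h2 := lintegral_lintegral_euler (a := 2 / 3) (by norm_num) (by norm_num) hb0 hb
  have hsum : ∀ a, 0 < a → 0 ≤ ∑' n, hypTerm a n * (b ^ 3) ^ n := fun a ha =>
    tsum_nonneg fun n => mul_nonneg (hypTerm_pos ha n).le (by positivity)
  have e1 : Real.Gamma (1 / 3) ^ 2 / Real.Gamma (2 * (1 / 3)) * (b ^ (3 * (1 / 3 : ℝ)) / (3 * (1 / 3)))
      = Real.Gamma (1 / 3) ^ 2 / Real.Gamma (2 / 3) * b := by
    rw [show 3 * (1 / 3 : ℝ) = 1 by norm_num, Real.rpow_one,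
      show 2 * (1 / 3 : ℝ) = 2 / 3 by norm_num, div_one]
  have e2 : Real.Gamma (2 / 3) ^ 2 / Real.Gamma (2 * (2 / 3)) * (b ^ (3 * (2 / 3 : ℝ)) / (3 * (2 / 3)))
      = Real.Gamma (2 / 3) ^ 2 / Real.Gamma (4 / 3) * (b ^ 2 / 2) := by
    rw [show 3 * (2 / 3 : ℝ) = (2 : ℕ) by norm_num, Real.rpow_natCast,
      show 2 * (2 / 3 : ℝ) = 4 / 3 by norm_num, Nat.cast_ofNat]
  rw [e1] at h1
  rw [e2] at h2
  have g1 := Real.Gamma_pos_of_pos (by norm_num : (0 : ℝ) < 1 / 3)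
  have g2 := Real.Gamma_pos_of_pos (by norm_num : (0 : ℝ) < 2 / 3)
  have g3 := Real.Gamma_pos_of_pos (by norm_num : (0 : ℝ) < 4 / 3)
  have s1 := hsum (1 / 3) (by norm_num)
  have s2 := hsum (2 / 3) (by norm_num)
  rw [ENNReal.ofReal_add (by positivity) (by positivity), ← h1, ← h2, ← lintegral_add_left]
  · have hinner : ∀ k ∈ Ioo 0 b, (∫⁻ t in Ioo 0 1, ENNReal.ofReal (k ^ (3 * (1 / 3 : ℝ) - 1) *
        ((t * (1 - t)) ^ ((1 / 3 : ℝ) - 1) * (1 - k ^ 3 * t) ^ (-(1 / 3 : ℝ))))) +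
        (∫⁻ t in Ioo 0 1, ENNReal.ofReal (k ^ (3 * (2 / 3 : ℝ) - 1) *
        ((t * (1 - t)) ^ ((2 / 3 : ℝ) - 1) * (1 - k ^ 3 * t) ^ (-(2 / 3 : ℝ))))) =
        ENNReal.ofReal (4 * √3) *
        ∫⁻ s in Ioi 0, ENNReal.ofReal (1 / √(4 - (3 * k * s - s ^ 3) ^ 2)) := fun k hk => by
      rw [← lintegral_cubic hk.1 (hk.2.trans hb), ← lintegral_add_left (by fun_prop)]
      exact setLIntegral_congr_fun measurableSet_Ioo fun t ht =>
        (ofReal_cubic_integrand hk.1 (hk.2.trans hb) ht).symm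
    rw [setLIntegral_congr_fun measurableSet_Ioo hinner,
      lintegral_const_mul' _ _ ENNReal.ofReal_ne_top, lintegral_lintegral_swap (by fun_prop)]
    congr 1
    exact setLIntegral_congr_fun measurableSet_Ioi fun s hs => lintegral_inv_sqrt hs hb0.le
  · exact Measurable.lintegral_prod_right' (f := fun p : ℝ × ℝ =>
      ENNReal.ofReal (p.1 ^ (3 * (1 / 3 : ℝ) - 1) *
        ((p.2 * (1 - p.2)) ^ ((1 / 3 : ℝ) - 1) * (1 - p.1 ^ 3 * p.2) ^ (-(1 / 3 : ℝ)))))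
      (by fun_prop)

end CubicSubstitution

section HesseCubic

variable {ρ x : ℂ}

theorem thetaJ_cube_sq_mul (hρ : ρ ≠ 0) (hx : x ≠ 0) :
    thetaJ (ρ ^ 3) (ρ ^ 2 * x) = thetaJ (ρ ^ 3) (ρ * x⁻¹) := by
  rw [← thetaJ_div (pow_ne_zero 3 hρ)]
  congr 1
  field_simp

theorem thetaJ_cube_mul_inv (hρ : ρ ≠ 0) (hx : x ≠ 0) :
    thetaJ (ρ ^ 3) (ρ ^ 2 * x⁻¹) = thetaJ (ρ ^ 3) (ρ * x) := by
  rw [thetaJ_cube_sq_mul hρ (inv_ne_zero hx), inv_inv]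

theorem thetaJ_mul_qInf_cube (hρ : ρ ≠ 0) (hρ1 : ‖ρ‖ < 1) (hx : x ≠ 0) :
    thetaJ ρ x * qInf (ρ ^ 3) (ρ ^ 3) ^ 3 = qInf ρ ρ *
      (thetaJ (ρ ^ 3) x * thetaJ (ρ ^ 3) (ρ * x) * thetaJ (ρ ^ 3) (ρ ^ 2 * x)) := by
  have hq := pow_ne_zero 3 hρ
  have hq1 := norm_pow_lt_one hρ1 three_ne_zero
  rw [thetaJ_eq_qInf hρ hρ1 hx, thetaJ_eq_qInf hq hq1 hx,
    thetaJ_eq_qInf hq hq1 (mul_ne_zero hρ hx),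
    thetaJ_eq_qInf hq hq1 (mul_ne_zero (pow_ne_zero 2 hρ) hx),
    qInf_eq_prod_pow hρ1 x three_ne_zero, qInf_eq_prod_pow hρ1 (ρ / x) three_ne_zero]
  simp only [Finset.prod_range_succ, Finset.prod_range_zero]
  rw [show ρ ^ 3 / (ρ * x) = ρ / x * ρ ^ 1 by field_simp,
    show ρ ^ 3 / (ρ ^ 2 * x) = ρ / x * ρ ^ 0 by field_simp,
    show ρ ^ 3 / x = ρ / x * ρ ^ 2 by field_simp,
    show ρ * x = x * ρ ^ 1 by ring, show ρ ^ 2 * x = x * ρ ^ 2 by ring, pow_zero, mul_one]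
  ring

theorem IsLaurent.pow {f : ℂ → ℂ} {c : ℤ → ℂ} (hf : IsLaurent f c) :
    ∃ d, IsLaurent (fun x => f x ^ 3) d :=
  ⟨_, ((hf.mul hf).mul hf).congr fun x _ => by ring⟩

/-- The cubic theta functions parametrize a curve in the Hesse pencil. -/
theorem exists_hesse (hρ : ρ ≠ 0) (hρ1 : ‖ρ‖ < 1) : ∃ C : ℂ, ∀ x ≠ 0,
    thetaJ (ρ ^ 3) x ^ 3 - ρ⁻¹ * x * thetaJ (ρ ^ 3) (ρ * x) ^ 3 +
      ρ⁻¹ * x ^ 2 * thetaJ (ρ ^ 3) (ρ ^ 2 * x) ^ 3 =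
    C * x * (thetaJ (ρ ^ 3) x * thetaJ (ρ ^ 3) (ρ * x) * thetaJ (ρ ^ 3) (ρ ^ 2 * x)) := by
  have hq := pow_ne_zero 3 hρ
  have hq1 := norm_pow_lt_one hρ1 three_ne_zero
  have hJ := isLaurent_thetaJ hq hq1
  obtain ⟨d₀, h₀⟩ := hJ.pow
  obtain ⟨d₁, h₁⟩ := (hJ.comp_mul_left hρ).pow
  obtain ⟨d₂, h₂⟩ := (hJ.comp_mul_left (pow_ne_zero 2 hρ)).pow
  have hf := (((h₀.zpow_mul (-1)).add (h₁.const_mul (-ρ⁻¹))).add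
    ((h₂.zpow_mul 1).const_mul ρ⁻¹))
  obtain ⟨C, hC⟩ := hf.eq_const_mul_thetaJ hρ fun x hx => by
    have e := thetaJ_mul_left hq hx
    rw [show ρ * (ρ * x) = ρ ^ 2 * x by ring, show ρ ^ 2 * (ρ * x) = ρ ^ 3 * x by ring, e]
    simp only [zpow_neg, zpow_one]
    field_simp
    ring
  refine ⟨C * qInf ρ ρ / qInf (ρ ^ 3) (ρ ^ 3) ^ 3, fun x hx => ?_⟩
  have h1 := hC x hx
  have h2 := thetaJ_mul_qInf_cube hρ hρ1 hx
  have h3 := qInf_self_ne_zero hq1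
  simp only [zpow_neg, zpow_one] at h1
  generalize thetaJ (ρ ^ 3) x = J₀, thetaJ (ρ ^ 3) (ρ * x) = J₁,
    thetaJ (ρ ^ 3) (ρ ^ 2 * x) = J₂, thetaJ ρ x = J, qInf (ρ ^ 3) (ρ ^ 3) = P,
    qInf ρ ρ = R at h1 h2 h3 ⊢
  field_simp at h1 ⊢
  linear_combination P ^ 3 * h1 + C * ρ * x * h2

theorem cubic_sum_ne_zero (hρ : ρ ≠ 0) (hρ1 : ‖ρ‖ < 1) (hx : ‖x‖ = 1) (hx1 : x ≠ -1) :
    thetaJ (ρ ^ 3) (ρ * x) ^ 3 + x * thetaJ (ρ ^ 3) (ρ ^ 2 * x) ^ 3 ≠ 0 := by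
  have hq := pow_ne_zero 3 hρ
  have hq1 := norm_pow_lt_one hρ1 three_ne_zero
  have hx0 : x ≠ 0 := by
    rintro rfl
    simp at hx
  have hJ := isLaurent_thetaJ hq hq1
  obtain ⟨d₁, h₁⟩ := (hJ.comp_mul_left hρ).pow
  obtain ⟨d₂, h₂⟩ := (hJ.comp_mul_left (pow_ne_zero 2 hρ)).pow
  have hf := h₁.add (h₂.zpow_mul 1)
  obtain ⟨C, hC⟩ := hf.eq_const_mul_quint hq
    (fun x hx => by
      have e1 := thetaJ_mul_left hq (mul_ne_zero hρ hx)
      have e2 := thetaJ_mul_left hq (mul_ne_zero (pow_ne_zero 2 hρ) hx)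
      rw [show ρ * (ρ ^ 3 * x) = ρ ^ 3 * (ρ * x) by ring,
        show ρ ^ 2 * (ρ ^ 3 * x) = ρ ^ 3 * (ρ ^ 2 * x) by ring, e1, e2]
      simp only [zpow_one]
      field_simp
      ring)
    (fun x hx => by
      rw [thetaJ_cube_mul_inv hρ hx, ← thetaJ_cube_sq_mul hρ hx]
      simp only [zpow_one]
      field_simp
      ring)
  simp only [zpow_one] at hC
  have hC0 : C ≠ 0 := by
    rintro rfl
    have h := hC 1 one_ne_zero
    rw [thetaJ_cube_sq_mul hρ one_ne_zero, inv_one, mul_one, one_mul, zero_mul, ← two_mul,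
      thetaJ_cube_self hρ hρ1] at h
    exact qInf_self_ne_zero hρ1 (by simpa using h)
  rw [hC x hx0]
  refine mul_ne_zero hC0 fun h0 => ?_
  have h := thetaJ_neg_mul_thetaJ hq hq1 hx0
  rw [h0, mul_zero] at h
  have hq2 := pow_ne_zero 2 hq
  have hq21 := norm_pow_lt_one hq1 two_ne_zero
  have hpow : ∀ n : ℕ, n ≠ 0 → ∀ y : ℂ, ‖y‖ = 1 → y * (ρ ^ 3) ^ n ≠ 1 := fun n hn y hy he => by
    have := congrArg norm he
    rw [norm_mul, hy, one_mul, norm_one] at this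
    exact (norm_pow_lt_one hq1 hn).ne this
  refine mul_ne_zero ?_ ?_ h
  · rw [thetaJ_eq_qInf hq hq1 (neg_ne_zero.2 hx0)]
    refine mul_ne_zero (mul_ne_zero (qInf_ne_zero hq1 fun n => ?_) (qInf_ne_zero_of_norm_lt hq1 ?_))
      (qInf_self_ne_zero hq1)
    · rcases eq_or_ne n 0 with rfl | hn
      · rw [pow_zero, mul_one]
        exact fun h => hx1 (by rw [← h, neg_neg])
      · exact hpow n hn _ (by rw [norm_neg, hx])
    · rw [norm_div, norm_neg, hx, div_one]
      exact hq1
  · rw [thetaJ_eq_qInf hq2 hq21 (mul_ne_zero hq (pow_ne_zero 2 hx0))]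
    refine mul_ne_zero (mul_ne_zero (qInf_ne_zero_of_norm_lt hq21 ?_)
      (qInf_ne_zero_of_norm_lt hq21 ?_)) (qInf_self_ne_zero hq21)
    · rw [norm_mul, norm_pow x, hx, one_pow, mul_one]
      exact hq1
    · rw [show (ρ ^ 3) ^ 2 / (ρ ^ 3 * x ^ 2) = ρ ^ 3 / x ^ 2 by field_simp, norm_div, norm_pow x, hx,
        one_pow, div_one]
      exact hq1

end HesseCubic

section LogProduct

/-- The logarithm of an infinite `q`-product, as a Lambert series. -/
theorem hasSum_neg_log_qInf {a q : ℂ} (ha : ‖a‖ < 1) (hq : ‖q‖ < 1) :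
    ∃ ℓ : ℂ, HasSum (fun m : ℕ => a ^ (m + 1) / ((m + 1) * (1 - q ^ (m + 1)))) ℓ ∧
      qInf a q = Complex.exp (-ℓ) := by
  set f : ℕ × ℕ → ℂ := fun z => (a * q ^ z.1) ^ (z.2 + 1) / (z.2 + 1) with hf
  have hlt : ∀ n, ‖a * q ^ n‖ < 1 := fun n => by
    rw [norm_mul, norm_pow]
    exact mul_lt_one_of_nonneg_of_lt_one_left (norm_nonneg _) ha (pow_le_one₀ (norm_nonneg _) hq.le)
  have hsum : Summable f := by
    have hg := (summable_geometric_of_lt_one (norm_nonneg q) hq).mul_of_nonneg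
      (summable_geometric_of_lt_one (norm_nonneg a) ha) (fun _ => by positivity)
      (fun _ => by positivity)
    refine Summable.of_norm_bounded hg fun z => ?_
    have h1 : (1 : ℝ) ≤ ‖((z.2 : ℂ) + 1)‖ := by
      rw [show ((z.2 : ℂ) + 1) = ((z.2 + 1 : ℕ) : ℂ) by push_cast; rfl, Complex.norm_natCast]
      exact_mod_cast Nat.succ_pos _
    rw [hf, norm_div]
    refine (div_le_self (norm_nonneg _) h1).trans ?_
    rw [norm_pow, norm_mul, norm_pow, mul_pow, mul_comm, ← pow_mul]
    gcongr ?_ * ?_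
    · exact pow_le_pow_of_le_one (norm_nonneg _) hq.le (Nat.le_mul_of_pos_right _ (Nat.succ_pos _))
    · exact pow_le_pow_of_le_one (norm_nonneg _) ha.le (Nat.le_succ _)
  have hrow : ∀ n, HasSum (fun k => f (n, k)) (-Complex.log (1 - a * q ^ n)) := fun n => by
    simpa [hf] using (hasSum_nat_add_iff' 1).2 (Complex.hasSum_taylorSeries_neg_log (hlt n))
  have hcol : ∀ k, HasSum (fun n => f (n, k)) (a ^ (k + 1) / ((k + 1) * (1 - q ^ (k + 1)))) :=
    fun k => by
      have h := (hasSum_geometric_of_norm_lt_one (norm_pow_lt_one hq (Nat.succ_ne_zero k))).mul_left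
        (a ^ (k + 1) / (k + 1))
      rw [← div_eq_mul_inv, div_div] at h
      refine h.congr_fun fun n => ?_
      simp only [hf, mul_pow, ← pow_mul, mul_comm n, Nat.succ_eq_add_one]
      ring
  have h1 := hsum.hasSum.prod_fiberwise hrow
  have h2 := ((Equiv.prodComm ℕ ℕ).hasSum_iff.2 hsum.hasSum).prod_fiberwise
    (f := f ∘ Equiv.prodComm ℕ ℕ) hcol
  refine ⟨_, h2, ?_⟩
  have h3 : HasSum (fun n => Complex.log (1 - a * q ^ n)) (-∑' z, f z) := by
    simpa using h1.neg
  refine ((Complex.hasProd_of_hasSum_log (fun n h => ?_) h3).tprod_eq)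
  have := hlt n
  rw [← sub_eq_zero.1 h, norm_one] at this
  exact lt_irrefl _ this

end LogProduct

section ThetaUniformization

/-- The Fourier coefficients of `evenPart`. -/
noncomputable def evenCoeff (ϱ : ℝ) (m : ℕ) : ℝ :=
  (ϱ ^ (m + 1) + 2 * (ϱ ^ (m + 1)) ^ 2) / ((m + 1) * (1 + ϱ ^ (m + 1) + (ϱ ^ (m + 1)) ^ 2))

/-- The Fourier coefficients of `oddPart`. -/
noncomputable def oddCoeff (ϱ : ℝ) (m : ℕ) : ℝ :=
  ϱ ^ (m + 1) / ((m + 1) * (1 + ϱ ^ (m + 1) + (ϱ ^ (m + 1)) ^ 2))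

/-- The real part of the logarithm of a quotient of cubic theta functions on the unit circle. -/
noncomputable def evenPart (ϱ z : ℝ) : ℝ := ∑' m : ℕ, evenCoeff ϱ m * cos (2 * π * (m + 1) * z)

/-- The imaginary part of the logarithm of a quotient of cubic theta functions on the unit
circle. -/
noncomputable def oddPart (ϱ z : ℝ) : ℝ := ∑' m : ℕ, oddCoeff ϱ m * sin (2 * π * (m + 1) * z)

variable {ϱ : ℝ}

theorem abs_oddCoeff_le (ϱ : ℝ) (m : ℕ) : (m + 1) * |oddCoeff ϱ m| ≤ 2 * |ϱ| ^ (m + 1) := by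
  have h := one_add_add_sq_pos (ϱ ^ (m + 1))
  have h2 : 1 / 2 ≤ 1 + ϱ ^ (m + 1) + (ϱ ^ (m + 1)) ^ 2 := by
    nlinarith [sq_nonneg (2 * ϱ ^ (m + 1) + 1)]
  have hm : (0 : ℝ) < m + 1 := by positivity
  rw [oddCoeff, abs_div, abs_mul, abs_of_pos h, abs_of_pos hm, abs_pow,
    mul_div_assoc', mul_div_mul_left _ _ hm.ne', div_le_iff₀ h]
  nlinarith [pow_nonneg (abs_nonneg ϱ) (m + 1)]

theorem abs_evenCoeff_le (h1 : |ϱ| < 1) (m : ℕ) :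
    (m + 1) * |evenCoeff ϱ m| ≤ 6 * |ϱ| ^ (m + 1) := by
  have h : evenCoeff ϱ m = oddCoeff ϱ m * (1 + 2 * ϱ ^ (m + 1)) := by
    rw [evenCoeff, oddCoeff]
    ring
  have h3 : |1 + 2 * ϱ ^ (m + 1)| ≤ 3 := by
    have := abs_add_le 1 (2 * ϱ ^ (m + 1))
    rw [abs_one, abs_mul, abs_two, abs_pow] at this
    linarith [pow_le_one₀ (abs_nonneg ϱ) h1.le (n := m + 1)]
  rw [h, abs_mul, ← mul_assoc]
  calc _ ≤ 2 * |ϱ| ^ (m + 1) * 3 :=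
        mul_le_mul (abs_oddCoeff_le ϱ m) h3 (abs_nonneg _) (by positivity)
    _ = _ := by ring

theorem summable_pow_succ_abs (h1 : |ϱ| < 1) (C : ℝ) : Summable fun m : ℕ => C * |ϱ| ^ (m + 1) :=
  (((summable_geometric_of_lt_one (abs_nonneg ϱ) h1).mul_right |ϱ|).mul_left C)

theorem summable_succ_mul_abs_oddCoeff (h1 : |ϱ| < 1) :
    Summable fun m : ℕ => (m + 1) * |oddCoeff ϱ m| :=
  .of_nonneg_of_le (fun _ => by positivity) (abs_oddCoeff_le ϱ) (summable_pow_succ_abs h1 2)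

theorem summable_succ_mul_abs_evenCoeff (h1 : |ϱ| < 1) :
    Summable fun m : ℕ => (m + 1) * |evenCoeff ϱ m| :=
  .of_nonneg_of_le (fun _ => by positivity) (abs_evenCoeff_le h1) (summable_pow_succ_abs h1 6)

theorem summable_abs_of_succ_mul {c : ℕ → ℝ} (hc : Summable fun m : ℕ => (m + 1) * |c m|) :
    Summable fun m => |c m| :=
  .of_nonneg_of_le (fun _ => abs_nonneg _) (fun m => by
    have := mul_nonneg m.cast_nonneg (abs_nonneg (c m)) (α := ℝ)
    linarith) hc

theorem summable_mul_cos {c : ℕ → ℝ} (hc : Summable fun m => |c m|) (z : ℝ) :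
    Summable fun m : ℕ => c m * cos (2 * π * (m + 1) * z) :=
  .of_norm_bounded hc fun m => by
    rw [norm_mul]
    exact mul_le_of_le_one_right (abs_nonneg _) (abs_cos_le_one _)

theorem summable_mul_sin {c : ℕ → ℝ} (hc : Summable fun m => |c m|) (z : ℝ) :
    Summable fun m : ℕ => c m * sin (2 * π * (m + 1) * z) :=
  .of_norm_bounded hc fun m => by
    rw [norm_mul]
    exact mul_le_of_le_one_right (abs_nonneg _) (abs_sin_le_one _)

theorem continuous_tsum_cos {c : ℕ → ℝ} (hc : Summable fun m => |c m|) :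
    Continuous fun z => ∑' m : ℕ, c m * cos (2 * π * (m + 1) * z) :=
  continuous_tsum (fun m => by fun_prop) hc fun m z => by
    rw [norm_mul]
    exact mul_le_of_le_one_right (abs_nonneg _) (abs_cos_le_one _)

theorem continuous_tsum_sin {c : ℕ → ℝ} (hc : Summable fun m => |c m|) :
    Continuous fun z => ∑' m : ℕ, c m * sin (2 * π * (m + 1) * z) :=
  continuous_tsum (fun m => by fun_prop) hc fun m z => by
    rw [norm_mul]
    exact mul_le_of_le_one_right (abs_nonneg _) (abs_sin_le_one _)

theorem hasDerivAt_tsum_cos {c : ℕ → ℝ} (hc : Summable fun m : ℕ => (m + 1) * |c m|) (z : ℝ) :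
    HasDerivAt (fun z => ∑' m : ℕ, c m * cos (2 * π * (m + 1) * z))
      (∑' m : ℕ, (-(2 * π * (m + 1) * c m)) * sin (2 * π * (m + 1) * z)) z := by
  refine hasDerivAt_tsum (g := fun (m : ℕ) z => c m * cos (2 * π * (m + 1) * z))
    (g' := fun (m : ℕ) z => -(2 * π * (m + 1) * c m) * sin (2 * π * (m + 1) * z))
    (hc.mul_left (2 * π)) (fun m y => ?_) (fun m y => ?_) (y₀ := 0) (summable_mul_cos (summable_abs_of_succ_mul hc) 0) z
  · exact (((hasDerivAt_id' y).const_mul (2 * π * (m + 1))).cos.const_mul (c m)).congr_deriv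
      (by ring)
  · rw [norm_mul, norm_neg, norm_mul, Real.norm_of_nonneg (by positivity : 0 ≤ 2 * π * (m + 1)),
      ← mul_assoc]
    exact mul_le_of_le_one_right (by positivity) (abs_sin_le_one _)

theorem hasDerivAt_tsum_sin {c : ℕ → ℝ} (hc : Summable fun m : ℕ => (m + 1) * |c m|) (z : ℝ) :
    HasDerivAt (fun z => ∑' m : ℕ, c m * sin (2 * π * (m + 1) * z))
      (∑' m : ℕ, (2 * π * (m + 1) * c m) * cos (2 * π * (m + 1) * z)) z := by
  refine hasDerivAt_tsum (g := fun (m : ℕ) z => c m * sin (2 * π * (m + 1) * z))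
    (g' := fun (m : ℕ) z => 2 * π * (m + 1) * c m * cos (2 * π * (m + 1) * z))
    (hc.mul_left (2 * π)) (fun m y => ?_) (fun m y => ?_) (y₀ := 0) (summable_mul_sin (summable_abs_of_succ_mul hc) 0) z
  · exact (((hasDerivAt_id' y).const_mul (2 * π * (m + 1))).sin.const_mul (c m)).congr_deriv
      (by ring)
  · rw [norm_mul, norm_mul, Real.norm_of_nonneg (by positivity : 0 ≤ 2 * π * (m + 1)),
      ← mul_assoc]
    exact mul_le_of_le_one_right (by positivity) (abs_cos_le_one _)

/-- The unit circle point with argument `2πz`. -/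
noncomputable def unitPoint (z : ℝ) : ℂ := Complex.exp (2 * π * z * Complex.I)

theorem norm_unitPoint (z : ℝ) : ‖unitPoint z‖ = 1 := by
  rw [unitPoint, show (2 * π * z * Complex.I : ℂ) = ((2 * π * z : ℝ) : ℂ) * Complex.I by push_cast; ring,
    Complex.norm_exp_ofReal_mul_I]

theorem unitPoint_ne_zero (z : ℝ) : unitPoint z ≠ 0 := Complex.exp_ne_zero _

theorem unitPoint_neg (z : ℝ) : unitPoint (-z) = (unitPoint z)⁻¹ := by
  rw [unitPoint, unitPoint, ← Complex.exp_neg]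
  congr 1
  push_cast
  ring

theorem unitPoint_pow (z : ℝ) (m : ℕ) : unitPoint z ^ (m + 1) =
    (cos (2 * π * (m + 1) * z) : ℝ) + (sin (2 * π * (m + 1) * z) : ℝ) * Complex.I := by
  rw [unitPoint, ← Complex.exp_nat_mul, Complex.ofReal_cos, Complex.ofReal_sin, ← Complex.exp_mul_I]
  congr 1
  push_cast
  ring

theorem evenPart_neg (ϱ z : ℝ) : evenPart ϱ (-z) = evenPart ϱ z :=
  tsum_congr fun m => by rw [mul_neg, cos_neg]

theorem oddPart_neg (ϱ z : ℝ) : oddPart ϱ (-z) = -oddPart ϱ z := by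
  rw [oddPart, oddPart, ← tsum_neg]
  exact tsum_congr fun m => by rw [mul_neg, sin_neg, mul_neg]

theorem log_combination (hϱ : |ϱ| < 1) (z : ℝ) {l₁ l₂ l₃ l₄ : ℂ}
    (h₁ : HasSum (fun m : ℕ => ((ϱ : ℂ) * unitPoint z) ^ (m + 1) /
      ((m + 1) * (1 - ((ϱ : ℂ) ^ 3) ^ (m + 1)))) l₁)
    (h₂ : HasSum (fun m : ℕ => ((ϱ : ℂ) ^ 2 * (unitPoint z)⁻¹) ^ (m + 1) /
      ((m + 1) * (1 - ((ϱ : ℂ) ^ 3) ^ (m + 1)))) l₂)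
    (h₃ : HasSum (fun m : ℕ => ((ϱ : ℂ) ^ 3 * unitPoint z) ^ (m + 1) /
      ((m + 1) * (1 - ((ϱ : ℂ) ^ 3) ^ (m + 1)))) l₃)
    (h₄ : HasSum (fun m : ℕ => ((ϱ : ℂ) ^ 3 * (unitPoint z)⁻¹) ^ (m + 1) /
      ((m + 1) * (1 - ((ϱ : ℂ) ^ 3) ^ (m + 1)))) l₄) :
    l₁ + l₂ - l₃ - l₄ = evenPart ϱ z + oddPart ϱ z * Complex.I := by
  have he := Complex.hasSum_ofReal.2
    (summable_mul_cos (summable_abs_of_succ_mul (summable_succ_mul_abs_evenCoeff hϱ)) z).hasSum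
  have ho := (Complex.hasSum_ofReal.2 (summable_mul_sin
    (summable_abs_of_succ_mul (summable_succ_mul_abs_oddCoeff hϱ)) z).hasSum).mul_right Complex.I
  refine (((h₁.add h₂).sub h₃).sub h₄).unique ((he.add ho).congr_fun fun m => ?_)
  have hp : |ϱ ^ (m + 1)| < 1 := by
    rw [abs_pow]
    exact pow_lt_one₀ (abs_nonneg _) hϱ (Nat.succ_ne_zero m)
  have e1 : (1 : ℂ) - ((ϱ : ℂ) ^ 3) ^ (m + 1) =
      (1 - (ϱ ^ (m + 1) : ℝ)) * (1 + (ϱ ^ (m + 1) : ℝ) + (ϱ ^ (m + 1) : ℝ) ^ 2) := by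
    push_cast
    rw [← pow_mul, mul_comm 3, pow_mul]
    ring
  have e2 : (1 : ℂ) - (ϱ ^ (m + 1) : ℝ) ≠ 0 := by
    rw [← Complex.ofReal_one, ← Complex.ofReal_sub, Complex.ofReal_ne_zero]
    linarith [(abs_lt.1 hp).2]
  have e3 : (1 : ℂ) + (ϱ ^ (m + 1) : ℝ) + (ϱ ^ (m + 1) : ℝ) ^ 2 ≠ 0 := by
    exact_mod_cast (one_add_add_sq_pos (ϱ ^ (m + 1))).ne'
  have e4 : (m : ℂ) + 1 ≠ 0 := Nat.cast_add_one_ne_zero m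
  have e5 : ∀ k : ℕ, ((ϱ : ℂ) ^ k) ^ (m + 1) = ((ϱ ^ (m + 1) : ℝ) : ℂ) ^ k := fun k => by
    push_cast
    rw [← pow_mul, ← pow_mul, mul_comm]
  have e6 := e5 1
  rw [pow_one, pow_one] at e6
  have hx := unitPoint_pow z m
  have hx' := unitPoint_pow (-z) m
  rw [unitPoint_neg, mul_neg, sin_neg, cos_neg] at hx'
  simp only [mul_pow, evenCoeff, oddCoeff]
  rw [hx, hx', e1, e5, e5, e6]
  generalize cos (2 * π * (m + 1) * z) = c, sin (2 * π * (m + 1) * z) = s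
  clear hx hx' e5 e6 e1 hp he ho h₁ h₂ h₃ h₄
  generalize ϱ ^ (m + 1) = p at *
  push_cast
  field_simp
  ring

/-- The cubic theta quotient on the unit circle in polar form. -/
theorem thetaJ_unitPoint (h0 : ϱ ≠ 0) (hϱ : |ϱ| < 1) (z : ℝ) :
    thetaJ ((ϱ : ℂ) ^ 3) (unitPoint z) = (1 - unitPoint z) *
      (Complex.exp (evenPart ϱ z + oddPart ϱ z * Complex.I) *
        thetaJ ((ϱ : ℂ) ^ 3) (ϱ * unitPoint z)) := by
  have h0' : (ϱ : ℂ) ≠ 0 := Complex.ofReal_ne_zero.2 h0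
  have hn : ‖(ϱ : ℂ)‖ < 1 := by rwa [Complex.norm_real]
  have hx := unitPoint_ne_zero z
  have hq := pow_ne_zero 3 h0'
  have hq1 := norm_pow_lt_one hn three_ne_zero
  have hu : ∀ k ≠ 0, ‖(ϱ : ℂ) ^ k * unitPoint z‖ < 1 := fun k hk => by
    rw [norm_mul, norm_unitPoint, mul_one]
    exact norm_pow_lt_one hn hk
  have hu' : ∀ k ≠ 0, ‖(ϱ : ℂ) ^ k * (unitPoint z)⁻¹‖ < 1 := fun k hk => by
    rw [norm_mul, norm_inv, norm_unitPoint, inv_one, mul_one]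
    exact norm_pow_lt_one hn hk
  obtain ⟨l₁, h₁, e₁⟩ := hasSum_neg_log_qInf (hu 1 one_ne_zero) hq1
  obtain ⟨l₂, h₂, e₂⟩ := hasSum_neg_log_qInf (hu' 2 two_ne_zero) hq1
  obtain ⟨l₃, h₃, e₃⟩ := hasSum_neg_log_qInf (hu 3 three_ne_zero) hq1
  obtain ⟨l₄, h₄, e₄⟩ := hasSum_neg_log_qInf (hu' 3 three_ne_zero) hq1
  rw [pow_one] at h₁ e₁
  rw [thetaJ_eq_qInf hq hq1 hx, thetaJ_eq_qInf hq hq1 (mul_ne_zero h0' hx), qInf_eq_one_sub_mul hq1,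
    ← log_combination hϱ z h₁ h₂ h₃ h₄, mul_comm (unitPoint z), e₃, div_eq_mul_inv, e₄, e₁,
    show (ϱ : ℂ) ^ 3 / (ϱ * unitPoint z) = ϱ ^ 2 * (unitPoint z)⁻¹ by field_simp, e₂]
  rw [mul_assoc (1 - unitPoint z), mul_assoc (1 - unitPoint z), ← mul_assoc (Complex.exp _),
    ← Complex.exp_add, ← Complex.exp_add, ← Complex.exp_add]
  ring_nf

theorem thetaJ_unitPoint' (h0 : ϱ ≠ 0) (hϱ : |ϱ| < 1) (z : ℝ) :
    thetaJ ((ϱ : ℂ) ^ 3) (unitPoint z) = (1 - unitPoint z) *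
      (Complex.exp (evenPart ϱ z - oddPart ϱ z * Complex.I) *
        thetaJ ((ϱ : ℂ) ^ 3) (ϱ ^ 2 * unitPoint z)) := by
  have h0' : (ϱ : ℂ) ≠ 0 := Complex.ofReal_ne_zero.2 h0
  have h := thetaJ_unitPoint h0 hϱ (-z)
  have hx := unitPoint_ne_zero z
  rw [unitPoint_neg, thetaJ_inv (pow_ne_zero 3 h0') hx, ← thetaJ_cube_sq_mul h0' hx, evenPart_neg,
    oddPart_neg, Complex.ofReal_neg, neg_mul, neg_mul, ← sub_eq_add_neg] at h
  generalize unitPoint z = x at *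
  generalize thetaJ ((ϱ : ℂ) ^ 3) x = J₀, thetaJ ((ϱ : ℂ) ^ 3) (ϱ ^ 2 * x) = J₂,
    Complex.exp (evenPart ϱ z - oddPart ϱ z * Complex.I) = e at *
  field_simp at h
  linear_combination -h

end ThetaUniformization

section HesseParametrization

theorem abs_neg_nome_lt_one : |-nome| < 1 := by
  rw [abs_neg, abs_of_pos nome_pos]
  exact nome_lt_one

theorem neg_nome_ne_zero : -nome ≠ 0 := neg_ne_zero.2 nome_pos.ne'

/-- The angular coordinate of the parametrization of the Hesse cubic. -/
noncomputable def hesseAngle (z : ℝ) : ℝ := π * z + 3 * oddPart (-nome) z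

/-- The radial coordinate of the parametrization of the Hesse cubic. -/
noncomputable def hesseRadius (z : ℝ) : ℝ :=
  2 * rexp (-(π / √15) / 3) * sin (π * z) * rexp (evenPart (-nome) z)

theorem hesseAngle_zero : hesseAngle 0 = 0 := by
  simp [hesseAngle, oddPart]

theorem hesseRadius_zero : hesseRadius 0 = 0 := by
  simp [hesseRadius]

theorem oddPart_half (ϱ : ℝ) : oddPart ϱ (1 / 2) = 0 := by
  rw [oddPart, ← tsum_zero (α := ℝ) (β := ℕ)]
  refine tsum_congr fun m => ?_
  rw [show 2 * π * ((m : ℝ) + 1) * (1 / 2) = ((m + 1 : ℕ) : ℝ) * π by push_cast; ring, sin_nat_mul_pi,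
    mul_zero]

theorem hesseAngle_half : hesseAngle (1 / 2) = π / 2 := by
  rw [hesseAngle, oddPart_half]
  ring

theorem hesseRadius_pos {z : ℝ} (hz : 0 < z) (hz1 : z < 1) : 0 < hesseRadius z := by
  have : 0 < sin (π * z) := sin_pos_of_pos_of_lt_pi (by positivity) (by nlinarith [pi_pos])
  rw [hesseRadius]
  positivity

theorem unitPoint_half : unitPoint (1 / 2) = -1 := by
  rw [unitPoint, ← Complex.exp_pi_mul_I]
  congr 1
  push_cast
  ring

theorem exp_evenPart_half {ϱ : ℝ} (h0 : ϱ ≠ 0) (hϱ : |ϱ| < 1) :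
    rexp (evenPart ϱ (1 / 2)) * qInf (-ϱ) ϱ = qInf (-ϱ ^ 3) (ϱ ^ 3) ^ 3 := by
  have h0' : (ϱ : ℂ) ≠ 0 := Complex.ofReal_ne_zero.2 h0
  have hn : ‖(ϱ : ℂ)‖ < 1 := by rwa [Complex.norm_real]
  have hq := pow_ne_zero 3 h0'
  have hq1 := norm_pow_lt_one hn three_ne_zero
  have h := thetaJ_unitPoint h0 hϱ (1 / 2)
  rw [unitPoint_half, oddPart_half, thetaJ_neg_one hq hq1, Complex.ofReal_zero, zero_mul, add_zero,
    thetaJ_eq_qInf hq hq1 (mul_ne_zero h0' (neg_ne_zero.2 one_ne_zero)),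
    show (ϱ : ℂ) ^ 3 / (ϱ * -1) = -ϱ ^ 2 by field_simp, mul_neg_one] at h
  have h2 := qInf_eq_prod_pow hn (-(ϱ : ℂ)) three_ne_zero
  simp only [Finset.prod_range_succ, Finset.prod_range_zero, pow_zero, one_mul, mul_one,
    pow_one] at h2
  rw [show -(ϱ : ℂ) * ϱ = -ϱ ^ 2 by ring, show -(ϱ : ℂ) * ϱ ^ 2 = -ϱ ^ 3 by ring] at h2
  have h3 := qInf_self_ne_zero hq1
  have e1 : ((qInf (-ϱ) ϱ : ℝ) : ℂ) = qInf (-(ϱ : ℂ)) ϱ := by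
    rw [ofReal_qInf hϱ, Complex.ofReal_neg]
  have e2 : ((qInf (-ϱ ^ 3) (ϱ ^ 3) : ℝ) : ℂ) = qInf (-(ϱ : ℂ) ^ 3) (ϱ ^ 3) := by
    rw [ofReal_qInf (norm_pow_lt_one hϱ three_ne_zero), Complex.ofReal_neg, Complex.ofReal_pow]
  apply Complex.ofReal_injective
  rw [Complex.ofReal_mul, Complex.ofReal_pow, e1, e2, h2, Complex.ofReal_exp]
  have h4 : (2 * qInf ((ϱ : ℂ) ^ 3) (ϱ ^ 3)) ≠ 0 := mul_ne_zero two_ne_zero h3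
  apply mul_left_cancel₀ h4
  linear_combination (-qInf (-(ϱ : ℂ) ^ 3) (ϱ ^ 3)) * h

theorem hesseRadius_half : hesseRadius (1 / 2) = ((1 + √5) / 2) ^ ((4 : ℝ) / 3) := by
  have hn : ‖-nome‖ < 1 := abs_neg_nome_lt_one
  have h := exp_evenPart_half neg_nome_ne_zero abs_neg_nome_lt_one
  have h1 := qInf_neg_mul_qInf_sq hn
  have h2 := qInf_neg_mul_qInf_sq (norm_pow_lt_one hn three_ne_zero)
  have e : rexp (-(3 * (π / √15))) = nome ^ 3 := by
    rw [nome, ← Real.exp_nat_mul]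
    congr 1
    push_cast
    ring
  rw [← singular_value, e, ← nome, hesseRadius, mul_one_div, sin_pi_div_two, mul_one, mul_div_assoc]
  congr 1
  rw [neg_sq] at h1
  rw [show (-nome) ^ 3 = -nome ^ 3 by ring, neg_sq] at h2
  rw [show (-nome) ^ 3 = -nome ^ 3 by ring] at h
  have h3 := right_ne_zero_of_mul_eq_one h2
  rw [eq_div_iff (pow_ne_zero 3 h3)]
  linear_combination qInf (-nome) (nome ^ 2) * qInf (-nome ^ 3) ((nome ^ 3) ^ 2) ^ 3 * h -
    rexp (evenPart (-nome) (1 / 2)) * qInf (-nome ^ 3) ((nome ^ 3) ^ 2) ^ 3 * h1 + 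
    qInf (-nome) (nome ^ 2) * ((qInf (-(-nome ^ 3)) (-nome ^ 3) *
      qInf (-nome ^ 3) ((nome ^ 3) ^ 2)) ^ 2 + qInf (-(-nome ^ 3)) (-nome ^ 3) *
      qInf (-nome ^ 3) ((nome ^ 3) ^ 2) + 1) * h2

theorem unitPoint_eq_sq (z : ℝ) : unitPoint z = Complex.exp (π * z * Complex.I) ^ 2 := by
  rw [unitPoint, ← Complex.exp_nat_mul]
  congr 1
  push_cast
  ring

theorem one_sub_unitPoint (z : ℝ) : 1 - unitPoint z =
    -2 * Complex.I * (sin (π * z) : ℝ) * Complex.exp (π * z * Complex.I) := by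
  rw [unitPoint_eq_sq, Complex.exp_mul_I, Complex.ofReal_sin, Complex.ofReal_mul]
  have h1 := Complex.sin_sq_add_cos_sq (π * z)
  generalize Complex.sin (π * z) = s, Complex.cos (π * z) = c at *
  linear_combination -h1 + s ^ 2 * Complex.I_sq

theorem thetaJ_mul_unitPoint_ne_zero {ϱ : ℝ} (h0 : ϱ ≠ 0) (hϱ : |ϱ| < 1) (z : ℝ) :
    thetaJ ((ϱ : ℂ) ^ 3) (ϱ * unitPoint z) ≠ 0 := by
  have h0' : (ϱ : ℂ) ≠ 0 := Complex.ofReal_ne_zero.2 h0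
  have hn : ‖(ϱ : ℂ)‖ < 1 := by rwa [Complex.norm_real]
  have hx := unitPoint_ne_zero z
  have hq1 := norm_pow_lt_one hn three_ne_zero
  rw [thetaJ_eq_qInf (pow_ne_zero 3 h0') hq1 (mul_ne_zero h0' hx)]
  refine mul_ne_zero (mul_ne_zero (qInf_ne_zero_of_norm_lt hq1 ?_) (qInf_ne_zero_of_norm_lt hq1 ?_))
    (qInf_self_ne_zero hq1)
  · rwa [norm_mul, norm_unitPoint, mul_one]
  · rw [show (ϱ : ℂ) ^ 3 / (ϱ * unitPoint z) = ϱ ^ 2 / unitPoint z by field_simp, norm_div,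
      norm_unitPoint, div_one]
    exact norm_pow_lt_one hn two_ne_zero

theorem thetaJ_sq_mul_unitPoint {ϱ : ℝ} (h0 : ϱ ≠ 0) (hϱ : |ϱ| < 1) {z : ℝ}
    (hz : sin (π * z) ≠ 0) : thetaJ ((ϱ : ℂ) ^ 3) (ϱ ^ 2 * unitPoint z) =
      Complex.exp (oddPart ϱ z * Complex.I) ^ 2 * thetaJ ((ϱ : ℂ) ^ 3) (ϱ * unitPoint z) := by
  have h1 := thetaJ_unitPoint h0 hϱ z
  rw [thetaJ_unitPoint' h0 hϱ z, Complex.exp_add, Complex.exp_sub, one_sub_unitPoint] at h1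
  have h2 := mul_left_cancel₀ (mul_ne_zero (mul_ne_zero (mul_ne_zero (neg_ne_zero.2 two_ne_zero)
    Complex.I_ne_zero) (Complex.ofReal_ne_zero.2 hz)) (Complex.exp_ne_zero _)) h1
  have h3 := Complex.exp_ne_zero (evenPart ϱ z)
  have h4 := Complex.exp_ne_zero (oddPart ϱ z * Complex.I)
  rw [div_mul_eq_mul_div, div_eq_iff h4, mul_assoc, mul_assoc] at h2
  have h5 := mul_left_cancel₀ h3 h2
  rw [h5]
  ring

theorem two_I_mul_sin (a : ℝ) : 2 * Complex.I * (sin a : ℝ) =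
    Complex.exp (a * Complex.I) - (Complex.exp (a * Complex.I))⁻¹ := by
  rw [← Complex.exp_neg, Complex.ofReal_sin, Complex.sin, neg_mul]
  linear_combination (Complex.exp (-(a * Complex.I)) - Complex.exp (a * Complex.I)) * Complex.I_sq

theorem two_mul_cos (a : ℝ) : 2 * ((cos a : ℝ) : ℂ) =
    Complex.exp (a * Complex.I) + (Complex.exp (a * Complex.I))⁻¹ := by
  rw [← Complex.exp_neg, Complex.ofReal_cos, Complex.cos, neg_mul]
  ring

theorem exp_hesseAngle (z : ℝ) : Complex.exp (hesseAngle z * Complex.I) =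
    Complex.exp (π * z * Complex.I) * Complex.exp (oddPart (-nome) z * Complex.I) ^ 3 := by
  rw [hesseAngle, ← Complex.exp_nat_mul, ← Complex.exp_add]
  congr 1
  push_cast
  ring

theorem exists_hesse_real : ∃ c : ℂ, ∀ z, 0 < z → z < 1 →
    ((hesseRadius z : ℝ) : ℂ) ^ 3 - 2 * (sin (hesseAngle z) : ℝ) = c * hesseRadius z := by
  have h0' : ((-nome : ℝ) : ℂ) ≠ 0 := Complex.ofReal_ne_zero.2 neg_nome_ne_zero
  have hn : ‖((-nome : ℝ) : ℂ)‖ < 1 := by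
    rw [Complex.norm_real]
    exact abs_neg_nome_lt_one
  obtain ⟨C, hC⟩ := exists_hesse h0' hn
  refine ⟨-C * (rexp (-(π / √15) / 3) : ℝ) ^ 2, fun z hz hz1 => ?_⟩
  have hs : sin (π * z) ≠ 0 :=
    (sin_pos_of_pos_of_lt_pi (by positivity) (by nlinarith [pi_pos])).ne'
  have h := hC _ (unitPoint_ne_zero z)
  have hu : (((-nome : ℝ) : ℂ)) = -((rexp (-(π / √15) / 3) : ℝ) : ℂ) ^ 3 := by
    rw [nome, ← Complex.ofReal_pow, ← Real.exp_nat_mul, ← Complex.ofReal_neg]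
    congr 3
    push_cast
    ring
  rw [thetaJ_sq_mul_unitPoint neg_nome_ne_zero abs_neg_nome_lt_one hs,
    thetaJ_unitPoint neg_nome_ne_zero abs_neg_nome_lt_one z, one_sub_unitPoint, Complex.exp_add] at h
  have hJ := thetaJ_mul_unitPoint_ne_zero neg_nome_ne_zero abs_neg_nome_lt_one z
  have hsin := two_I_mul_sin (hesseAngle z)
  rw [exp_hesseAngle] at hsin
  have hw := Complex.exp_ne_zero (π * z * Complex.I)
  have hg := Complex.exp_ne_zero (oddPart (-nome) z * Complex.I)
  have hr : ((rexp (-(π / √15) / 3) : ℝ) : ℂ) ≠ 0 := Complex.ofReal_ne_zero.2 (Real.exp_ne_zero _)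
  generalize thetaJ (((-nome : ℝ) : ℂ) ^ 3) ((-nome : ℝ) * unitPoint z) = J at h hJ
  rw [unitPoint_eq_sq, hu] at h
  rw [hesseRadius]
  push_cast at h hsin hr ⊢
  generalize Complex.exp (π * z * Complex.I) = w, Complex.exp (oddPart (-nome) z * Complex.I) = g,
    Complex.exp (evenPart (-nome) z) = a, Complex.sin (π * z) = σ,
    Complex.exp (-(π / (√15 : ℝ)) / 3) = u, Complex.sin (hesseAngle z) = τ at *
  have h5 : w ^ 2 * g ^ 6 - 1 = 2 * Complex.I * τ * (w * g ^ 3) := by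
    rw [hsin]
    field_simp
  field_simp at h
  have hI := Complex.I_sq
  have hI3 : Complex.I ^ 3 = -Complex.I := by rw [pow_succ, hI]; ring
  have hk : Complex.I * w * g ^ 3 ≠ 0 :=
    mul_ne_zero (mul_ne_zero Complex.I_ne_zero hw) (pow_ne_zero 3 hg)
  apply mul_left_cancel₀ hk
  linear_combination h + h5 + 8 * σ ^ 3 * w * a ^ 3 * g ^ 3 * u ^ 3 * hI3

theorem golden_rpow_four_thirds_pow : (((1 + √5) / 2 : ℝ) ^ ((4 : ℝ) / 3)) ^ 3 =
    3 * ((1 + √5) / 2) + 2 := by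
  have h5 : √5 ^ 2 = 5 := Real.sq_sqrt (by norm_num)
  rw [← Real.rpow_natCast, ← Real.rpow_mul (by positivity)]
  norm_num
  linear_combination (√5 ^ 2 / 16 + √5 / 4 + 11 / 16) * h5

theorem golden_rpow_mul : ((1 + √5) / 2 : ℝ) ^ (-((1 : ℝ) / 3)) * ((1 + √5) / 2) ^ ((4 : ℝ) / 3) =
    (1 + √5) / 2 := by
  rw [← Real.rpow_add (by positivity)]
  norm_num

/-- The parametrization of the real points of the Hesse cubic. -/
theorem hesseRadius_cube {z : ℝ} (hz : 0 ≤ z) (hz1 : z < 1) :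
    (3 * ((1 + √5) / 2) ^ (-((1 : ℝ) / 3)) * hesseRadius z - hesseRadius z ^ 3) / 2 =
      -sin (hesseAngle z) := by
  obtain ⟨c, hc⟩ := exists_hesse_real
  have h := hc (1 / 2) (by norm_num) (by norm_num)
  have hS : 0 < ((1 + √5) / 2 : ℝ) ^ ((4 : ℝ) / 3) := by positivity
  have h1 : c = ((3 * ((1 + √5) / 2) ^ (-((1 : ℝ) / 3)) : ℝ) : ℂ) := by
    rw [hesseRadius_half, hesseAngle_half, sin_pi_div_two, ← Complex.ofReal_pow,
      golden_rpow_four_thirds_pow] at h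
    apply mul_right_cancel₀ (Complex.ofReal_ne_zero.2 hS.ne')
    rw [← h, ← Complex.ofReal_mul, mul_assoc, golden_rpow_mul]
    push_cast
    ring
  rcases hz.eq_or_lt with rfl | hz0
  · rw [hesseRadius_zero, hesseAngle_zero, sin_zero]
    ring
  · have h2 := hc z hz0 hz1
    rw [h1] at h2
    have h3 : hesseRadius z ^ 3 - 2 * sin (hesseAngle z) =
        3 * ((1 + √5) / 2) ^ (-((1 : ℝ) / 3)) * hesseRadius z := by exact_mod_cast h2
    linear_combination -h3 / 2

theorem cos_hesseAngle_ne_zero {z : ℝ} (hz : 0 ≤ z) (hz1 : z < 1 / 2) : cos (hesseAngle z) ≠ 0 := by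
  rcases hz.eq_or_lt with rfl | hz0
  · rw [hesseAngle_zero, cos_zero]
    exact one_ne_zero
  have h0' : ((-nome : ℝ) : ℂ) ≠ 0 := Complex.ofReal_ne_zero.2 neg_nome_ne_zero
  have hn : ‖((-nome : ℝ) : ℂ)‖ < 1 := by
    rw [Complex.norm_real]
    exact abs_neg_nome_lt_one
  have hs : 0 < sin (π * z) := sin_pos_of_pos_of_lt_pi (by positivity) (by nlinarith [pi_pos])
  have hc : 0 < cos (π * z) := cos_pos_of_mem_Ioo ⟨by nlinarith [pi_pos], by nlinarith [pi_pos]⟩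
  have hx : unitPoint z ≠ -1 := fun h => by
    have h1 := unitPoint_pow z 0
    rw [zero_add, pow_one, h] at h1
    have h2 := congrArg Complex.im h1
    simp only [Complex.neg_im, Complex.one_im, neg_zero, Complex.add_im, Complex.ofReal_im,
      Complex.mul_im, Complex.ofReal_re, Complex.I_im, Complex.I_re, mul_one, mul_zero, zero_add,
      add_zero] at h2
    rw [Nat.cast_zero, zero_add, mul_one, mul_assoc, sin_two_mul] at h2
    exact (by positivity : 2 * sin (π * z) * cos (π * z) ≠ 0) h2.symm
  have h := cubic_sum_ne_zero h0' hn (norm_unitPoint z) hx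
  rw [thetaJ_sq_mul_unitPoint neg_nome_ne_zero abs_neg_nome_lt_one hs.ne', unitPoint_eq_sq] at h
  intro h0
  have h2 := two_mul_cos (hesseAngle z)
  rw [exp_hesseAngle, h0, Complex.ofReal_zero, mul_zero] at h2
  apply h
  have hw := Complex.exp_ne_zero (π * z * Complex.I)
  have hg := Complex.exp_ne_zero (oddPart (-nome) z * Complex.I)
  generalize thetaJ (((-nome : ℝ) : ℂ) ^ 3) ((-nome : ℝ) * Complex.exp (π * z * Complex.I) ^ 2) = J
  generalize Complex.exp (π * z * Complex.I) = w, Complex.exp (oddPart (-nome) z * Complex.I) = g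
    at *
  field_simp at h2
  linear_combination -J ^ 3 * h2

theorem continuous_oddPart {ϱ : ℝ} (hϱ : |ϱ| < 1) : Continuous (oddPart ϱ) :=
  continuous_tsum_sin (summable_abs_of_succ_mul (summable_succ_mul_abs_oddCoeff hϱ))

theorem continuous_hesseAngle : Continuous hesseAngle := by
  have := continuous_oddPart abs_neg_nome_lt_one
  unfold hesseAngle
  fun_prop

theorem abs_hesseAngle_lt {z : ℝ} (hz : 0 ≤ z) (hz1 : z < 1 / 2) :
    |hesseAngle z| < π / 2 := by
  by_contra! h
  have hc : ContinuousOn (fun y => |hesseAngle y|) (Set.Icc 0 z) :=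
    continuous_hesseAngle.abs.continuousOn
  obtain ⟨y, hy, hy2⟩ := intermediate_value_Icc hz hc
    (show π / 2 ∈ Set.Icc |hesseAngle 0| |hesseAngle z| by
      rw [hesseAngle_zero, abs_zero]
      exact ⟨by positivity, h⟩)
  apply cos_hesseAngle_ne_zero hy.1 (hy.2.trans_lt hz1)
  rw [← cos_abs, show |hesseAngle y| = π / 2 from hy2, cos_pi_div_two]

theorem arcsin_hesseRadius {z : ℝ} (hz : 0 ≤ z) (hz1 : z ≤ 1 / 2) :
    arcsin ((3 * ((1 + √5) / 2) ^ (-((1 : ℝ) / 3)) * hesseRadius z - hesseRadius z ^ 3) / 2) =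
      -hesseAngle z := by
  rw [hesseRadius_cube hz (by linarith), ← sin_neg]
  have h : |hesseAngle z| ≤ π / 2 := by
    rcases hz1.eq_or_lt with rfl | h1
    · rw [hesseAngle_half, abs_of_pos (by positivity)]
    · exact (abs_hesseAngle_lt hz h1).le
  rw [abs_le] at h
  exact arcsin_sin (by linarith) (by linarith)

end HesseParametrization

section DslopeIntegral

theorem continuous_dslope_zero {B : ℝ → ℝ} (hB : Continuous B) (hd : DifferentiableAt ℝ B 0) :
    Continuous (dslope B 0) := by
  rw [← continuousOn_univ, continuousOn_dslope univ_mem]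
  exact ⟨hB.continuousOn, hd⟩

theorem dslope_zero_of_ne {B : ℝ → ℝ} (h0 : B 0 = 0) {s : ℝ} (hs : s ≠ 0) :
    dslope B 0 s = B s / s := by
  rw [dslope_of_ne _ hs, slope_def_field, h0, sub_zero, sub_zero]

/-- Integration by parts for `B s / s` along a parametrization of the graph of `B`. -/
theorem integral_dslope_of_parametrization {B s s' θ θ' : ℝ → ℝ} {b : ℝ} (hb : 0 < b)
    (hB : Continuous B) (hd : DifferentiableAt ℝ B 0) (hB0 : B 0 = 0)
    (hs : ∀ z, HasDerivAt s (s' z) z) (hs' : Continuous s') (hs0 : s 0 = 0)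
    (hpos : ∀ z, 0 < z → z ≤ b → 0 < s z) (hθ : ∀ z, HasDerivAt θ (θ' z) z) (hθ' : Continuous θ')
    (hBθ : ∀ z, 0 ≤ z → z ≤ b → B (s z) = θ z)
    (hintg : IntervalIntegrable (fun z => log (s z)) MeasureTheory.volume 0 b) :
    ∫ u in (0)..(s b), dslope B 0 u = θ b * log (s b) - ∫ z in (0)..b, θ' z * log (s z) := by
  have hg := continuous_dslope_zero hB hd
  have hsc : Continuous s := continuous_iff_continuousAt.2 fun z => (hs z).continuousAt
  have h1 : ∫ z in (0)..b, dslope B 0 (s z) * s' z = ∫ u in (0)..(s b), dslope B 0 u := by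
    have h := intervalIntegral.integral_comp_mul_deriv (a := 0) (b := b) (fun z _ => hs z)
      hs'.continuousOn hg
    rwa [hs0] at h
  have hi1 : IntervalIntegrable (fun z => θ' z * log (s z)) MeasureTheory.volume 0 b :=
    hintg.continuousOn_mul hθ'.continuousOn
  have hi2 : IntervalIntegrable (fun z => dslope B 0 (s z) * s' z) MeasureTheory.volume 0 b :=
    ((hg.comp hsc).mul hs').intervalIntegrable _ _
  have h2 : ∫ z in (0)..b, (θ' z * log (s z) + dslope B 0 (s z) * s' z) =
      dslope B 0 (s b) * (s b * log (s b)) - dslope B 0 (s 0) * (s 0 * log (s 0)) := by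
    refine intervalIntegral.integral_eq_sub_of_hasDerivAt_of_le hb.le
      (f := fun z => dslope B 0 (s z) * (s z * log (s z))) ?_ (fun z hz => ?_) (hi1.add hi2)
    · exact ((hg.comp hsc).mul (continuous_mul_log.comp hsc)).continuousOn
    · have hz0 := hpos z hz.1 hz.2.le
      have hder := (hθ z).mul ((hs z).log hz0.ne')
      refine (hder.congr_of_eventuallyEq ?_).congr_deriv ?_
      · filter_upwards [Ioo_mem_nhds hz.1 hz.2] with y hy
        have hy0 := hpos y hy.1 hy.2.le
        rw [dslope_zero_of_ne hB0 hy0.ne', hBθ y hy.1.le hy.2.le]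
        simp only [Pi.mul_apply]
        field_simp
      · rw [dslope_zero_of_ne hB0 hz0.ne', hBθ z hz.1.le hz.2.le]
        ring
  rw [intervalIntegral.integral_add hi1 hi2, h1, hs0, zero_mul, mul_zero, sub_zero,
    dslope_zero_of_ne hB0 (hpos b hb le_rfl).ne', hBθ b hb.le le_rfl] at h2
  have := (hpos b hb le_rfl).ne'
  rw [← mul_assoc, div_mul_cancel₀ _ this] at h2
  linarith

theorem integral_dslope_arcsin : ∫ u in (0)..1, dslope arcsin 0 u = π / 2 * log 2 := by
  have h := integral_dslope_of_parametrization (B := arcsin) (s := sin) (s' := cos) (θ := id)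
    (θ' := fun _ => 1) (b := π / 2) (by positivity) continuous_arcsin
    (differentiableAt_arcsin.2 ⟨by norm_num, by norm_num⟩) arcsin_zero hasDerivAt_sin continuous_cos
    sin_zero (fun z h0 h1 => sin_pos_of_pos_of_lt_pi h0 (by linarith [pi_pos])) hasDerivAt_id
    continuous_const (fun z h0 h1 => arcsin_sin (by linarith [pi_pos]) h1) intervalIntegrable_log_sin
  simp only [sin_pi_div_two, one_mul, integral_log_sin_zero_pi_div_two, log_one, mul_zero] at h
  rw [h]
  ring

theorem integral_dslope_arcsin_of_one_le {X : ℝ} (hX : 1 ≤ X) :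
    ∫ u in (0)..X, dslope arcsin 0 u = π / 2 * log (2 * X) := by
  have hc := continuous_dslope_zero continuous_arcsin
    (differentiableAt_arcsin.2 ⟨by norm_num, by norm_num⟩)
  rw [← intervalIntegral.integral_add_adjacent_intervals (hc.intervalIntegrable 0 1)
    (hc.intervalIntegrable 1 X), integral_dslope_arcsin, log_mul two_ne_zero (by positivity), mul_add]
  congr 1
  have h : ∀ u ∈ Set.uIcc 1 X, dslope arcsin 0 u = π / 2 * (1 / u) := fun u hu => by
    rw [Set.uIcc_of_le hX] at hu
    have : u ≠ 0 := by linarith [hu.1]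
    rw [dslope_zero_of_ne arcsin_zero this, arcsin_of_one_le hu.1]
    ring
  rw [intervalIntegral.integral_congr h, intervalIntegral.integral_const_mul, integral_one_div_of_pos
    one_pos (by positivity), div_one]

theorem hasDerivAt_cube_div_two (s : ℝ) : HasDerivAt (fun s : ℝ => s ^ 3 / 2) (3 * s ^ 2 / 2) s := by
  simpa using (hasDerivAt_pow 3 s).div_const 2

theorem differentiableAt_arcsin_cube : DifferentiableAt ℝ (fun s => arcsin (s ^ 3 / 2)) 0 := by
  have h : DifferentiableAt ℝ arcsin ((0 : ℝ) ^ 3 / 2) :=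
    differentiableAt_arcsin.2 ⟨by norm_num, by norm_num⟩
  exact DifferentiableAt.comp (f := fun s : ℝ => s ^ 3 / 2) 0 h
    (hasDerivAt_cube_div_two 0).differentiableAt

theorem integral_dslope_arcsin_cube {S : ℝ} (hS : 2 ≤ S ^ 3) :
    ∫ s in (0)..S, dslope (fun s => arcsin (s ^ 3 / 2)) 0 s = π / 2 * log S := by
  have hc := continuous_dslope_zero continuous_arcsin
    (differentiableAt_arcsin.2 ⟨by norm_num, by norm_num⟩)
  have h := intervalIntegral.integral_comp_mul_deriv (a := 0) (b := S)
    (fun z _ => hasDerivAt_cube_div_two z) (by fun_prop) hc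
  rw [zero_pow three_ne_zero, zero_div, integral_dslope_arcsin_of_one_le (by linarith),
    mul_div_cancel₀ _ two_ne_zero, log_pow] at h
  have e : ∀ s ∈ Set.uIcc 0 S, (dslope arcsin 0 ∘ fun s => s ^ 3 / 2) s * (3 * s ^ 2 / 2) =
      3 * dslope (fun s => arcsin (s ^ 3 / 2)) 0 s := fun s _ => by
    rcases eq_or_ne s 0 with rfl | hs
    · have h1 : HasDerivAt (fun s => arcsin (s ^ 3 / 2)) (1 / √(1 - ((0 : ℝ) ^ 3 / 2) ^ 2) *
          (3 * (0 : ℝ) ^ 2 / 2)) 0 :=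
        HasDerivAt.comp (h := fun s : ℝ => s ^ 3 / 2) (0 : ℝ)
          (hasDerivAt_arcsin (by norm_num) (by norm_num)) (hasDerivAt_cube_div_two 0)
      rw [dslope_same, h1.deriv]
      ring
    · rw [Function.comp_apply, dslope_zero_of_ne arcsin_zero (by positivity),
        dslope_zero_of_ne (by norm_num) hs]
      field_simp
  rw [intervalIntegral.integral_congr e, intervalIntegral.integral_const_mul] at h
  push_cast at h
  linarith

end DslopeIntegral

section LogSineFourier

theorem integral_cos_two_pi_mul (n : ℕ) (hn : n ≠ 0) :
    ∫ z in (0 : ℝ)..(1 / 2), cos (2 * π * n * z) = 0 := by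
  have h0 : 2 * π * (n : ℝ) ≠ 0 := by positivity
  rw [intervalIntegral.integral_comp_mul_left (fun x => cos x) h0, integral_cos, mul_zero, sin_zero,
    show 2 * π * (n : ℝ) * (1 / 2) = n * π by ring, sin_nat_mul_pi, sub_zero, smul_zero]

theorem intervalIntegrable_log_two_mul_sin (a b : ℝ) :
    IntervalIntegrable (fun z => log (2 * sin (π * z))) MeasureTheory.volume a b := by
  have h : AnalyticOnNhd ℝ (fun z => 2 * sin (π * z)) Set.univ := fun z _ => by fun_prop
  exact MeromorphicOn.intervalIntegrable_log fun z _ => (h z trivial).meromorphicAt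

theorem intervalIntegrable_log_sin_mul_cos (n : ℕ) (a b : ℝ) :
    IntervalIntegrable (fun z => log (2 * sin (π * z)) * cos (2 * π * n * z))
      MeasureTheory.volume a b :=
  (intervalIntegrable_log_two_mul_sin a b).mul_continuousOn (by fun_prop)

theorem sin_two_mul_eq_sum (n : ℕ) (x : ℝ) :
    sin (2 * n * x) = 2 * sin x * ∑ j ∈ Finset.range n, cos ((2 * j + 1) * x) := by
  induction n with
  | zero => simp
  | succ n ih =>
    rw [Finset.sum_range_succ, mul_add, ← ih]
    have h1 : 2 * ((n + 1 : ℕ) : ℝ) * x = (2 * n + 1) * x + x := by push_cast; ring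
    have h2 : 2 * (n : ℝ) * x = (2 * n + 1) * x - x := by ring
    rw [h1, h2, sin_add, sin_sub]
    ring

theorem integral_cos_mul_sum (n : ℕ) (hn : n ≠ 0) : ∫ z in (0 : ℝ)..(1 / 2),
    2 * cos (π * z) * ∑ j ∈ Finset.range n, cos ((2 * j + 1) * (π * z)) = 1 / 2 := by
  have h : ∀ z : ℝ, 2 * cos (π * z) * ∑ j ∈ Finset.range n, cos ((2 * j + 1) * (π * z)) =
      ∑ j ∈ Finset.range n, (cos (2 * π * (j + 1 : ℕ) * z) + cos (2 * π * j * z)) := fun z => by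
    rw [Finset.mul_sum]
    refine Finset.sum_congr rfl fun j _ => ?_
    have h1 : 2 * π * ((j + 1 : ℕ) : ℝ) * z = (2 * j + 1) * (π * z) + π * z := by push_cast; ring
    have h2 : 2 * π * (j : ℝ) * z = (2 * j + 1) * (π * z) - π * z := by ring
    rw [h1, h2, cos_add, cos_sub]
    ring
  simp_rw [h]
  rw [intervalIntegral.integral_finsetSum fun j _ => by
    apply Continuous.intervalIntegrable
    fun_prop]
  have h3 : ∀ j : ℕ, ∫ z in (0 : ℝ)..(1 / 2), (cos (2 * π * (j + 1 : ℕ) * z) + cos (2 * π * j * z)) =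
      if j = 0 then 1 / 2 else 0 := fun j => by
    rw [intervalIntegral.integral_add (by apply Continuous.intervalIntegrable; fun_prop)
      (by apply Continuous.intervalIntegrable; fun_prop),
      integral_cos_two_pi_mul _ (Nat.succ_ne_zero j), zero_add]
    split_ifs with hj
    · simp [hj]
    · exact integral_cos_two_pi_mul j hj
  simp_rw [h3]
  rw [Finset.sum_ite_eq' _ 0 _, if_pos (Finset.mem_range.2 (Nat.pos_of_ne_zero hn))]

theorem integral_log_sin_mul_cos (n : ℕ) (hn : n ≠ 0) :
    ∫ z in (0 : ℝ)..(1 / 2), log (2 * sin (π * z)) * cos (2 * π * n * z) = -(1 / (4 * n)) := by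
  have hn0 : (n : ℝ) ≠ 0 := Nat.cast_ne_zero.2 hn
  have hpi := pi_pos.ne'
  set D : ℝ → ℝ := fun z => ∑ j ∈ Finset.range n, cos ((2 * j + 1) * (π * z)) with hD
  have hDc : Continuous D := by fun_prop
  have hcont : Continuous fun z => 2 * sin (π * z) := by fun_prop
  have hi1 := intervalIntegrable_log_sin_mul_cos n 0 (1 / 2)
  have hi2 : IntervalIntegrable (fun z => 1 / (2 * n) * (2 * cos (π * z) * D z))
      MeasureTheory.volume 0 (1 / 2) := by
    apply Continuous.intervalIntegrable
    fun_prop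
  have hsin : ∀ z, sin (2 * π * n * z) = 2 * sin (π * z) * D z := fun z => by
    rw [← sin_two_mul_eq_sum]
    congr 1
    ring
  have h2 : ∫ z in (0)..(1 / 2), (log (2 * sin (π * z)) * cos (2 * π * n * z) +
      1 / (2 * n) * (2 * cos (π * z) * D z)) =
      1 / (2 * π * n) * (D (1 / 2) * (2 * sin (π * (1 / 2)) * log (2 * sin (π * (1 / 2))))) -
      1 / (2 * π * n) * (D 0 * (2 * sin (π * 0) * log (2 * sin (π * 0)))) := by
    refine intervalIntegral.integral_eq_sub_of_hasDerivAt_of_le (by norm_num)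
      (f := fun z => 1 / (2 * π * n) * (D z * (2 * sin (π * z) * log (2 * sin (π * z))))) ?_
      (fun z hz => ?_) (hi1.add hi2)
    · exact (continuous_const.mul (hDc.mul (continuous_mul_log.comp hcont))).continuousOn
    · have hz0 : 0 < sin (π * z) := sin_pos_of_pos_of_lt_pi (mul_pos pi_pos hz.1)
        (by nlinarith [pi_pos, hz.2])
      have e1 : HasDerivAt (fun z => 2 * sin (π * z)) (2 * (cos (π * z) * π)) z := by
        simpa using ((hasDerivAt_id' z).const_mul π).sin.const_mul 2
      have e2 : HasDerivAt (fun z => sin (2 * π * n * z)) (cos (2 * π * n * z) * (2 * π * n)) z := by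
        simpa using (((hasDerivAt_id' z).const_mul (2 * π * n)).sin)
      have e3 := ((e2.mul (e1.log (by positivity))).const_mul (1 / (2 * π * n)))
      refine (e3.congr_of_eventuallyEq (Eventually.of_forall fun y => ?_)).congr_deriv ?_
      · simp only [Pi.mul_apply, hsin]
        ring
      · rw [hsin]
        field_simp
  have hz : 2 * sin (π * (1 / 2)) * D (1 / 2) = 0 := by
    rw [← hsin, show 2 * π * (n : ℝ) * (1 / 2) = n * π by ring, sin_nat_mul_pi]
  rw [intervalIntegral.integral_add hi1 hi2, intervalIntegral.integral_const_mul,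
    integral_cos_mul_sum n hn, mul_zero, sin_zero] at h2
  have h4 : 1 / (4 * (n : ℝ)) = 1 / (2 * n) * (1 / 2) := by
    field_simp
    norm_num
  rw [h4]
  linear_combination h2 + 1 / (2 * π * n) * log (2 * sin (π * (1 / 2))) * hz

theorem integral_log_two_mul_sin : ∫ z in (0 : ℝ)..(1 / 2), log (2 * sin (π * z)) = 0 := by
  have h : ∫ z in (0 : ℝ)..(1 / 2), log (2 * sin (π * z)) =
      ∫ z in (0 : ℝ)..(1 / 2), (log 2 + log (sin (π * z))) := by
    refine intervalIntegral.integral_congr_ae (Eventually.of_forall fun z hz => ?_)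
    rw [Set.uIoc_of_le (by norm_num)] at hz
    have hz0 : 0 < sin (π * z) := sin_pos_of_pos_of_lt_pi (mul_pos pi_pos hz.1)
      (by nlinarith [pi_pos, hz.2])
    exact log_mul two_ne_zero hz0.ne'
  have hi : IntervalIntegrable (fun z => log (sin (π * z))) MeasureTheory.volume 0 (1 / 2) := by
    have h : AnalyticOnNhd ℝ (fun z => sin (π * z)) Set.univ := fun z _ => by fun_prop
    exact MeromorphicOn.intervalIntegrable_log fun z _ => (h z trivial).meromorphicAt
  rw [h, intervalIntegral.integral_add intervalIntegrable_const hi, intervalIntegral.integral_const,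
    intervalIntegral.integral_comp_mul_left (fun x => log (sin x)) pi_pos.ne', mul_zero, mul_one_div,
    integral_log_sin_zero_pi_div_two, smul_eq_mul, smul_eq_mul]
  have := pi_pos.ne'
  field_simp
  ring

theorem integral_cos_mul_cos (m n : ℕ) (hm : m ≠ 0) :
    ∫ z in (0 : ℝ)..(1 / 2), cos (2 * π * m * z) * cos (2 * π * n * z) =
      if m = n then 1 / 4 else 0 := by
  have h : ∀ z : ℝ, cos (2 * π * m * z) * cos (2 * π * n * z) = 1 / 2 *
      (cos (2 * π * (m + n : ℕ) * z) + cos (2 * π * ((m : ℤ) - n).natAbs * z)) := fun z => by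
    have h1 : 2 * π * ((m + n : ℕ) : ℝ) * z = 2 * π * m * z + 2 * π * n * z := by push_cast; ring
    have h2 : cos (2 * π * (((m : ℤ) - n).natAbs : ℝ) * z) = cos (2 * π * m * z - 2 * π * n * z) := by
      rw [Nat.cast_natAbs, ← cos_abs, ← cos_abs (_ - _)]
      congr 1
      rw [show 2 * π * (m : ℝ) * z - 2 * π * n * z = 2 * π * (m - n) * z by ring]
      simp only [abs_mul]
      push_cast
      rw [abs_abs]
    rw [h1, h2, cos_add, cos_sub]
    ring
  simp_rw [h]
  rw [intervalIntegral.integral_const_mul, intervalIntegral.integral_add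
    (by apply Continuous.intervalIntegrable; fun_prop)
    (by apply Continuous.intervalIntegrable; fun_prop), integral_cos_two_pi_mul _ (by omega), zero_add]
  split_ifs with hmn
  · subst hmn
    norm_num
  · rw [integral_cos_two_pi_mul _ (by omega), mul_zero]

theorem hasSum_integral_mul_cos {f : ℝ → ℝ} {c : ℕ → ℝ} (hc : Summable fun m => |c m|)
    (hf : IntervalIntegrable f MeasureTheory.volume 0 (1 / 2)) :
    HasSum (fun m : ℕ => c m * ∫ z in (0 : ℝ)..(1 / 2), f z * cos (2 * π * (m + 1 : ℕ) * z))
      (∫ z in (0 : ℝ)..(1 / 2), f z * ∑' m : ℕ, c m * cos (2 * π * (m + 1) * z)) := by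
  have h := intervalIntegral.hasSum_integral_of_dominated_convergence (μ := MeasureTheory.volume)
    (a := 0) (b := 1 / 2) (F := fun (m : ℕ) z => c m * (f z * cos (2 * π * (m + 1 : ℕ) * z)))
    (f := fun z => f z * ∑' m : ℕ, c m * cos (2 * π * (m + 1) * z))
    (fun m z => |c m| * |f z|) (fun m => ?_) (fun m => Eventually.of_forall fun z _ => ?_)
    (Eventually.of_forall fun z _ => hc.mul_right _) ?_ (Eventually.of_forall fun z _ => ?_)
  · simpa only [intervalIntegral.integral_const_mul] using h
  · have hm : IntervalIntegrable (fun z => c m * (f z * cos (2 * π * (m + 1 : ℕ) * z)))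
        MeasureTheory.volume 0 (1 / 2) :=
      (hf.mul_continuousOn (g := fun z => cos (2 * π * (m + 1 : ℕ) * z)) (by fun_prop)).const_mul (c m)
    exact (intervalIntegrable_iff.1 hm).aestronglyMeasurable
  · rw [norm_mul, norm_mul, Real.norm_eq_abs, Real.norm_eq_abs]
    gcongr
    exact mul_le_of_le_one_right (abs_nonneg _) (abs_cos_le_one _)
  · simp only [tsum_mul_right]
    exact hf.abs.const_mul _
  · refine ((summable_mul_cos hc z).hasSum.mul_left (f z)).congr_fun fun m => ?_
    push_cast
    ring

end LogSineFourier

section HesseIntegral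

theorem continuous_evenPart {ϱ : ℝ} (hϱ : |ϱ| < 1) : Continuous (evenPart ϱ) :=
  continuous_tsum_cos (summable_abs_of_succ_mul (summable_succ_mul_abs_evenCoeff hϱ))

theorem summable_abs_two_pi_mul {c : ℕ → ℝ} (hc : Summable fun m : ℕ => ((m : ℝ) + 1) * |c m|) :
    Summable fun m : ℕ => |2 * π * (m + 1) * c m| := by
  refine (hc.mul_left (2 * π)).congr fun m => ?_
  rw [abs_mul, abs_of_pos (by positivity : 0 < 2 * π * ((m : ℝ) + 1))]
  ring

/-- The derivative of `hesseAngle`. -/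
noncomputable def hesseAngleDeriv (z : ℝ) : ℝ :=
  π + 3 * ∑' m : ℕ, 2 * π * (m + 1) * oddCoeff (-nome) m * cos (2 * π * (m + 1) * z)

theorem hasDerivAt_hesseAngle (z : ℝ) : HasDerivAt hesseAngle (hesseAngleDeriv z) z := by
  have h := hasDerivAt_tsum_sin (summable_succ_mul_abs_oddCoeff abs_neg_nome_lt_one) z
  exact (((hasDerivAt_id' z).const_mul π).add (h.const_mul 3)).congr_deriv
    (by rw [hesseAngleDeriv, mul_one])

theorem continuous_hesseAngleDeriv : Continuous hesseAngleDeriv :=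
  continuous_const.add (continuous_const.mul (continuous_tsum_cos
    (summable_abs_two_pi_mul (summable_succ_mul_abs_oddCoeff abs_neg_nome_lt_one))))

theorem exists_hasDerivAt_hesseRadius :
    ∃ s' : ℝ → ℝ, (∀ z, HasDerivAt hesseRadius (s' z) z) ∧ Continuous s' := by
  have hs := summable_succ_mul_abs_evenCoeff abs_neg_nome_lt_one
  have hd := hasDerivAt_tsum_cos hs
  have hE : Continuous (evenPart (-nome)) := continuous_evenPart abs_neg_nome_lt_one
  have hE' : Continuous fun z : ℝ => ∑' m : ℕ,
      (-(2 * π * (m + 1) * evenCoeff (-nome) m)) * sin (2 * π * (m + 1) * z) :=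
    continuous_tsum_sin (by simpa only [abs_neg] using summable_abs_two_pi_mul hs)
  refine ⟨_, fun z => (((((hasDerivAt_id' z).const_mul π).sin).const_mul
    (2 * rexp (-(π / √15) / 3))).mul (hd z).exp), ?_⟩
  change Continuous fun z => _ * rexp (evenPart (-nome) z) + _ * (rexp (evenPart (-nome) z) * _)
  fun_prop

theorem log_hesseRadius {z : ℝ} (hz : 0 < z) (hz1 : z < 1) : log (hesseRadius z) =
    -(π / √15) / 3 + log (2 * sin (π * z)) + evenPart (-nome) z := by
  have h : 0 < sin (π * z) := sin_pos_of_pos_of_lt_pi (by positivity) (by nlinarith [pi_pos])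
  rw [hesseRadius, log_mul (by positivity) (exp_ne_zero _), log_exp,
    show 2 * rexp (-(π / √15) / 3) * sin (π * z) = rexp (-(π / √15) / 3) * (2 * sin (π * z)) by ring,
    log_mul (exp_ne_zero _) (by positivity), log_exp]

/-- The expression for `log ∘ hesseRadius` on the open unit interval. -/
noncomputable def hesseLog (z : ℝ) : ℝ :=
  -(π / √15) / 3 + log (2 * sin (π * z)) + evenPart (-nome) z

theorem intervalIntegrable_hesseLog : IntervalIntegrable hesseLog MeasureTheory.volume 0 (1 / 2) :=
  (intervalIntegrable_const.add (intervalIntegrable_log_two_mul_sin 0 (1 / 2))).add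
    ((continuous_evenPart abs_neg_nome_lt_one).intervalIntegrable _ _)

theorem log_hesseRadius_eq_hesseLog {z : ℝ} (hz : z ∈ Set.uIoc (0 : ℝ) (1 / 2)) :
    log (hesseRadius z) = hesseLog z := by
  rw [Set.uIoc_of_le (by norm_num)] at hz
  exact log_hesseRadius hz.1 (by linarith [hz.2])

theorem intervalIntegrable_log_hesseRadius :
    IntervalIntegrable (fun z => log (hesseRadius z)) MeasureTheory.volume 0 (1 / 2) :=
  intervalIntegrable_hesseLog.congr fun _ hz => (log_hesseRadius_eq_hesseLog hz).symm

theorem integral_evenPart_mul_cos {ϱ : ℝ} (hϱ : |ϱ| < 1) (n : ℕ) :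
    ∫ z in (0 : ℝ)..(1 / 2), evenPart ϱ z * cos (2 * π * (n + 1 : ℕ) * z) = evenCoeff ϱ n / 4 := by
  have h := hasSum_integral_mul_cos (f := fun z => cos (2 * π * (n + 1 : ℕ) * z))
    (summable_abs_of_succ_mul (summable_succ_mul_abs_evenCoeff hϱ))
    (by apply Continuous.intervalIntegrable; fun_prop)
  have h2 : ∀ m : ℕ, ∫ z in (0 : ℝ)..(1 / 2), cos (2 * π * (n + 1 : ℕ) * z) *
      cos (2 * π * (m + 1 : ℕ) * z) = if m = n then 1 / 4 else 0 := fun m => by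
    rw [integral_cos_mul_cos _ _ n.succ_ne_zero]
    exact if_congr (by omega) rfl rfl
  simp only [h2] at h
  have h3 := h.unique (hasSum_single n fun m hm => by rw [if_neg hm, mul_zero])
  rw [if_pos rfl] at h3
  simp only [evenPart]
  simp_rw [mul_comm (tsum _)]
  rw [h3]
  ring

theorem integral_evenPart {ϱ : ℝ} (hϱ : |ϱ| < 1) :
    ∫ z in (0 : ℝ)..(1 / 2), evenPart ϱ z = 0 := by
  have h := hasSum_integral_mul_cos (f := fun _ => 1)
    (summable_abs_of_succ_mul (summable_succ_mul_abs_evenCoeff hϱ)) intervalIntegrable_const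
  simp only [one_mul, integral_cos_two_pi_mul _ (Nat.succ_ne_zero _), mul_zero] at h
  exact h.unique hasSum_zero

theorem integral_hesseLog : ∫ z in (0 : ℝ)..(1 / 2), hesseLog z = -(π / √15) / 6 := by
  have hE := (continuous_evenPart abs_neg_nome_lt_one).intervalIntegrable (μ := MeasureTheory.volume)
    0 (1 / 2)
  have hl := intervalIntegrable_log_two_mul_sin 0 (1 / 2)
  simp only [hesseLog]
  rw [intervalIntegral.integral_add (intervalIntegrable_const.add hl) hE,
    intervalIntegral.integral_add intervalIntegrable_const hl, intervalIntegral.integral_const,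
    integral_log_two_mul_sin, integral_evenPart abs_neg_nome_lt_one, smul_eq_mul]
  ring

theorem integral_hesseLog_mul_cos (n : ℕ) :
    ∫ z in (0 : ℝ)..(1 / 2), hesseLog z * cos (2 * π * (n + 1 : ℕ) * z) =
      (evenCoeff (-nome) n - 1 / (n + 1)) / 4 := by
  have hE : IntervalIntegrable (fun z => evenPart (-nome) z * cos (2 * π * (n + 1 : ℕ) * z))
      MeasureTheory.volume 0 (1 / 2) := by
    have := continuous_evenPart abs_neg_nome_lt_one
    apply Continuous.intervalIntegrable
    fun_prop
  have hl := intervalIntegrable_log_sin_mul_cos (n + 1) 0 (1 / 2)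
  have hc : IntervalIntegrable (fun z => -(π / √15) / 3 * cos (2 * π * (n + 1 : ℕ) * z))
      MeasureTheory.volume 0 (1 / 2) := by
    apply Continuous.intervalIntegrable
    fun_prop
  simp only [hesseLog, add_mul]
  rw [intervalIntegral.integral_add (hc.add hl) hE,
    intervalIntegral.integral_add hc hl, intervalIntegral.integral_const_mul,
    integral_log_sin_mul_cos _ n.succ_ne_zero, integral_evenPart_mul_cos abs_neg_nome_lt_one,
    integral_cos_two_pi_mul _ n.succ_ne_zero]
  have : (n : ℝ) + 1 ≠ 0 := by positivity
  push_cast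
  field_simp
  ring

theorem integral_hesseAngleDeriv_mul_log :
    ∫ z in (0 : ℝ)..(1 / 2), hesseAngleDeriv z * log (hesseRadius z) =
      -(π ^ 2 / √15) / 6 - 3 * π / 2 * ∑' m : ℕ, lambertTerm ((-nome) ^ (m + 1)) / (m + 1) := by
  have hS := summable_abs_two_pi_mul (summable_succ_mul_abs_oddCoeff abs_neg_nome_lt_one)
  have hsum := hasSum_integral_mul_cos hS intervalIntegrable_hesseLog
  have hcont := continuous_tsum_cos hS
  have h1 : ∫ z in (0 : ℝ)..(1 / 2), hesseAngleDeriv z * log (hesseRadius z) =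
      ∫ z in (0 : ℝ)..(1 / 2), (π * hesseLog z + 3 * (hesseLog z *
        ∑' m : ℕ, 2 * π * (m + 1) * oddCoeff (-nome) m * cos (2 * π * (m + 1) * z))) := by
    refine intervalIntegral.integral_congr_ae (Eventually.of_forall fun z hz => ?_)
    simp only [log_hesseRadius_eq_hesseLog hz, hesseAngleDeriv]
    ring
  rw [h1, intervalIntegral.integral_add (intervalIntegrable_hesseLog.const_mul π)
    ((intervalIntegrable_hesseLog.mul_continuousOn hcont.continuousOn).const_mul 3),
    intervalIntegral.integral_const_mul, intervalIntegral.integral_const_mul, integral_hesseLog,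
    ← hsum.tsum_eq, ← tsum_mul_left, ← tsum_mul_left, sub_eq_add_neg, ← tsum_neg]
  congr 1
  · ring
  · refine tsum_congr fun m => ?_
    rw [integral_hesseLog_mul_cos, evenCoeff, oddCoeff, lambertTerm]
    have hQ := (one_add_add_sq_pos ((-nome) ^ (m + 1))).ne'
    generalize (-nome) ^ (m + 1) = p at hQ ⊢
    have : (m : ℝ) + 1 ≠ 0 := by positivity
    field_simp
    ring

end HesseIntegral

section ArcsinIntegral

theorem differentiableAt_arcsin_cubic (k : ℝ) :
    DifferentiableAt ℝ (fun s => arcsin ((3 * k * s - s ^ 3) / 2)) 0 := by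
  have h : DifferentiableAt ℝ arcsin ((3 * k * 0 - (0 : ℝ) ^ 3) / 2) :=
    differentiableAt_arcsin.2 ⟨by norm_num, by norm_num⟩
  exact DifferentiableAt.comp (f := fun s : ℝ => (3 * k * s - s ^ 3) / 2) 0 h (by fun_prop)

theorem lintegral_arcsin_sub {k S : ℝ} (hk : 0 ≤ k) (hS : 0 < S) (hkS : 3 * k * S + 2 ≤ S ^ 3) :
    ∫⁻ s in Set.Ioi (0 : ℝ), ENNReal.ofReal ((arcsin ((3 * k * s - s ^ 3) / 2) -
      arcsin (-s ^ 3 / 2)) / (3 * s)) = ENNReal.ofReal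
        ((∫ s in (0)..S, dslope (fun s => arcsin ((3 * k * s - s ^ 3) / 2)) 0 s) / 3 +
        (∫ s in (0)..S, dslope (fun s => arcsin (s ^ 3 / 2)) 0 s) / 3) ∧
    0 ≤ (∫ s in (0)..S, dslope (fun s => arcsin ((3 * k * s - s ^ 3) / 2)) 0 s) / 3 +
        (∫ s in (0)..S, dslope (fun s => arcsin (s ^ 3 / 2)) 0 s) / 3 := by
  set f : ℝ → ℝ := dslope (fun s => arcsin ((3 * k * s - s ^ 3) / 2)) 0 with hf
  set g : ℝ → ℝ := dslope (fun s => arcsin (s ^ 3 / 2)) 0 with hg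
  have hfc : Continuous f := continuous_dslope_zero
    (continuous_arcsin.comp (by fun_prop : Continuous fun s : ℝ => (3 * k * s - s ^ 3) / 2))
    (differentiableAt_arcsin_cubic k)
  have hgc : Continuous g := continuous_dslope_zero
    (continuous_arcsin.comp (by fun_prop : Continuous fun s : ℝ => s ^ 3 / 2))
    differentiableAt_arcsin_cube
  have heq : ∀ s, 0 < s → (arcsin ((3 * k * s - s ^ 3) / 2) - arcsin (-s ^ 3 / 2)) / (3 * s) =
      f s / 3 + g s / 3 := fun s hs => by
    rw [hf, hg, dslope_zero_of_ne (by simp) hs.ne', dslope_zero_of_ne (by simp) hs.ne', neg_div,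
      arcsin_neg]
    field_simp
    ring
  have hnonneg : ∀ s, 0 < s → 0 ≤ f s / 3 + g s / 3 := fun s hs => by
    rw [← heq s hs]
    refine div_nonneg (sub_nonneg.2 (monotone_arcsin ?_)) (by positivity)
    have : 0 ≤ 3 * k * s := by positivity
    linarith
  have hzero : ∀ s, S < s → (arcsin ((3 * k * s - s ^ 3) / 2) - arcsin (-s ^ 3 / 2)) / (3 * s) = 0 :=
    fun s hs => by
    have h1 : 2 ≤ S * (S ^ 2 - 3 * k) := by linarith
    have h2 : 0 < S ^ 2 - 3 * k := (pos_iff_pos_of_mul_pos (by linarith)).1 hS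
    have hs0 : 0 < s := hS.trans hs
    have h3 : S * (S ^ 2 - 3 * k) ≤ s * (s ^ 2 - 3 * k) := by gcongr
    have h4 : 0 ≤ 3 * k * s := by positivity
    rw [arcsin_of_le_neg_one (by linarith), arcsin_of_le_neg_one (by linarith), sub_self, zero_div]
  have hintg : ∫ s in Set.Ioc 0 S, (f s / 3 + g s / 3) = (∫ s in (0)..S, f s) / 3 +
      (∫ s in (0)..S, g s) / 3 := by
    rw [← intervalIntegral.integral_of_le hS.le, intervalIntegral.integral_add
      ((hfc.intervalIntegrable _ _).div_const 3) ((hgc.intervalIntegrable _ _).div_const 3),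
      intervalIntegral.integral_div, intervalIntegral.integral_div]
  have hae : ∀ᵐ s ∂MeasureTheory.volume.restrict (Set.Ioc 0 S), 0 ≤ f s / 3 + g s / 3 :=
    (MeasureTheory.ae_restrict_iff' measurableSet_Ioc).2
      (Eventually.of_forall fun s hs => hnonneg s hs.1)
  refine ⟨?_, ?_⟩
  · rw [← Set.Ioc_union_Ioi_eq_Ioi hS.le, MeasureTheory.lintegral_union measurableSet_Ioi
      (Set.disjoint_left.2 fun x hx hx' => not_lt.2 hx.2 hx'),
      MeasureTheory.setLIntegral_congr_fun (g := fun _ => 0) measurableSet_Ioi (fun s hs => by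
        simp only [hzero s hs, ENNReal.ofReal_zero]),
      MeasureTheory.lintegral_zero, add_zero, ← hintg,
      MeasureTheory.ofReal_integral_eq_lintegral_ofReal ?_ hae]
    · exact MeasureTheory.setLIntegral_congr_fun measurableSet_Ioc fun s hs => by
        simp only [heq s hs.1]
    · exact (((hfc.div_const 3).add (hgc.div_const 3)).integrableOn_Icc).mono_set
        Set.Ioc_subset_Icc_self
  · rw [← hintg]
    exact MeasureTheory.integral_nonneg_of_ae hae

theorem integral_dslope_hesse :
    ∫ s in (0)..((1 + √5) / 2 : ℝ) ^ ((4 : ℝ) / 3), dslope (fun s =>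
      arcsin ((3 * ((1 + √5) / 2 : ℝ) ^ (-((1 : ℝ) / 3)) * s - s ^ 3) / 2)) 0 s =
    -(π / 2) * log (((1 + √5) / 2 : ℝ) ^ ((4 : ℝ) / 3)) -
      (π ^ 2 / √15) / 6 - 3 * π / 2 * ∑' m : ℕ, lambertTerm ((-nome) ^ (m + 1)) / (m + 1) := by
  obtain ⟨s', hs, hs'⟩ := exists_hasDerivAt_hesseRadius
  have h := integral_dslope_of_parametrization (b := 1 / 2) (by norm_num)
    (continuous_arcsin.comp (by fun_prop : Continuous fun s : ℝ =>
      (3 * ((1 + √5) / 2 : ℝ) ^ (-((1 : ℝ) / 3)) * s - s ^ 3) / 2))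
    (differentiableAt_arcsin_cubic _) (by simp) hs hs' hesseRadius_zero
    (fun z hz hz1 => hesseRadius_pos hz (by linarith))
    (fun z => (hasDerivAt_hesseAngle z).neg) continuous_hesseAngleDeriv.neg
    (fun z hz hz1 => arcsin_hesseRadius hz hz1) intervalIntegrable_log_hesseRadius
  simp only [neg_mul, intervalIntegral.integral_neg, integral_hesseAngleDeriv_mul_log, Pi.neg_apply,
    hesseAngle_half, hesseRadius_half] at h
  refine Eq.trans h ?_
  ring

theorem hypergeometric_golden {k : ℝ} (hk : k = ((1 + √5) / 2 : ℝ) ^ (-((1 : ℝ) / 3))) :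
    Gamma (1 / 3) ^ 2 / Gamma (2 / 3) * k * (∑' n, hypTerm (1 / 3) n * (k ^ 3) ^ n) +
      Gamma (2 / 3) ^ 2 / Gamma (4 / 3) * (k ^ 2 / 2) * ∑' n, hypTerm (2 / 3) n * (k ^ 3) ^ n =
    4 * √3 * π * (-(π * √15 / 270) -
      1 / 2 * ∑' m : ℕ, lambertTerm ((-nome) ^ (m + 1)) / (m + 1)) := by
  have hφ : 1 < (1 + √5) / 2 := one_lt_goldenRatio
  have hk0 : 0 < k := hk ▸ rpow_pos_of_pos (by positivity) _
  have hk1 : k < 1 := hk ▸ rpow_lt_one_of_one_lt_of_neg hφ (by norm_num)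
  have hmul := golden_rpow_mul
  have hcube := golden_rpow_four_thirds_pow
  have hI := integral_dslope_hesse
  have hS : 0 < ((1 + √5) / 2 : ℝ) ^ ((4 : ℝ) / 3) := rpow_pos_of_pos (by positivity) _
  rw [← hk] at hmul hI
  obtain ⟨h1, h2⟩ := lintegral_arcsin_sub hk0.le hS (by
    rw [hcube, mul_assoc, hmul])
  have h3 := hypergeometric_eq_lintegral_arcsin hk0 hk1
  rw [hI, integral_dslope_arcsin_cube (by rw [hcube]; linarith)] at h1 h2
  rw [h1, ← ENNReal.ofReal_mul (by positivity), ENNReal.ofReal_eq_ofReal_iff ?_ (by positivity)] at h3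
  · rw [h3]
    have h15 : √15 ≠ 0 := by positivity
    have e : π ^ 2 / √15 = π ^ 2 * √15 / 15 := by
      rw [div_eq_div_iff h15 (by norm_num), mul_assoc, mul_self_sqrt (by norm_num)]
    rw [e]
    ring
  · have hsum : ∀ a : ℝ, 0 < a → 0 ≤ ∑' n, hypTerm a n * (k ^ 3) ^ n := fun a ha =>
      tsum_nonneg fun n => mul_nonneg (hypTerm_pos ha n).le (by positivity)
    have e1 := hsum (1 / 3) (by norm_num)
    have e2 := hsum (2 / 3) (by norm_num)
    have g1 := Gamma_pos_of_pos (by norm_num : (0 : ℝ) < 1 / 3)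
    have g2 := Gamma_pos_of_pos (by norm_num : (0 : ℝ) < 2 / 3)
    have g3 := Gamma_pos_of_pos (by norm_num : (0 : ℝ) < 4 / 3)
    positivity

end ArcsinIntegral

section GammaConstants

theorem Gamma_one_third_mul_Gamma_two_thirds : Gamma (1 / 3) * Gamma (2 / 3) = 2 * π / √3 := by
  have h := Gamma_mul_Gamma_one_sub (1 / 3)
  rw [show (1 : ℝ) - 1 / 3 = 2 / 3 by norm_num, show π * (1 / 3) = π / 3 by ring,
    sin_pi_div_three] at h
  rw [h]
  field_simp

theorem Gamma_one_sixth_mul_Gamma_two_thirds :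
    Gamma (1 / 6) * Gamma (2 / 3) = Gamma (1 / 3) * 2 ^ ((2 : ℝ) / 3) * √π := by
  have h := Gamma_mul_Gamma_add_half (1 / 6)
  norm_num at h
  norm_num
  exact h

theorem gamma_constant_one_third :
    2 ^ ((1 : ℝ) / 3) * Gamma (1 / 6) * Gamma (1 / 3) * Gamma (1 / 2) / (8 * √3 * π ^ 2) =
      Gamma (1 / 3) ^ 2 / Gamma (2 / 3) / (4 * √3 * π) := by
  have h := Gamma_one_sixth_mul_Gamma_two_thirds
  have g2 := (Gamma_pos_of_pos (by norm_num : (0 : ℝ) < 2 / 3)).ne'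
  have h2 : (2 : ℝ) ^ ((1 : ℝ) / 3) * 2 ^ ((2 : ℝ) / 3) = 2 := by
    rw [← rpow_add two_pos]
    norm_num
  have hpi : √π * √π = π := mul_self_sqrt pi_pos.le
  rw [Gamma_one_half_eq, div_div, div_eq_div_iff (by positivity) (by positivity)]
  generalize (2 : ℝ) ^ ((1 : ℝ) / 3) = u at *
  generalize (2 : ℝ) ^ ((2 : ℝ) / 3) = v at *
  generalize Gamma (1 / 3) = x at *
  generalize Gamma (1 / 6) = y at *
  generalize Gamma (2 / 3) = w at *
  linear_combination 4 * √3 * π * u * x * √π * h + 4 * √3 * π * x ^ 2 * √π ^ 2 * h2 +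
    8 * √3 * π * x ^ 2 * hpi

theorem gamma_constant_two_thirds :
    3 * (Gamma (2 / 3) ^ 3 / (16 * π ^ 2)) =
      Gamma (2 / 3) ^ 2 / Gamma (4 / 3) / 2 / (4 * √3 * π) := by
  have h := Gamma_one_third_mul_Gamma_two_thirds
  have g1 := Gamma_pos_of_pos (by norm_num : (0 : ℝ) < 1 / 3)
  have h4 : Gamma (4 / 3) = 1 / 3 * Gamma (1 / 3) := by
    rw [← Gamma_add_one (by norm_num)]
    norm_num
  rw [eq_div_iff (by positivity)] at h
  rw [h4, div_div, div_div, mul_div_assoc', div_eq_div_iff (by positivity) (by positivity)]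
  generalize Gamma (1 / 3) = x at *
  generalize Gamma (2 / 3) = w at *
  linear_combination 8 * π * w ^ 2 * h

end GammaConstants

/-- With `φ` the golden ratio, the box limit defining `F(1,5,5,5)` exists and
`(225/(32√5 π²)) F(1,5,5,5) = (A/φ^{1/3}) ₃F₂(1/3,1/3,1/3;2/3,4/3;1/φ)
  + (3B/φ^{2/3}) ₃F₂(2/3,2/3,2/3;4/3,5/3;1/φ)`, both series being convergent. -/
theorem stmt_19 (φ A B : ℝ)
    (hφ : φ = (1 + Real.sqrt 5)/2)
    (hA : A = 2^((1:ℝ)/3) * Real.Gamma (1/6) * Real.Gamma (1/3) * Real.Gamma (1/2)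
      / (8 * Real.sqrt 3 * π^2))
    (hB : B = Real.Gamma (2/3)^3 / (16*π^2)) :
    Summable (fun n : ℕ =>
      (poch (1/3) n)^3 / (poch (2/3) n * poch (4/3) n * (n.factorial : ℝ)) * (1/φ)^n) ∧
    Summable (fun n : ℕ =>
      (poch (2/3) n)^3 / (poch (4/3) n * poch (5/3) n * (n.factorial : ℝ)) * (1/φ)^n) ∧
    ∃ L : ℝ, Tendsto (fun v => (1+5+5+5:ℝ)^2 * boxSum 1 5 5 5 v) atTop (𝓝 L) ∧
      225/(32*Real.sqrt 5*π^2) * L =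
        A/φ^((1:ℝ)/3) * (∑' n : ℕ,
          (poch (1/3) n)^3 / (poch (2/3) n * poch (4/3) n * (n.factorial : ℝ)) * (1/φ)^n)
        + 3*B/φ^((2:ℝ)/3) * (∑' n : ℕ,
          (poch (2/3) n)^3 / (poch (4/3) n * poch (5/3) n * (n.factorial : ℝ)) * (1/φ)^n) := by
  have h1φ : 1 < φ := hφ ▸ one_lt_goldenRatio
  have h0φ : 0 < φ := one_pos.trans h1φ
  have hx0 : 0 ≤ 1 / φ := by positivity
  have hx1 : 1 / φ < 1 := (div_lt_one h0φ).2 h1φ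
  have e1 : ∀ n : ℕ, (poch (1/3) n)^3 / (poch (2/3) n * poch (4/3) n * (n.factorial : ℝ)) =
      hypTerm (1 / 3) n := fun n => by
    rw [hypTerm, show (2 : ℝ) * (1 / 3) = 2 / 3 by norm_num, show (1 : ℝ) / 3 + 1 = 4 / 3 by norm_num]
  have e2 : ∀ n : ℕ, (poch (2/3) n)^3 / (poch (4/3) n * poch (5/3) n * (n.factorial : ℝ)) =
      hypTerm (2 / 3) n := fun n => by
    rw [hypTerm, show (2 : ℝ) * (2 / 3) = 4 / 3 by norm_num, show (2 : ℝ) / 3 + 1 = 5 / 3 by norm_num]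
  simp only [e1, e2]
  refine ⟨summable_hypTerm (by norm_num) (by norm_num) hx0 hx1,
    summable_hypTerm (by norm_num) (by norm_num) hx0 hx1, _, tendsto_boxSum.const_mul _, ?_⟩
  have hk := hypergeometric_golden rfl
  rw [← hφ] at hk
  have hk3 : (φ ^ (-((1 : ℝ) / 3))) ^ 3 = 1 / φ := by
    rw [← rpow_natCast, ← rpow_mul h0φ.le, one_div]
    norm_num
    exact rpow_neg_one φ
  have hk1 : φ ^ (-((1 : ℝ) / 3)) = (φ ^ ((1 : ℝ) / 3))⁻¹ := rpow_neg h0φ.le _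
  have hk2 : (φ ^ (-((1 : ℝ) / 3))) ^ 2 = (φ ^ ((2 : ℝ) / 3))⁻¹ := by
    rw [← rpow_natCast, ← rpow_mul h0φ.le, ← rpow_neg h0φ.le]
    norm_num
  rw [hk3, hk2, hk1] at hk
  rw [lattice_eq_lambert, hA, hB, gamma_constant_one_third, gamma_constant_two_thirds]
  have hc : 4 * √3 * π ≠ 0 := by positivity
  refine mul_left_cancel₀ hc (hk.symm.trans ?_)
  generalize (∑' n, hypTerm (1 / 3) n * (1 / φ) ^ n) = X
  generalize (∑' n, hypTerm (2 / 3) n * (1 / φ) ^ n) = Y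
  generalize Gamma (1 / 3) ^ 2 / Gamma (2 / 3) = U
  generalize Gamma (2 / 3) ^ 2 / Gamma (4 / 3) = V
  generalize 4 * √3 * π = c at hc
  field_simp
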